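/- arXiv:2504.14711 — 3 statements merged into one kernel-verified Lean document; each statement's English description precedes it below -/
import Mathlib

section
/- Let k, m be positive integers and let H be a simple directed graph on n = km vertices such that d⁻(v) + d⁺(v) ≥ 2n(1 − 1/m) − 1 for every vertex v. Then V(H) can be partitioned into k sets, each of size m, such that each set can be linearly ordered v₁, …, v_m with a directed edge from v_i to v_j present in H for all i < j (i.e., each part spans a transitive tournament). -/
namespace AcyclicColoring

open Finset Relation
open scoped Classical

variable {V α : Type*} {r : V → V → Prop}

/-- The relation `r` (for `true`) or its reverse (for `false`). -/
def dirRel (r : V → V → Prop) : Bool → V → V → Prop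
  | true => r
  | false => fun u v => r v u

theorem dirRel_not (r : V → V → Prop) (b : Bool) (u v : V) :
    dirRel r (!b) u v ↔ dirRel r b v u := by
  cases b <;> rfl

/-- The neighbours of `v` in `C` in direction `b`. -/
noncomputable def nbr (r : V → V → Prop) (b : Bool) (C : Finset V) (v : V) : Finset V :=
  C.filter (dirRel r b v)

/-- The total degree of `v` into `C`. -/
noncomputable def deg (r : V → V → Prop) (C : Finset V) (v : V) : ℕ :=
  ∑ b, (nbr r b C v).card

/-- `C` spans no directed cycle: every nonempty subset has a source or a sink. -/
def IsAcyclicOn (r : V → V → Prop) (C : Finset V) : Prop :=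
  ∀ D ⊆ C, D.Nonempty → ∃ v ∈ D, ∃ b, ∀ u ∈ D, ¬ dirRel r b v u

theorem IsAcyclicOn.mono {C D : Finset V} (h : IsAcyclicOn r C) (hD : D ⊆ C) :
    IsAcyclicOn r D := fun F hF => h F (hF.trans hD)

theorem dirRel_irrefl (hr : ∀ v, ¬ r v v) (b : Bool) (v : V) : ¬ dirRel r b v v := by
  cases b <;> exact hr v

/-- Adding `y` to an acyclic set creates a cycle only through `y`. -/
theorem exists_cycle_of_not_insert {C : Finset V} {y : V} (hC : IsAcyclicOn r C)
    (h : ¬ IsAcyclicOn r (insert y C)) :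
    ∃ D ⊆ insert y C, y ∈ D ∧ ∀ v ∈ D, ∀ b, ∃ u ∈ D, dirRel r b v u := by
  unfold IsAcyclicOn at h
  push Not at h
  obtain ⟨D, hD, hne, hcyc⟩ := h
  refine ⟨D, hD, ?_, hcyc⟩
  by_contra hy
  obtain ⟨v, hv, b, hb⟩ := hC D (fun u hu => by
    rcases mem_insert.1 (hD hu) with rfl | h
    · exact absurd hu hy
    · exact h) hne
  obtain ⟨u, hu, h⟩ := hcyc v hv b
  exact hb u hu h

theorem exists_nbr_of_not_insert (hr : ∀ v, ¬ r v v) {C : Finset V} {y : V}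
    (hC : IsAcyclicOn r C) (h : ¬ IsAcyclicOn r (insert y C)) (b : Bool) :
    ∃ z ∈ C, dirRel r b y z := by
  obtain ⟨D, hD, hy, hcyc⟩ := exists_cycle_of_not_insert hC h
  obtain ⟨u, hu, hyu⟩ := hcyc y hy b
  rcases mem_insert.1 (hD hu) with rfl | h
  · exact absurd hyu (dirRel_irrefl hr b _)
  · exact ⟨u, h, hyu⟩

theorem one_le_card_nbr (hr : ∀ v, ¬ r v v) {C : Finset V} {y : V}
    (hC : IsAcyclicOn r C) (h : ¬ IsAcyclicOn r (insert y C)) (b : Bool) :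
    1 ≤ (nbr r b C y).card := by
  obtain ⟨z, hz, hyz⟩ := exists_nbr_of_not_insert hr hC h b
  exact card_pos.2 ⟨z, mem_filter.2 ⟨hz, hyz⟩⟩

theorem two_le_deg (hr : ∀ v, ¬ r v v) {C : Finset V} {y : V}
    (hC : IsAcyclicOn r C) (h : ¬ IsAcyclicOn r (insert y C)) : 2 ≤ deg r C y := by
  have h1 := one_le_card_nbr hr hC h true
  have h2 := one_le_card_nbr hr hC h false
  simp only [deg, Fintype.sum_bool]
  omega

theorem deg_mono {C D : Finset V} (h : C ⊆ D) (v : V) : deg r C v ≤ deg r D v :=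
  sum_le_sum fun _ _ => card_le_card (filter_subset_filter _ h)

theorem deg_union {C D : Finset V} (h : Disjoint C D) (v : V) :
    deg r (C ∪ D) v = deg r C v + deg r D v := by
  simp only [deg, nbr, ← sum_add_distrib]
  refine sum_congr rfl fun b _ => ?_
  rw [filter_union, card_union_of_disjoint (disjoint_filter_filter h)]

/-- If all vertices of `B` are blocked by the acyclic set `C`, and the degrees of the vertices
of `C` are suitably bounded, then `B` is small. -/
theorem card_le_of_blocked (hr : ∀ v, ¬ r v v) {B C : Finset V} {q : ℕ}
    (hC : IsAcyclicOn r C) (hB : ∀ y ∈ B, ¬ IsAcyclicOn r (insert y C))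
    (hdeg : ∀ z ∈ C, deg r C z + deg r B z ≤ 4 * q + 1)
    (hvital : ∀ z ∈ C, (∃ y ∈ B, IsAcyclicOn r (insert y (C.erase z))) →
      deg r C z + deg r B z ≤ 2 * q + 1) :
    B.card ≤ q * C.card := by
  set O : Bool → V → Finset V := fun b y =>
    C.filter fun z => dirRel r b y z ∧ (deg r C z ≠ 0 ∨ dirRel r (!b) y z) with hO
  set wt : V → ℕ := fun z =>
    if ∃ y ∈ B, IsAcyclicOn r (insert y (C.erase z)) then 2 else 1 with hwt
  have hbad : ∀ C' ⊆ C, ∀ y, ¬ IsAcyclicOn r (insert y C') → ∀ b, ∃ z ∈ C', z ∈ O b y := by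
    intro C' hC' y hy b
    obtain ⟨D, hD, hyD, hcyc⟩ := exists_cycle_of_not_insert (hC.mono hC') hy
    obtain ⟨z, hz, hyz⟩ := hcyc y hyD b
    have hzC : z ∈ C' := by
      rcases mem_insert.1 (hD hz) with rfl | h
      · exact absurd hyz (dirRel_irrefl hr b _)
      · exact h
    refine ⟨z, hzC, mem_filter.2 ⟨hC' hzC, hyz, ?_⟩⟩
    by_contra hcon
    push Not at hcon
    obtain ⟨u, hu, hzu⟩ := hcyc z hz b
    rcases mem_insert.1 (hD hu) with rfl | h
    · exact hcon.2 ((dirRel_not r b _ _).2 hzu)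
    · have h1 : (nbr r b C z).card ≤ deg r C z :=
        single_le_sum (f := fun b => (nbr r b C z).card) (fun _ _ => Nat.zero_le _) (mem_univ b)
      have h2 : 0 < (nbr r b C z).card := card_pos.2 ⟨u, mem_filter.2 ⟨hC' h, hzu⟩⟩
      omega
  have hlow : ∀ y ∈ B, ∀ b, 2 ≤ ∑ z ∈ O b y, wt z := by
    intro y hy b
    obtain ⟨z, hzC, hz⟩ := hbad C subset_rfl y (hB y hy) b
    by_cases hcard : 2 ≤ (O b y).card
    · calc 2 ≤ ∑ z ∈ O b y, 1 := by simpa using hcard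
        _ ≤ _ := sum_le_sum fun z _ => by simp only [hwt]; split_ifs <;> omega
    · have hv : IsAcyclicOn r (insert y (C.erase z)) := by
        by_contra hcon
        obtain ⟨u, huC, hu⟩ := hbad _ (erase_subset z C) y hcon b
        exact hcard (one_lt_card.2 ⟨u, hu, z, hz, (mem_erase.1 huC).1⟩)
      have : wt z = 2 := if_pos ⟨y, hy, hv⟩
      calc 2 = wt z := this.symm
        _ ≤ _ := single_le_sum (fun _ _ => Nat.zero_le _) hz
  have hup : ∀ z ∈ C, ∀ M, deg r C z + deg r B z ≤ 2 * M + 1 →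
      ∑ y ∈ B, ∑ b, (if z ∈ O b y then 1 else 0) ≤ 2 * M := by
    intro z hz M hM
    have hdegB : deg r B z = (nbr r true B z).card + (nbr r false B z).card := by
      simp [deg]
    simp only [Fintype.sum_bool]
    simp only [sum_add_distrib, sum_boole, Nat.cast_id]
    by_cases h0 : deg r C z = 0
    · have h1 : ∀ b b', (B.filter fun y => z ∈ O b y).card ≤ (nbr r b' B z).card := by
        intro b b'
        refine card_le_card fun y hy => ?_
        simp only [hO, mem_filter, h0, ne_eq, not_true_eq_false, false_or, nbr] at hy ⊢
        refine ⟨hy.1, ?_⟩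
        have h2 := hy.2.2
        cases b <;> cases b' <;> simp_all [dirRel]
      have := h1 true true
      have := h1 true false
      have := h1 false true
      have := h1 false false
      omega
    · have h1 : ∀ b, (B.filter fun y => z ∈ O b y).card ≤ (nbr r (!b) B z).card := by
        intro b
        refine card_le_card fun y hy => ?_
        simp only [hO, mem_filter, nbr] at hy ⊢
        exact ⟨hy.1, (dirRel_not r b _ _).2 hy.2.2.1⟩
      have := h1 true
      have := h1 false
      simp only [Bool.not_true, Bool.not_false] at *
      omega
  have hkey : 4 * B.card ≤ 4 * q * C.card := by
    calc 4 * B.card = ∑ y ∈ B, ∑ _b : Bool, 2 := by simp; ring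
      _ ≤ ∑ y ∈ B, ∑ b, ∑ z ∈ O b y, wt z :=
          sum_le_sum fun y hy => sum_le_sum fun b _ => hlow y hy b
      _ = ∑ y ∈ B, ∑ z ∈ C, ∑ b, wt z * (if z ∈ O b y then 1 else 0) := by
          refine sum_congr rfl fun y _ => ?_
          rw [sum_comm]
          refine sum_congr rfl fun b _ => ?_
          simp only [mul_ite, mul_one, mul_zero]
          rw [← sum_filter]
          refine sum_congr ?_ fun _ _ => rfl
          ext z
          simp only [hO, mem_filter]
          tauto
      _ = ∑ z ∈ C, wt z * ∑ y ∈ B, ∑ b, (if z ∈ O b y then 1 else 0) := by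
          rw [sum_comm]
          simp only [mul_sum]
      _ ≤ ∑ z ∈ C, 4 * q := by
          refine sum_le_sum fun z hz => ?_
          by_cases hv : ∃ y ∈ B, IsAcyclicOn r (insert y (C.erase z))
          · have h1 : wt z = 2 := if_pos hv
            have h2 := hup z hz q (hvital z hz hv)
            rw [h1]
            omega
          · have h1 : wt z = 1 := if_neg hv
            have h2 := hup z hz (2 * q) (by have := hdeg z hz; omega)
            rw [h1]
            omega
      _ = 4 * q * C.card := by rw [sum_const, smul_eq_mul, mul_comm]
  nlinarith

/-- The relation `E` restricted to the finset `T`. -/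
def Within (T : Finset α) (E : α → α → Prop) (a b : α) : Prop := a ∈ T ∧ b ∈ T ∧ E a b

/-- A vertex `c ≠ c₀` from which `c₀` is reachable has an out-neighbour from which `c₀` is
reachable without returning to `c`. -/
theorem exists_step_avoiding {T : Finset α} {E : α → α → Prop} {c c₀ : α}
    (h : ReflTransGen (Within T E) c c₀) (hne : c ≠ c₀) :
    ∃ d ∈ T.erase c, E c d ∧ ReflTransGen (Within (T.erase c) E) d c₀ := by
  have key : ∀ x, ReflTransGen (Within T E) x c₀ →
      (x ≠ c ∧ ReflTransGen (Within (T.erase c) E) x c₀) ∨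
        ∃ d ∈ T.erase c, E c d ∧ ReflTransGen (Within (T.erase c) E) d c₀ := by
    intro x hx
    induction hx using ReflTransGen.head_induction_on with
    | refl => exact Or.inl ⟨hne.symm, .refl⟩
    | head hxy hy ih =>
      rename_i x y
      rcases ih with ⟨hyc, hyr⟩ | h
      · by_cases hxc : x = c
        · subst hxc
          exact Or.inr ⟨y, mem_erase.2 ⟨hyc, hxy.2.1⟩, hxy.2.2, hyr⟩
        · exact Or.inl ⟨hxc, .head ⟨mem_erase.2 ⟨hxc, hxy.1⟩, mem_erase.2 ⟨hyc, hxy.2.1⟩,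
            hxy.2.2⟩ hyr⟩
      · exact Or.inr h
  rcases key c h with ⟨h, _⟩ | h
  · exact absurd rfl h
  · exact h

/-- In a digraph with more than one vertex in which every vertex reaches `c₀`, there is a
nonempty set `A'` of vertices that are not cut vertices towards `c₀`, whose only out-neighbours
outside `A'` are a single vertex `U`. -/
theorem exists_terminal_set {A : Finset α} {E : α → α → Prop} {c₀ : α} (hc₀ : c₀ ∈ A)
    (hE : ∀ c ∈ A, ReflTransGen (Within A E) c c₀) (hA : ∃ c ∈ A, c ≠ c₀) :
    ∃ U ∈ A, ∃ A' ⊆ A, A'.Nonempty ∧ U ∉ A' ∧ c₀ ∉ A' ∧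
      (∀ W ∈ A', ∀ c ∈ A, E W c → c = U ∨ c ∈ A') ∧
      ∀ W ∈ A', ∀ c ∈ A, c ≠ W → ReflTransGen (Within (A.erase W) E) c c₀ := by
  set T : α → Finset α := fun U =>
    A.filter fun c => c ≠ U ∧ ¬ ReflTransGen (Within (A.erase U) E) c c₀ with hT
  have hne : (A.filter fun U => (T U).Nonempty).Nonempty := by
    obtain ⟨c, hc, hcc⟩ := hA
    refine ⟨c₀, mem_filter.2 ⟨hc₀, c, mem_filter.2 ⟨hc, hcc, fun h => ?_⟩⟩⟩
    rcases h.cases_tail with h | ⟨d, _, hd⟩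
    · exact hcc h.symm
    · simpa using hd.2.1
  obtain ⟨U, hU, hmin⟩ := exists_min_image _ (fun U => (T U).card) hne
  obtain ⟨hUA, hTU⟩ := mem_filter.1 hU
  have hUT : U ∉ T U := fun h => (mem_filter.1 h).2.1 rfl
  have hcT : c₀ ∉ T U := fun h => (mem_filter.1 h).2.2 .refl
  refine ⟨U, hUA, T U, filter_subset _ _, hTU, hUT, hcT, ?_, ?_⟩
  · intro W hW c hc hWc
    by_contra hcon
    push Not at hcon
    obtain ⟨hWA, hWU, hWr⟩ := mem_filter.1 hW
    have hcr : ReflTransGen (Within (A.erase U) E) c c₀ := by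
      by_contra h
      exact hcon.2 (mem_filter.2 ⟨hc, hcon.1, h⟩)
    exact hWr (.head ⟨mem_erase.2 ⟨hWU, hWA⟩, mem_erase.2 ⟨hcon.1, hc⟩, hWc⟩ hcr)
  · intro W hW
    obtain ⟨hWA, hWU, hWr⟩ := mem_filter.1 hW
    have hWc : W ≠ c₀ := fun h => hcT (h ▸ hW)
    have hclaim : ∀ d, ReflTransGen (Within (A.erase U) E) d c₀ →
        ReflTransGen (Within (A.erase W) E) d c₀ := by
      intro d hd
      induction hd using ReflTransGen.head_induction_on with
      | refl => exact .refl
      | head hxy hy ih =>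
        rename_i x y
        have hxW : x ≠ W := by
          rintro rfl
          exact hWr (.head hxy hy)
        have hyW : y ≠ W := by
          rintro rfl
          exact hWr hy
        exact .head ⟨mem_erase.2 ⟨hxW, (mem_erase.1 hxy.1).2⟩,
          mem_erase.2 ⟨hyW, (mem_erase.1 hxy.2.1).2⟩, hxy.2.2⟩ ih
    have hUr : ReflTransGen (Within (A.erase W) E) U c₀ := by
      by_cases hUc : U = c₀
      · rw [hUc]
      · obtain ⟨d, hd, hUd, hdr⟩ := exists_step_avoiding (hE U hUA) hUc
        have hdW : d ≠ W := by
          rintro rfl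
          exact hWr hdr
        exact .head ⟨mem_erase.2 ⟨hWU.symm, hUA⟩, mem_erase.2 ⟨hdW, (mem_erase.1 hd).2⟩, hUd⟩
          (hclaim d hdr)
    have hss : T W ⊂ T U := by
      refine (ssubset_iff_of_subset ?_).2 ⟨W, hW, fun h => (mem_filter.1 h).2.1 rfl⟩
      intro c hc
      obtain ⟨hcA, hcW, hcr⟩ := mem_filter.1 hc
      refine mem_filter.2 ⟨hcA, ?_, fun h => hcr (hclaim c h)⟩
      rintro rfl
      exact hcr hUr
    intro c hc hcW
    by_contra hcon
    have := hmin W (mem_filter.2 ⟨hWA, c, mem_filter.2 ⟨hc, hcW, hcon⟩⟩)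
    exact absurd (card_lt_card hss) (by omega)

theorem isAcyclicOn_insert_erase (hr : ∀ v, ¬ r v v) {C : Finset V} {y z : V} {b : Bool}
    (hC : IsAcyclicOn r C) (h : nbr r b C y = {z}) : IsAcyclicOn r (insert y (C.erase z)) := by
  by_contra hcon
  obtain ⟨u, hu, hyu⟩ := exists_nbr_of_not_insert hr (hC.mono (erase_subset z C)) hcon b
  have : u ∈ nbr r b C y := mem_filter.2 ⟨(mem_erase.1 hu).2, hyu⟩
  rw [h, mem_singleton] at this
  exact (mem_erase.1 hu).1 this

theorem isAcyclicOn_insert_insert_erase (hr : ∀ v, ¬ r v v) {C : Finset V} {y y' z : V}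
    {b : Bool} (h : nbr r b C y = {z}) (hy : ¬ dirRel r b y y')
    (hC : IsAcyclicOn r (insert y' (C.erase z))) :
    IsAcyclicOn r (insert y (insert y' (C.erase z))) := by
  by_contra hcon
  obtain ⟨u, hu, hyu⟩ := exists_nbr_of_not_insert hr hC hcon b
  rcases mem_insert.1 hu with rfl | hu
  · exact hy hyu
  · have : u ∈ nbr r b C y := mem_filter.2 ⟨(mem_erase.1 hu).2, hyu⟩
    rw [h, mem_singleton] at this
    exact (mem_erase.1 hu).1 this

/-- No two vertices of `I` span a 2-cycle. -/
def TwoCycleFree (r : V → V → Prop) (I : Finset V) : Prop :=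
  ∀ y ∈ I, ∀ u ∈ I, ¬ ∀ b, dirRel r b y u

/-- There is a set `I ⊆ B` without 2-cycles such that the vertices of `I` together with their
2-cycle partners cover `B`. -/
theorem exists_max_twoCycleFree (hr : ∀ v, ¬ r v v) (B : Finset V) :
    ∃ I ⊆ B, TwoCycleFree r I ∧
      B.card ≤ ∑ y ∈ I, ((B.filter fun u => ∀ b, dirRel r b y u).card + 1) := by
  obtain ⟨I, hI, hmax⟩ := exists_max_image
    (B.powerset.filter (TwoCycleFree r)) card ⟨∅, by simp [TwoCycleFree]⟩
  obtain ⟨hIB, hIfree⟩ := mem_filter.1 hI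
  rw [mem_powerset] at hIB
  refine ⟨I, hIB, hIfree, ?_⟩
  have hcover : B ⊆ I.biUnion fun y => insert y (B.filter fun u => ∀ b, dirRel r b y u) := by
    intro u hu
    rw [mem_biUnion]
    by_cases huI : u ∈ I
    · exact ⟨u, huI, mem_insert_self _ _⟩
    by_contra hcon
    push Not at hcon
    have hnot : ∀ y ∈ I, ¬ ∀ b, dirRel r b y u := fun y hy h =>
      hcon y hy (mem_insert_of_mem (mem_filter.2 ⟨hu, h⟩))
    have hmem : insert u I ∈ B.powerset.filter (TwoCycleFree r) := by
      refine mem_filter.2 ⟨mem_powerset.2 (insert_subset hu hIB), ?_⟩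
      intro y hy w hw h
      rcases mem_insert.1 hy with rfl | hyI
      · rcases mem_insert.1 hw with rfl | hwI
        · exact dirRel_irrefl hr true _ (h true)
        · exact hnot w hwI fun b => (dirRel_not r b _ _).1 (h _)
      · rcases mem_insert.1 hw with rfl | hwI
        · exact hnot y hyI h
        · exact hIfree y hyI w hwI h
    have := hmax _ hmem
    rw [card_insert_of_notMem huI] at this
    omega
  calc B.card ≤ _ := card_le_card hcover
    _ ≤ _ := card_biUnion_le
    _ ≤ _ := sum_le_sum fun y _ => card_insert_le _ _

/-- The pairs `(z, b)` such that `z` is the unique neighbour of `y` in `C` in direction `b`. -/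
noncomputable def soloPairs (r : V → V → Prop) (C : Finset V) (y : V) : Finset (V × Bool) :=
  (C ×ˢ univ).filter fun p => nbr r p.2 C y = {p.1}

theorem card_soloPairs (C : Finset V) (y : V) :
    (soloPairs r C y).card = ∑ b, (C.filter fun z => nbr r b C y = {z}).card := by
  rw [soloPairs, card_filter, sum_product_right]
  simp only [card_filter]

theorem card_soloPairs_le (C : Finset V) (y : V) : (soloPairs r C y).card ≤ 2 := by
  rw [card_soloPairs]
  calc _ ≤ ∑ _b : Bool, 1 := sum_le_sum fun b _ => card_le_one.2 fun u hu v hv => by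
          have := (mem_filter.1 hu).2.symm.trans (mem_filter.1 hv).2
          simpa using this
    _ = 2 := by simp

theorem four_le_deg_add_card_soloPairs (hr : ∀ v, ¬ r v v) {C : Finset V} {y : V}
    (hC : IsAcyclicOn r C) (h : ¬ IsAcyclicOn r (insert y C)) :
    4 ≤ deg r C y + (soloPairs r C y).card := by
  rw [card_soloPairs, deg, ← sum_add_distrib]
  calc 4 = ∑ _b : Bool, 2 := by simp
    _ ≤ _ := sum_le_sum fun b _ => ?_
  have h1 := one_le_card_nbr hr hC h b
  by_cases h2 : (nbr r b C y).card = 1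
  · obtain ⟨z, hz⟩ := card_eq_one.1 h2
    have hzC : z ∈ C := by
      have : z ∈ nbr r b C y := by simp [hz]
      exact (mem_filter.1 this).1
    have : 0 < (C.filter fun z => nbr r b C y = {z}).card :=
      card_pos.2 ⟨z, mem_filter.2 ⟨hzC, hz⟩⟩
    omega
  · omega

/-- If the vertices of `B` are blocked by all classes `P W`, then a vertex `z` of some class can
be replaced by two vertices of `B`. -/
theorem exists_swap_pair (hr : ∀ v, ¬ r v v) {B : Finset V} {A : Finset α} {P : α → Finset V}
    {q s : ℕ} (hP : ∀ W ∈ A, IsAcyclicOn r (P W)) (hs : ∀ W ∈ A, (P W).card = s)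
    (hB : B.card = q * s + 1) (hblock : ∀ y ∈ B, ∀ W ∈ A, ¬ IsAcyclicOn r (insert y (P W)))
    (hdeg : ∀ y ∈ B, ∑ W ∈ A, deg r (P W) y + deg r B y + 1 ≤ 2 * (q + A.card))
    (hq : q ≤ A.card) :
    ∃ W ∈ A, ∃ z ∈ P W, ∃ y₁ ∈ B, ∃ y₂ ∈ B, y₁ ≠ y₂ ∧
      IsAcyclicOn r (insert y₁ ((P W).erase z)) ∧
      IsAcyclicOn r (insert y₂ (insert y₁ ((P W).erase z))) := by
  obtain ⟨I, hIB, hIfree, hIcard⟩ := exists_max_twoCycleFree hr B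
  set h : V → Finset V := fun y => B.filter fun u => ∀ b, dirRel r b y u with hh
  have hsub : ∀ y b, h y ⊆ nbr r b B y := fun y b u hu =>
    mem_filter.2 ⟨(mem_filter.1 hu).1, (mem_filter.1 hu).2 b⟩
  have hdeg2 : ∀ y, deg r B y = (nbr r true B y).card + (nbr r false B y).card := fun y => by
    simp [deg]
  have hle : ∀ y, 2 * (h y).card ≤ deg r B y := fun y => by
    have := card_le_card (hsub y true)
    have := card_le_card (hsub y false)
    have := hdeg2 y
    omega
  have hpure : ∀ y, deg r B y = 2 * (h y).card → ∀ b, ∀ u ∈ B, dirRel r b y u → u ∈ h y := by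
    intro y hy b u hu hyu
    have h1 : h y = nbr r b B y := by
      refine eq_of_subset_of_card_le (hsub y b) ?_
      have h1 := card_le_card (hsub y true)
      have h2 := card_le_card (hsub y false)
      have := hdeg2 y
      cases b <;> omega
    rw [h1]
    exact mem_filter.2 ⟨hu, hyu⟩
  set Occ : α → V → Finset (V × Bool) := fun W y =>
    if deg r B y = 2 * (h y).card then
      ((soloPairs r (P W) y).image Prod.fst).toList.head?.elim ∅ fun z => {z} ×ˢ univ
    else soloPairs r (P W) y with hOcc
  have hsolo : ∀ W y z b, (z, b) ∈ soloPairs r (P W) y → z ∈ P W ∧ nbr r b (P W) y = {z} := by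
    intro W y z b hzb
    simpa [soloPairs] using hzb
  have hOcc_pure : ∀ W y, deg r B y = 2 * (h y).card →
      (soloPairs r (P W) y = ∅ ∧ Occ W y = ∅) ∨
        ∃ z b, (z, b) ∈ soloPairs r (P W) y ∧ Occ W y = {z} ×ˢ univ := by
    intro W y hy
    simp only [hOcc, if_pos hy]
    rcases hl : ((soloPairs r (P W) y).image Prod.fst).toList with _ | ⟨z, l⟩
    · left
      rw [toList_eq_nil, image_eq_empty] at hl
      exact ⟨hl, rfl⟩
    · right
      have hz : z ∈ (soloPairs r (P W) y).image Prod.fst := by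
        rw [← mem_toList, hl]
        exact List.mem_cons_self
      obtain ⟨⟨z', b⟩, hzb, rfl⟩ := mem_image.1 hz
      exact ⟨z', b, hzb, rfl⟩
  have hOcc_mem : ∀ W y z b, (z, b) ∈ Occ W y → z ∈ P W ∧
      ∃ b', nbr r b' (P W) y = {z} ∧ (deg r B y ≠ 2 * (h y).card → b' = b) := by
    intro W y z b hzb
    by_cases hy : deg r B y = 2 * (h y).card
    · rcases hOcc_pure W y hy with ⟨_, h0⟩ | ⟨z', b', h1, h2⟩
      · simp [h0] at hzb
      · rw [h2] at hzb
        obtain rfl : z = z' := mem_singleton.1 (mem_product.1 hzb).1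
        exact ⟨(hsolo _ _ _ _ h1).1, b', (hsolo _ _ _ _ h1).2, fun h => absurd hy h⟩
    · simp only [hOcc, if_neg hy] at hzb
      exact ⟨(hsolo _ _ _ _ hzb).1, b, (hsolo _ _ _ _ hzb).2, fun _ => rfl⟩
  have hOcc_card : ∀ y ∈ B, 2 * A.card + 2 * ((h y).card + 1) ≤
      2 * q + ∑ W ∈ A, (Occ W y).card := by
    intro y hy
    have h1 : 4 * A.card ≤ ∑ W ∈ A, deg r (P W) y + ∑ W ∈ A, (soloPairs r (P W) y).card := by
      rw [← sum_add_distrib, mul_comm, ← smul_eq_mul, ← sum_const]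
      exact sum_le_sum fun W hW =>
        four_le_deg_add_card_soloPairs hr (hP W hW) (hblock y hy W hW)
    have h2 := hdeg y hy
    by_cases hyp : deg r B y = 2 * (h y).card
    · have h3 : ∀ W, (soloPairs r (P W) y).card ≤ (Occ W y).card ∧ 2 ∣ (Occ W y).card := by
        intro W
        rcases hOcc_pure W y hyp with ⟨h3, h4⟩ | ⟨z, b, _, h4⟩
        · simp [h3, h4]
        · simp [h4, card_soloPairs_le]
      have h4 : 2 ∣ ∑ W ∈ A, (Occ W y).card := dvd_sum fun W _ => (h3 W).2
      have h5 : ∑ W ∈ A, (soloPairs r (P W) y).card ≤ ∑ W ∈ A, (Occ W y).card :=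
        sum_le_sum fun W _ => (h3 W).1
      omega
    · have h3 : ∑ W ∈ A, (Occ W y).card = ∑ W ∈ A, (soloPairs r (P W) y).card := by
        simp only [hOcc, if_neg hyp]
      have := hle y
      omega
  have hIs : s + 1 ≤ I.card := by
    have h1 : ∀ y ∈ I, (h y).card + 1 ≤ q := by
      intro y hy
      have h1 : 2 * A.card ≤ ∑ W ∈ A, deg r (P W) y := by
        rw [mul_comm, ← smul_eq_mul, ← sum_const]
        exact sum_le_sum fun W hW => two_le_deg hr (hP W hW) (hblock y (hIB hy) W hW)
      have := hdeg y (hIB hy)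
      have := hle y
      omega
    have h2 : q * s + 1 ≤ I.card * q := by
      rw [← hB]
      refine hIcard.trans ?_
      rw [← smul_eq_mul, ← sum_const]
      exact sum_le_sum h1
    by_contra hcon
    have : I.card * q ≤ s * q := Nat.mul_le_mul_right _ (by omega)
    rw [mul_comm s q] at this
    omega
  have hexists : ∃ W ∈ A, ∃ y₁ ∈ I, ∃ y₂ ∈ I, y₁ ≠ y₂ ∧ ¬ Disjoint (Occ W y₁) (Occ W y₂) := by
    by_contra hcon
    push Not at hcon
    have h1 : ∀ W ∈ A, ∑ y ∈ I, (Occ W y).card ≤ s * 2 := by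
      intro W hW
      rw [← card_biUnion fun y₁ h₁ y₂ h₂ hne => hcon W hW y₁ h₁ y₂ h₂ hne]
      calc _ ≤ (P W ×ˢ (univ : Finset Bool)).card := card_le_card fun p hp => by
            obtain ⟨y, _, hp⟩ := mem_biUnion.1 hp
            exact mem_product.2 ⟨(hOcc_mem W y p.1 p.2 hp).1, mem_univ _⟩
        _ = s * 2 := by rw [card_product, hs W hW]; simp
    have h2 : ∑ y ∈ I, ∑ W ∈ A, (Occ W y).card ≤ A.card * (s * 2) := by
      rw [sum_comm, ← smul_eq_mul, ← sum_const]
      exact sum_le_sum h1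
    have h3 : ∑ y ∈ I, (2 * A.card + 2 * ((h y).card + 1)) ≤
        ∑ y ∈ I, (2 * q + ∑ W ∈ A, (Occ W y).card) :=
      sum_le_sum fun y hy => hOcc_card y (hIB hy)
    simp only [sum_add_distrib (f := fun _ => 2 * A.card), sum_add_distrib (f := fun _ => 2 * q),
      ← mul_sum, sum_const, smul_eq_mul] at h3
    obtain ⟨e, he⟩ := Nat.exists_eq_add_of_le hq
    rw [he] at h2 h3
    have h4 : q * s + 1 ≤ ∑ y ∈ I, ((h y).card + 1) := hB ▸ hIcard
    have h5 : e * (s + 1) ≤ e * I.card := Nat.mul_le_mul_left _ hIs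
    nlinarith
  obtain ⟨W, hW, y₁, hy₁, y₂, hy₂, hne, hdis⟩ := hexists
  obtain ⟨⟨z, b⟩, hz₁, hz₂⟩ := not_disjoint_iff.1 hdis
  obtain ⟨hzW, b₁, hb₁, hb₁'⟩ := hOcc_mem _ _ _ _ hz₁
  obtain ⟨-, b₂, hb₂, hb₂'⟩ := hOcc_mem _ _ _ _ hz₂
  have ha₁ := isAcyclicOn_insert_erase hr (hP W hW) hb₁
  have ha₂ := isAcyclicOn_insert_erase hr (hP W hW) hb₂
  refine ⟨W, hW, z, hzW, y₁, hIB hy₁, y₂, hIB hy₂, hne, ha₁, ?_⟩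
  have hor : ¬ dirRel r b₁ y₁ y₂ ∨ ¬ dirRel r b₂ y₂ y₁ := by
    by_contra hcon
    push Not at hcon
    by_cases hp₁ : deg r B y₁ = 2 * (h y₁).card
    · exact hIfree _ hy₁ _ hy₂ (mem_filter.1 (hpure _ hp₁ _ _ (hIB hy₂) hcon.1)).2
    by_cases hp₂ : deg r B y₂ = 2 * (h y₂).card
    · exact hIfree _ hy₂ _ hy₁ (mem_filter.1 (hpure _ hp₂ _ _ (hIB hy₁) hcon.2)).2
    obtain rfl := hb₁' hp₁
    obtain rfl := hb₂' hp₂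
    refine hIfree _ hy₁ _ hy₂ fun b => ?_
    by_cases hbb : b = b₂
    · exact hbb ▸ hcon.1
    · obtain rfl : b = !b₂ := Bool.eq_not.2 hbb
      exact (dirRel_not r _ _ _).2 hcon.2
  rcases hor with hor | hor
  · rw [insert_comm]
    exact isAcyclicOn_insert_insert_erase hr hb₁ hor ha₂
  · exact isAcyclicOn_insert_insert_erase hr hb₂ hor ha₁

/-- The colour class of `c` in `Y` under the colouring `f`. -/
noncomputable def cls (Y : Finset V) (f : V → α) (c : α) : Finset V := Y.filter fun v => f v = c

theorem mem_cls {Y : Finset V} {f : V → α} {c : α} {v : V} : v ∈ cls Y f c ↔ v ∈ Y ∧ f v = c :=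
  mem_filter

/-- `Y` has an acyclic colouring with colours in `T` and colour classes of sizes `n`. -/
def Colorable (r : V → V → Prop) (Y : Finset V) (T : Finset α) (n : α → ℕ) : Prop :=
  ∃ f : V → α, (∀ v ∈ Y, f v ∈ T) ∧
    ∀ c ∈ T, IsAcyclicOn r (cls Y f c) ∧ (cls Y f c).card = n c

theorem Colorable.congr {Y : Finset V} {T : Finset α} {n n' : α → ℕ} (h : Colorable r Y T n)
    (hn : ∀ c ∈ T, n c = n' c) : Colorable r Y T n' := by
  obtain ⟨f, h1, h2⟩ := h
  exact ⟨f, h1, fun c hc => ⟨(h2 c hc).1, (h2 c hc).2.trans (hn c hc)⟩⟩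

theorem colorable_singleton {Y : Finset V} {c : α} {n : α → ℕ} (h : IsAcyclicOn r Y)
    (hn : Y.card = n c) : Colorable r Y {c} n := by
  refine ⟨fun _ => c, by simp, fun d hd => ?_⟩
  obtain rfl := mem_singleton.1 hd
  simp [cls, h, hn]

theorem Colorable.union {Y₁ Y₂ : Finset V} {T₁ T₂ : Finset α} {n : α → ℕ}
    (h₁ : Colorable r Y₁ T₁ n) (h₂ : Colorable r Y₂ T₂ n) (hY : Disjoint Y₁ Y₂)
    (hT : Disjoint T₁ T₂) : Colorable r (Y₁ ∪ Y₂) (T₁ ∪ T₂) n := by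
  obtain ⟨f₁, hf₁, h₁⟩ := h₁
  obtain ⟨f₂, hf₂, h₂⟩ := h₂
  have hY' : ∀ v ∈ Y₂, v ∉ Y₁ := fun v h2 h1 => disjoint_left.1 hY h1 h2
  refine ⟨fun v => if v ∈ Y₁ then f₁ v else f₂ v, fun v hv => ?_, fun c hc => ?_⟩
  · by_cases hv1 : v ∈ Y₁
    · simp [hv1, hf₁ v hv1]
    · have : v ∈ Y₂ := by simpa [hv1] using hv
      simp [hv1, hf₂ v this]
  · rcases mem_union.1 hc with hc | hc
    · have : cls (Y₁ ∪ Y₂) (fun v => if v ∈ Y₁ then f₁ v else f₂ v) c = cls Y₁ f₁ c := by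
        ext v
        simp only [mem_cls, mem_union]
        by_cases hv1 : v ∈ Y₁
        · simp [hv1]
        · simp only [hv1, if_false, false_or, false_and, iff_false]
          rintro ⟨hv2, rfl⟩
          exact disjoint_left.1 hT hc (hf₂ v hv2)
      rw [this]
      exact h₁ c hc
    · have : cls (Y₁ ∪ Y₂) (fun v => if v ∈ Y₁ then f₁ v else f₂ v) c = cls Y₂ f₂ c := by
        ext v
        simp only [mem_cls, mem_union]
        by_cases hv1 : v ∈ Y₁
        · have hv2 : v ∉ Y₂ := fun h => hY' v h hv1
          simp only [hv1, hv2, if_true, or_false, true_and, false_and, iff_false]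
          rintro rfl
          exact disjoint_left.1 hT (hf₁ v hv1) hc
        · simp [hv1]
      rw [this]
      exact h₂ c hc

/-- Some vertex of the class `P a` can be moved to the class `P b`. -/
def Movable (r : V → V → Prop) (P : α → Finset V) (a b : α) : Prop :=
  ∃ v ∈ P a, IsAcyclicOn r (insert v (P b))

theorem reflTransGen_within_movable_congr {P P' : α → Finset V} {T T' : Finset α} (hT : T ⊆ T')
    (h : ∀ c ∈ T, P c = P' c) {a b : α} (hab : ReflTransGen (Within T (Movable r P)) a b) :
    ReflTransGen (Within T' (Movable r P')) a b := by
  refine ReflTransGen.mono (fun x y hxy => ⟨hT hxy.1, hT hxy.2.1, ?_⟩) _ _ hab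
  obtain ⟨v, hv, hv'⟩ := hxy.2.2
  exact ⟨v, h x hxy.1 ▸ hv, h y hxy.2.1 ▸ hv'⟩

/-- A new vertex that can be added to a class from which `c₀` is reachable can be added to the
colouring at the cost of enlarging the class of `c₀`. -/
theorem colorable_insert_of_reachable {f : V → α} {c₀ : α} (T : Finset α) :
    ∀ (Y : Finset V) (y : V) (c : α), (∀ v ∈ Y, f v ∈ T) →
      (∀ c ∈ T, IsAcyclicOn r (cls Y f c)) → y ∉ Y → c ∈ T →
      IsAcyclicOn r (insert y (cls Y f c)) →
      ReflTransGen (Within T (Movable r (cls Y f))) c c₀ →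
      Colorable r (insert y Y) T (fun d => (cls Y f d).card + if d = c₀ then 1 else 0) := by
  induction hN : T.card generalizing T with
  | zero =>
    intro Y y c _ _ _ hc
    simp [card_eq_zero.1 hN] at hc
  | succ N ih =>
    intro Y y c hf hac hy hc hyc hreach
    have hyY : ∀ v ∈ Y, v ≠ y := fun v hv h => hy (h ▸ hv)
    by_cases hcc : c = c₀
    · subst hcc
      refine ⟨Function.update f y c, ?_, ?_⟩
      · intro v hv
        rcases mem_insert.1 hv with rfl | hv
        · simpa using hc
        · rw [Function.update_of_ne (hyY v hv)]
          exact hf v hv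
      · intro d hd
        by_cases hdc : d = c
        · subst hdc
          have : cls (insert y Y) (Function.update f y d) d = insert y (cls Y f d) := by
            ext v
            simp only [mem_cls, mem_insert]
            by_cases hv : v = y
            · simp [hv]
            · simp [hv]
          simp only [this, if_true]
          exact ⟨hyc, card_insert_of_notMem fun h => hy (mem_cls.1 h).1⟩
        · have : cls (insert y Y) (Function.update f y c) d = cls Y f d := by
            ext v
            simp only [mem_cls, mem_insert]
            by_cases hv : v = y
            · simp [hv, hy, Ne.symm hdc]
            · simp [hv]
          simp only [this, if_neg hdc]
          exact ⟨hac d hd, rfl⟩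
    · obtain ⟨d, hd, ⟨v, hv, hvd⟩, hdr⟩ := exists_step_avoiding hreach hcc
      obtain ⟨hvY, hvc⟩ := mem_cls.1 hv
      set Y' := Y.filter fun u => f u ≠ c with hY'
      have hcls : ∀ e ∈ T.erase c, cls Y f e = cls Y' f e := by
        intro e he
        have hec := (mem_erase.1 he).1
        ext u
        simp only [mem_cls, hY', mem_filter]
        grind
      have h1 := ih (T.erase c) (by rw [card_erase_of_mem hc]; omega) Y' v d
        (fun u hu => mem_erase.2 ⟨(mem_filter.1 hu).2, hf u (mem_filter.1 hu).1⟩)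
        (fun e he => hcls e he ▸ hac e (mem_erase.1 he).2)
        (fun h => (mem_filter.1 h).2 hvc) hd (hcls d hd ▸ hvd)
        (reflTransGen_within_movable_congr subset_rfl hcls hdr)
      have h2 : Colorable r (insert y ((cls Y f c).erase v)) {c}
          (fun d => (cls Y f d).card + if d = c₀ then 1 else 0) := by
        refine colorable_singleton (hyc.mono (insert_subset_insert _ (erase_subset _ _))) ?_
        have hpos : 0 < (cls Y f c).card := card_pos.2 ⟨v, hv⟩
        rw [card_insert_of_notMem fun h => hy (mem_cls.1 (mem_erase.1 h).2).1,
          card_erase_of_mem hv, if_neg hcc]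
        omega
      have h3 := (h1.congr fun e he => by rw [← hcls e he]).union h2 ?_ ?_
      · have hT : T.erase c ∪ {c} = T := by
          ext e
          simp only [mem_union, mem_erase, mem_singleton]
          grind
        have hYY : insert v Y' ∪ insert y ((cls Y f c).erase v) = insert y Y := by
          ext u
          simp only [mem_union, mem_insert, mem_erase, mem_cls, hY', mem_filter]
          grind
        rwa [hT, hYY] at h3
      · rw [disjoint_left]
        intro u hu hu'
        simp only [mem_insert, mem_erase, mem_cls, hY', mem_filter] at hu hu'
        grind
      · simp

theorem sum_deg_cls (Y : Finset V) (f : V → α) (T : Finset α) (v : V) :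
    ∑ c ∈ T, deg r (cls Y f c) v = deg r (Y.filter fun u => f u ∈ T) v := by
  simp only [deg]
  rw [sum_comm]
  refine sum_congr rfl fun b _ => ?_
  have hmaps : Set.MapsTo f (nbr r b (Y.filter fun u => f u ∈ T) v : Finset V) (T : Set α) :=
    fun u hu => (mem_filter.1 (mem_filter.1 hu).1).2
  rw [card_eq_sum_card_fiberwise hmaps]
  refine sum_congr rfl fun c hc => congrArg card ?_
  ext u
  simp only [nbr, cls, mem_filter]
  grind

/-- `f` is an acyclic colouring of `X` without `x` in which all classes have size `s`, except
that the class of `c₀` has size `s - 1`. -/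
structure NearColoring (r : V → V → Prop) (X : Finset V) (K : Finset α) (s : ℕ) (x : V)
    (f : V → α) (c₀ : α) : Prop where
  mem : x ∈ X
  mem_color : c₀ ∈ K
  maps : ∀ v ∈ X.erase x, f v ∈ K
  acyclic : ∀ c ∈ K, IsAcyclicOn r (cls (X.erase x) f c)
  card : ∀ c ∈ K, (cls (X.erase x) f c).card + (if c = c₀ then 1 else 0) = s

/-- The colours from which `c₀` can be reached by moving single vertices. -/
noncomputable def accessible (r : V → V → Prop) (X : Finset V) (K : Finset α) (x : V)
    (f : V → α) (c₀ : α) : Finset α :=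
  K.filter fun c => ReflTransGen (Within K (Movable r (cls (X.erase x) f))) c c₀

/-- Replacing `z` by `y₁` in the class of `W` and recolouring everything outside the classes in
`A` yields another near colouring. -/
theorem NearColoring.swap {X : Finset V} {K A : Finset α} {s : ℕ} {x z y₁ : V} {f g : V → α}
    {c₀ W : α} (h : NearColoring r X K s x f c₀) (hAK : A ⊆ K) (hc₀ : c₀ ∈ A) (hW : W ∈ A)
    (hWc₀ : W ≠ c₀) (hz : z ∈ cls (X.erase x) f W)
    (hy₁ : y₁ ∈ X \ (X.erase x).filter fun v => f v ∈ A)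
    (hgmaps : ∀ v ∈ (X \ (X.erase x).filter fun v => f v ∈ A).erase y₁, g v ∈ K \ A)
    (hg : ∀ c ∈ K \ A,
      IsAcyclicOn r (cls ((X \ (X.erase x).filter fun v => f v ∈ A).erase y₁) g c) ∧
        (cls ((X \ (X.erase x).filter fun v => f v ∈ A).erase y₁) g c).card = s)
    (hac : IsAcyclicOn r (insert y₁ ((cls (X.erase x) f W).erase z))) :
    ∃ f' : V → α, NearColoring r X K s z f' c₀ ∧
      (∀ c ∈ A.erase W, cls (X.erase x) f c = cls (X.erase z) f' c) ∧
      cls (X.erase z) f' W = insert y₁ ((cls (X.erase x) f W).erase z) ∧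
      ∀ c ∈ K \ A, cls (X.erase z) f' c =
        cls ((X \ (X.erase x).filter fun v => f v ∈ A).erase y₁) g c := by
  set B := X \ (X.erase x).filter fun v => f v ∈ A with hB
  obtain ⟨hzX₀, hfz⟩ := mem_cls.1 hz
  have hzX := (mem_erase.1 hzX₀).2
  have hBX : B ⊆ X := sdiff_subset
  have hnotB : ∀ v ∈ X, v ∉ B → v ∈ X.erase x ∧ f v ∈ A := by
    intro v hv hvB
    by_contra hcon
    exact hvB (mem_sdiff.2 ⟨hv, fun h => hcon (mem_filter.1 h)⟩)
  have hBnot : ∀ v ∈ B, v ∈ X.erase x → f v ∉ A := fun v hv hv₀ hvA =>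
    (mem_sdiff.1 hv).2 (mem_filter.2 ⟨hv₀, hvA⟩)
  have hzB : z ∉ B := fun h => hBnot z h hzX₀ (hfz ▸ hW)
  have hX₀X : ∀ v ∈ X.erase x, v ∈ X := fun v hv => (mem_erase.1 hv).2
  have hy₁X := hBX hy₁
  have hclear : ∀ v, v ∈ X.erase z ↔ v ∈ X ∧ v ≠ z := fun v => by rw [mem_erase, and_comm]
  have hBe : ∀ v, v ∈ B.erase y₁ ↔ v ∈ B ∧ v ≠ y₁ := fun v => by rw [mem_erase, and_comm]
  have hKA : ∀ c, c ∈ K \ A ↔ c ∈ K ∧ c ∉ A := fun c => mem_sdiff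
  clear_value B
  set X₀ := X.erase x with hX₀
  obtain ⟨f', hf'B, hf'y, hf'⟩ : ∃ f' : V → α, (∀ v ∈ B.erase y₁, f' v = g v) ∧ f' y₁ = W ∧
      ∀ v, v ∉ B → f' v = f v := by
    refine ⟨fun v => if v ∈ B.erase y₁ then g v else if v = y₁ then W else f v, ?_, ?_, ?_⟩
    · intro v hv
      simp [hv]
    · simp
    · intro v hv
      have : v ≠ y₁ := fun h => hv (h ▸ hy₁)
      simp [hv, this]
  have hA : ∀ c ∈ A.erase W, cls X₀ f c = cls (X.erase z) f' c := by
    intro c hc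
    obtain ⟨hcW, hcA⟩ := mem_erase.1 hc
    ext u
    rw [mem_cls, mem_cls, hclear]
    by_cases huB : u ∈ B
    · by_cases huy : u = y₁
      · grind
      · have := hgmaps u ((hBe u).2 ⟨huB, huy⟩)
        rw [hf'B u ((hBe u).2 ⟨huB, huy⟩)]
        grind
    · grind
  have hWeq : cls (X.erase z) f' W = insert y₁ ((cls X₀ f W).erase z) := by
    ext u
    rw [mem_insert, mem_erase, mem_cls, mem_cls, hclear]
    by_cases huB : u ∈ B
    · by_cases huy : u = y₁
      · grind
      · have := hgmaps u ((hBe u).2 ⟨huB, huy⟩)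
        rw [hf'B u ((hBe u).2 ⟨huB, huy⟩)]
        grind
    · grind
  have hKeq : ∀ c ∈ K \ A, cls (X.erase z) f' c = cls (B.erase y₁) g c := by
    intro c hc
    ext u
    rw [mem_cls, mem_cls, hclear, hBe]
    by_cases huB : u ∈ B
    · by_cases huy : u = y₁
      · grind
      · rw [hf'B u ((hBe u).2 ⟨huB, huy⟩)]
        grind
    · grind
  have hcases : ∀ c ∈ K, c ∈ A.erase W ∨ c = W ∨ c ∈ K \ A := by
    intro c hc
    rw [mem_erase, mem_sdiff]
    tauto
  refine ⟨f', ⟨hzX, h.mem_color, ?_, ?_, ?_⟩, hA, hWeq, hKeq⟩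
  · intro v hv
    obtain ⟨hvX, hvz⟩ := (hclear v).1 hv
    by_cases hvB : v ∈ B
    · by_cases hvy : v = y₁
      · rw [hvy, hf'y]
        exact hAK hW
      · rw [hf'B v ((hBe v).2 ⟨hvB, hvy⟩)]
        exact (mem_sdiff.1 (hgmaps v ((hBe v).2 ⟨hvB, hvy⟩))).1
    · rw [hf' v hvB]
      exact hAK (hnotB v hvX hvB).2
  · intro c hc
    rcases hcases c hc with hc | rfl | hc
    · rw [← hA c hc]
      exact h.acyclic c (hAK (mem_erase.1 hc).2)
    · rwa [hWeq]
    · rw [hKeq c hc]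
      exact (hg c hc).1
  · intro c hc
    rcases hcases c hc with hc' | rfl | hc'
    · rw [← hA c hc']
      exact h.card c hc
    · have hpos : 0 < (cls X₀ f c).card := card_pos.2 ⟨z, hz⟩
      have hyn : y₁ ∉ (cls X₀ f c).erase z := fun hy => by
        obtain ⟨h1, h2⟩ := mem_cls.1 (mem_erase.1 hy).2
        exact hBnot y₁ hy₁ h1 (h2 ▸ hW)
      have h1 := h.card c hc
      rw [if_neg hWc₀] at h1 ⊢
      change (cls X₀ f c).card + 0 = s at h1
      rw [hWeq, card_insert_of_notMem hyn, card_erase_of_mem hz]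
      omega
    · have hcc : c ≠ c₀ := fun h => (mem_sdiff.1 hc').2 (h ▸ hc₀)
      rw [hKeq c hc', if_neg hcc, add_zero]
      exact (hg c hc').2

/-- A near colouring can be completed, or it can be changed so that more colours become
accessible. -/
theorem NearColoring.colorable_or_improve (hr : ∀ v, ¬ r v v) {X : Finset V} {K : Finset α}
    {s : ℕ} {x : V} {f : V → α} {c₀ : α} (hX : X.card = K.card * s)
    (hdeg : ∀ v ∈ X, deg r X v + 1 ≤ 2 * K.card)
    (ih : ∀ (X' : Finset V) (K' : Finset α), X'.card < X.card → X'.card = K'.card * s →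
      (∀ v ∈ X', deg r X' v + 1 ≤ 2 * K'.card) → Colorable r X' K' fun _ => s)
    (h : NearColoring r X K s x f c₀) :
    Colorable r X K (fun _ => s) ∨ ∃ x' f', NearColoring r X K s x' f' c₀ ∧
      (accessible r X K x f c₀).card < (accessible r X K x' f' c₀).card := by
  by_cases hcol : Colorable r X K fun _ => s
  · exact Or.inl hcol
  refine Or.inr ?_
  set X₀ := X.erase x with hX₀
  set P := cls X₀ f with hP
  set A := accessible r X K x f c₀ with hA
  have hAK : A ⊆ K := filter_subset _ _
  have hAreach : ∀ c ∈ A, ReflTransGen (Within K (Movable r P)) c c₀ := fun c hc =>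
    (mem_filter.1 hc).2
  have hc₀A : c₀ ∈ A := mem_filter.2 ⟨h.mem_color, .refl⟩
  have hX₀X : X₀ ⊆ X := erase_subset _ _
  have hxX₀ : x ∉ X₀ := notMem_erase x X
  have hPA : ∀ c ∈ A, IsAcyclicOn r (P c) := fun c hc => h.acyclic c (hAK hc)
  set YA := X₀.filter fun v => f v ∈ A with hYA
  set B := X \ YA with hB
  have hBX : B ⊆ X := sdiff_subset
  have hPYA : ∀ c ∈ A, P c ⊆ YA := fun c hc v hv =>
    mem_filter.2 ⟨(mem_cls.1 hv).1, (mem_cls.1 hv).2 ▸ hc⟩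
  have hYAX : YA ⊆ X := (filter_subset _ _).trans hX₀X
  have hdisj : ∀ c ∈ A, Disjoint (P c) B := fun c hc =>
    disjoint_of_subset_left (hPYA c hc) disjoint_sdiff
  -- The vertices of `B` cannot be moved to accessible classes.
  have hblock : ∀ y ∈ B, ∀ c ∈ A, ¬ IsAcyclicOn r (insert y (P c)) := by
    intro y hy c hc hac
    obtain ⟨hyX, hyA⟩ := mem_sdiff.1 hy
    by_cases hyx : y = x
    · subst hyx
      have h1 := colorable_insert_of_reachable (r := r) (f := f) (c₀ := c₀) K X₀ y c h.maps
        h.acyclic hxX₀ (hAK hc) hac (hAreach c hc)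
      rw [hX₀, insert_erase hyX] at h1
      exact hcol (h1.congr h.card)
    · have hy₀ : y ∈ X₀ := mem_erase.2 ⟨hyx, hyX⟩
      refine hyA (mem_filter.2 ⟨hy₀, mem_filter.2 ⟨h.maps y hy₀, ?_⟩⟩)
      exact .head ⟨h.maps y hy₀, hAK hc, y, mem_cls.2 ⟨hy₀, rfl⟩, hac⟩ (hAreach c hc)
  -- Degree bound for vertices blocked by a set of accessible classes.
  have hbound : ∀ v ∈ X, ∀ T ⊆ A, (∀ c ∈ T, ¬ IsAcyclicOn r (insert v (P c))) →
      ∀ Z ⊆ X, (∀ u ∈ Z, u ∈ X₀ → f u ∉ T) → 2 * T.card + deg r Z v + 1 ≤ 2 * K.card := by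
    intro v hv T hT hvT Z hZ hZT
    have h1 : 2 * T.card ≤ ∑ c ∈ T, deg r (P c) v := by
      rw [mul_comm, ← smul_eq_mul, ← sum_const]
      exact sum_le_sum fun c hc => two_le_deg hr (hPA c (hT hc)) (hvT c hc)
    rw [hP, sum_deg_cls] at h1
    have h2 : Disjoint (X₀.filter fun u => f u ∈ T) Z := by
      rw [disjoint_left]
      intro u hu huZ
      exact hZT u huZ (mem_filter.1 hu).1 (mem_filter.1 hu).2
    have h3 := deg_mono (r := r) (union_subset ((filter_subset _ _).trans hX₀X) hZ) v
      (C := (X₀.filter fun u => f u ∈ T) ∪ Z)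
    rw [deg_union h2] at h3
    have := hdeg v hv
    omega
  obtain ⟨q, hq⟩ : ∃ q, q = (K \ A).card := ⟨_, rfl⟩
  have hKq : K.card = A.card + q := by
    rw [hq, card_sdiff_of_subset hAK]
    have := card_le_card hAK
    omega
  have hYAcard : YA.card + 1 = A.card * s := by
    have h1 : YA.card = ∑ c ∈ A, (P c).card := by
      have hmaps : Set.MapsTo f (YA : Set V) (A : Set α) := fun u hu => (mem_filter.1 hu).2
      rw [card_eq_sum_card_fiberwise hmaps]
      refine sum_congr rfl fun c hc => congrArg Finset.card ?_
      ext u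
      simp only [hP, hYA, mem_cls, mem_filter]
      grind
    have h2 : ∑ c ∈ A, ((P c).card + if c = c₀ then 1 else 0) = A.card * s := by
      rw [← smul_eq_mul, ← sum_const]
      exact sum_congr rfl fun c hc => h.card c (hAK hc)
    rw [sum_add_distrib, ← h1] at h2
    simpa [hc₀A] using h2
  have hBcard : B.card = q * s + 1 := by
    rw [hB, card_sdiff_of_subset hYAX, hX, hKq, add_mul]
    omega
  have hBf : ∀ T ⊆ A, ∀ u ∈ B, u ∈ X₀ → f u ∉ T := fun T hT u hu hu₀ huT =>
    (mem_sdiff.1 hu).2 (mem_filter.2 ⟨hu₀, hT huT⟩)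
  have hBdeg : ∀ y ∈ B, deg r B y + 1 ≤ 2 * q := by
    intro y hy
    have := hbound y (hBX hy) A subset_rfl (hblock y hy) B hBX (hBf A subset_rfl)
    omega
  have hBcol : ∀ y ∈ B, Colorable r (B.erase y) (K \ A) fun _ => s := by
    intro y hy
    refine ih _ _ ?_ ?_ fun v hv => ?_
    · exact card_lt_card ((erase_ssubset hy).trans_subset hBX)
    · rw [card_erase_of_mem hy, hBcard, hq]
      rfl
    · rw [← hq]
      exact (Nat.add_le_add_right (deg_mono (erase_subset _ _) v) 1).trans
        (hBdeg v (mem_erase.1 hv).2)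
  have hzdeg : ∀ W ∈ A, ∀ z ∈ P W, ∀ T ⊆ A, W ∉ T →
      (∀ c ∈ T, ¬ IsAcyclicOn r (insert z (P c))) →
      2 * T.card + (deg r (P W) z + deg r B z) + 1 ≤ 2 * K.card := by
    intro W hW z hz T hT hWT hzT
    rw [← deg_union (hdisj W hW)]
    refine hbound z (hYAX (hPYA W hW hz)) T hT hzT _
      (union_subset ((hPYA W hW).trans hYAX) hBX) fun u hu hu₀ => ?_
    rcases mem_union.1 hu with hu | hu
    · rw [(mem_cls.1 hu).2]
      exact hWT
    · exact hBf T hT u hu hu₀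
  have hAne : ∃ c ∈ A, c ≠ c₀ := by
    by_contra hcon
    push Not at hcon
    have hA1 : A.card = 1 := card_eq_one.2 ⟨c₀, by ext c; simp; grind⟩
    have h1 : ∀ z ∈ P c₀, deg r (P c₀) z + deg r B z ≤ 2 * q + 1 := by
      intro z hz
      have := hzdeg c₀ hc₀A z hz ∅ (empty_subset _) (notMem_empty _) (by simp)
      simp only [card_empty] at this
      omega
    have h2 := card_le_of_blocked hr (hPA c₀ hc₀A) (fun y hy => hblock y hy c₀ hc₀A)
      (q := q) (fun z hz => by have := h1 z hz; omega) (fun z hz _ => h1 z hz)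
    have h3 := h.card c₀ h.mem_color
    rw [if_pos rfl] at h3
    have h4 : q * (P c₀).card ≤ q * s := Nat.mul_le_mul_left _ (by rw [← h3]; exact Nat.le_succ _)
    omega
  have hAreach' : ∀ c ∈ A, ReflTransGen (Within A (Movable r P)) c c₀ := by
    intro c hc
    have h1 := hAreach c hc
    clear hc
    induction h1 using ReflTransGen.head_induction_on with
    | refl => exact .refl
    | head hab hb ihb =>
      exact .head ⟨mem_filter.2 ⟨hab.1, .head hab hb⟩, mem_filter.2 ⟨hab.2.1, hb⟩, hab.2.2⟩ ihb
  obtain ⟨U, hU, A', hA'A, hA'ne, hUA', hc₀A', hout, hterm⟩ :=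
    exists_terminal_set hc₀A hAreach' hAne
  have hPcard : ∀ W ∈ A', (P W).card = s := by
    intro W hW
    have hWc : W ≠ c₀ := fun h => hc₀A' (h ▸ hW)
    have := h.card W (hAK (hA'A hW))
    rwa [if_neg hWc, add_zero] at this
  -- No vertex of a terminal class that can be replaced by a vertex of `B` is movable.
  have hfixed : ∀ W ∈ A', ∀ z ∈ P W, ∀ y ∈ B, IsAcyclicOn r (insert y ((P W).erase z)) →
      ∀ c ∈ A.erase W, ¬ IsAcyclicOn r (insert z (P c)) := by
    intro W hW z hz y hy hzy c hc hzc
    obtain ⟨hcW, hcA⟩ := mem_erase.1 hc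
    have hWA := hA'A hW
    have hzW := (mem_cls.1 hz).2
    set Y' := X₀.filter fun v => f v ∈ A.erase W with hY'
    have hcls : ∀ e ∈ A.erase W, P e = cls Y' f e := by
      intro e he
      ext u
      simp only [hP, mem_cls, hY', mem_filter]
      grind
    have h1 := colorable_insert_of_reachable (r := r) (f := f) (c₀ := c₀) (A.erase W) Y' z c
      (fun v hv => (mem_filter.1 hv).2)
      (fun e he => hcls e he ▸ hPA e (mem_erase.1 he).2)
      (fun hz' => by
        have := (mem_filter.1 hz').2
        rw [hzW] at this
        exact notMem_erase W A this)
      hc (hcls c hc ▸ hzc)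
      (reflTransGen_within_movable_congr subset_rfl hcls (hterm W hW c hcA hcW))
    have h1' : Colorable r (insert z Y') (A.erase W) fun _ => s := h1.congr fun e he => by
      rw [← hcls e he]
      exact h.card e (hAK (mem_erase.1 he).2)
    have hyP : y ∉ P W := fun h => disjoint_left.1 (hdisj W hWA) h hy
    have h2 : Colorable r (insert y ((P W).erase z)) {W} fun _ => s := by
      refine colorable_singleton hzy ?_
      have hpos : 0 < (P W).card := card_pos.2 ⟨z, hz⟩
      rw [card_insert_of_notMem fun h => hyP (mem_erase.1 h).2, card_erase_of_mem hz,
        ← hPcard W hW]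
      omega
    obtain ⟨hyX, hyA⟩ := mem_sdiff.1 hy
    have hzX := (mem_cls.1 hz).1
    have h3 := (h1'.union h2 (by
      rw [disjoint_left]
      intro u hu hu'
      simp only [mem_insert, mem_erase, mem_filter, hY', hP, mem_cls, hYA] at hu hu' hyA
      grind) (by simp)).union (hBcol y hy) (by
      rw [disjoint_left]
      intro u hu hu'
      simp only [mem_insert, mem_erase, mem_filter, hY', hP, mem_cls, hYA, hB, mem_union,
        mem_sdiff] at hu hu' hyA
      grind) (by
      rw [disjoint_left]
      intro e he he'
      simp only [mem_union, mem_erase, mem_singleton, mem_sdiff] at he he'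
      grind)
    refine hcol ?_
    have hK : A.erase W ∪ {W} ∪ K \ A = K := by
      ext e
      have := @hAK e
      simp only [mem_union, mem_erase, mem_singleton, mem_sdiff]
      grind
    have hXX : insert z Y' ∪ insert y ((P W).erase z) ∪ B.erase y = X := by
      ext u
      have := @hX₀X u
      have := hX₀X hzX
      simp only [mem_insert, mem_erase, mem_filter, hY', hP, mem_cls, hYA, hB, mem_union,
        mem_sdiff] at hyA ⊢
      grind
    rwa [hK, hXX] at h3
  have hqt : q < A'.card := by
    obtain ⟨W, hW⟩ := hA'ne
    have hWA := hA'A hW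
    by_contra hcon
    have h1 := card_le_of_blocked hr (hPA W hWA) (fun y hy => hblock y hy W hWA) (q := q)
      (fun z hz => by
        have h1 := hzdeg W hWA z hz ((A.erase U) \ A') (sdiff_subset.trans (erase_subset _ _))
          (fun h => (mem_sdiff.1 h).2 hW) (fun c hc hzc => by
            obtain ⟨hcU, hcA'⟩ := mem_sdiff.1 hc
            obtain ⟨hcU, hcA⟩ := mem_erase.1 hcU
            rcases hout W hW c hcA ⟨z, hz, hzc⟩ with h | h
            · exact hcU h
            · exact hcA' h)
        have hss : A' ⊆ A.erase U := fun c hc =>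
          mem_erase.2 ⟨fun h => hUA' (h ▸ hc), hA'A hc⟩
        have h2 := card_le_card hss
        have h3 : 0 < A.card := card_pos.2 ⟨U, hU⟩
        rw [card_sdiff_of_subset hss] at h1
        rw [card_erase_of_mem hU] at h1 h2
        omega)
      (fun z hz ⟨y, hy, hzy⟩ => by
        have h1 := hzdeg W hWA z hz (A.erase W) (erase_subset _ _) (notMem_erase _ _)
          (hfixed W hW z hz y hy hzy)
        have h3 : 0 < A.card := card_pos.2 ⟨U, hU⟩
        rw [card_erase_of_mem hWA] at h1
        omega)
    rw [hPcard W hW] at h1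
    omega
  obtain ⟨W, hW, z, hz, y₁, hy₁, y₂, hy₂, hne, hac₁, hac₂⟩ := exists_swap_pair hr
    (fun W hW => hPA W (hA'A hW)) hPcard hBcard (fun y hy W hW => hblock y hy W (hA'A hW))
    (fun y hy => by
      have h1 := hbound y (hBX hy) (A \ A') sdiff_subset
        (fun c hc => hblock y hy c (mem_sdiff.1 hc).1)
        ((X₀.filter fun u => f u ∈ A') ∪ B)
        (union_subset ((filter_subset _ _).trans hX₀X) hBX) (fun u hu hu₀ => by
          rcases mem_union.1 hu with hu | hu
          · exact fun h => (mem_sdiff.1 h).2 (mem_filter.1 hu).2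
          · exact hBf _ sdiff_subset u hu hu₀)
      have hd : Disjoint (X₀.filter fun u => f u ∈ A') B := by
        rw [disjoint_left]
        intro u hu huB
        exact hBf A' hA'A u huB (mem_filter.1 hu).1 (mem_filter.1 hu).2
      have h2 := card_le_card hA'A
      rw [deg_union hd, ← sum_deg_cls, card_sdiff_of_subset hA'A] at h1
      have h3 : ∑ W ∈ A', deg r (P W) y = ∑ c ∈ A', deg r (cls X₀ f c) y := rfl
      omega) hqt.le
  have hWA := hA'A hW
  have hWc₀ : W ≠ c₀ := fun h => hc₀A' (h ▸ hW)
  obtain ⟨g, hgmaps, hg⟩ := hBcol y₁ hy₁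
  obtain ⟨f', hnear, hP'A, hP'W, hP'B⟩ := h.swap hAK hc₀A hWA hWc₀ hz hy₁ hgmaps hg hac₁
  have hreachA : ∀ c ∈ A.erase W,
      ReflTransGen (Within K (Movable r (cls (X.erase z) f'))) c c₀ := fun c hc =>
    reflTransGen_within_movable_congr ((erase_subset _ _).trans hAK) hP'A
      (hterm W hW c (mem_erase.1 hc).2 (mem_erase.1 hc).1)
  have hreachW : ReflTransGen (Within K (Movable r (cls (X.erase z) f'))) W c₀ := by
    obtain ⟨d, hd, ⟨v, hv, hvd⟩, -⟩ := exists_step_avoiding (hAreach' W hWA) hWc₀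
    have hvz : v ≠ z := by
      rintro rfl
      exact hfixed W hW v hv y₁ hy₁ hac₁ d hd hvd
    refine .head ⟨hAK hWA, hAK (mem_erase.1 hd).2, v, ?_, ?_⟩ (hreachA d hd)
    · rw [hP'W]
      exact mem_insert_of_mem (mem_erase.2 ⟨hvz, hv⟩)
    · rw [← hP'A d hd]
      exact hvd
  have hy₂B : y₂ ∈ B.erase y₁ := mem_erase.2 ⟨hne.symm, hy₂⟩
  have hgy := hgmaps y₂ hy₂B
  have hgK := (mem_sdiff.1 hgy).1
  have hreachg : ReflTransGen (Within K (Movable r (cls (X.erase z) f'))) (g y₂) c₀ := by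
    refine .head ⟨hgK, hAK hWA, y₂, ?_, ?_⟩ hreachW
    · rw [hP'B _ hgy]
      exact mem_cls.2 ⟨hy₂B, rfl⟩
    · rw [hP'W]
      exact hac₂
  refine ⟨z, f', hnear, card_lt_card ((ssubset_iff_of_subset fun c hc => ?_).2
    ⟨g y₂, mem_filter.2 ⟨hgK, hreachg⟩, (mem_sdiff.1 hgy).2⟩)⟩
  refine mem_filter.2 ⟨hAK hc, ?_⟩
  by_cases hcW : c = W
  · rw [hcW]
    exact hreachW
  · exact hreachA c (mem_erase.2 ⟨hcW, hc⟩)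

theorem NearColoring.colorable (hr : ∀ v, ¬ r v v) {X : Finset V} {K : Finset α} {s : ℕ}
    {c₀ : α} (hX : X.card = K.card * s) (hdeg : ∀ v ∈ X, deg r X v + 1 ≤ 2 * K.card)
    (ih : ∀ (X' : Finset V) (K' : Finset α), X'.card < X.card → X'.card = K'.card * s →
      (∀ v ∈ X', deg r X' v + 1 ≤ 2 * K'.card) → Colorable r X' K' fun _ => s)
    {x : V} {f : V → α} (h : NearColoring r X K s x f c₀) : Colorable r X K fun _ => s := by
  induction hN : K.card - (accessible r X K x f c₀).card using Nat.strong_induction_on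
    generalizing x f with
  | _ N ihN =>
    rcases h.colorable_or_improve hr hX hdeg ih with h1 | ⟨x', f', h1, h2⟩
    · exact h1
    · have h3 : (accessible r X K x' f' c₀).card ≤ K.card := card_le_card (filter_subset _ _)
      exact ihN _ (by omega) h1 rfl

/-- The relation `r` restricted to pairs of vertices in `Y`. -/
def restrict (r : V → V → Prop) (Y : Finset V) (u v : V) : Prop := r u v ∧ u ∈ Y ∧ v ∈ Y

theorem dirRel_restrict {Y : Finset V} {b : Bool} {u v : V} :
    dirRel (restrict r Y) b u v ↔ dirRel r b u v ∧ u ∈ Y ∧ v ∈ Y := by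
  cases b
  · simp only [dirRel, restrict]
    tauto
  · rfl

theorem deg_restrict_le (Y C : Finset V) (v : V) : deg (restrict r Y) C v ≤ deg r C v :=
  sum_le_sum fun _ _ => card_le_card (monotone_filter_right _ fun _ _ h =>
    (dirRel_restrict.1 h).1)

/-- Activating the edges at `u` does not affect sets avoiding `u`. -/
theorem IsAcyclicOn.restrict_insert {Y C : Finset V} {u : V}
    (h : IsAcyclicOn (restrict r Y) C) (hu : u ∉ C) :
    IsAcyclicOn (restrict r (insert u Y)) C := by
  intro D hD hne
  obtain ⟨v, hv, b, hb⟩ := h D hD hne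
  have hmem : ∀ w ∈ D, w ∈ insert u Y → w ∈ Y := fun w hw hwY => by
    rcases mem_insert.1 hwY with rfl | h
    · exact absurd (hD hw) hu
    · exact h
  refine ⟨v, hv, b, fun w hw hvw => hb w hw ?_⟩
  obtain ⟨h1, h2, h3⟩ := dirRel_restrict.1 hvw
  exact dirRel_restrict.2 ⟨h1, hmem v hv h2, hmem w hw h3⟩

theorem isAcyclicOn_restrict_empty (C : Finset V) : IsAcyclicOn (restrict r ∅) C := by
  rintro D - ⟨v, hv⟩
  exact ⟨v, hv, true, fun u _ h => notMem_empty _ (dirRel_restrict.1 h).2.1⟩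

theorem colorable_restrict_empty [Nonempty α] {s : ℕ} (K : Finset α) :
    ∀ X : Finset V, X.card = K.card * s → Colorable (restrict r ∅) X K fun _ => s := by
  induction K using Finset.induction_on with
  | empty =>
    intro X hX
    have hX0 : X = ∅ := by simpa using hX
    subst hX0
    exact ⟨fun _ => Classical.arbitrary α, by simp, by simp⟩
  | insert c K hc ih =>
    intro X hX
    rw [card_insert_of_notMem hc, add_mul, one_mul] at hX
    obtain ⟨Z, hZX, hZ⟩ := exists_subset_card_eq (show s ≤ X.card by omega)
    have h1 := (colorable_singleton (c := c) (n := fun _ => s)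
      (isAcyclicOn_restrict_empty (r := r) Z) hZ).union
      (ih (X \ Z) (by rw [card_sdiff_of_subset hZX]; omega)) disjoint_sdiff (by simpa using hc)
    rwa [union_sdiff_of_subset hZX, singleton_union] at h1

/-- A digraph of total degree less than `2 * K.card` on `K.card * s` vertices has an acyclic
colouring with colours in `K` and all classes of size `s`. -/
theorem colorable_of_deg [Nonempty α] {s : ℕ} (X : Finset V) (K : Finset α) (r : V → V → Prop)
    (hr : ∀ v, ¬ r v v) (hX : X.card = K.card * s)
    (hdeg : ∀ v ∈ X, deg r X v + 1 ≤ 2 * K.card) : Colorable r X K fun _ => s := by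
  induction hN : X.card using Nat.strong_induction_on generalizing X K r with
  | _ N ih =>
    have key : ∀ Y : Finset V, Colorable (restrict r Y) X K fun _ => s := by
      intro Y
      induction Y using Finset.induction_on with
      | empty => exact colorable_restrict_empty K X hX
      | insert u Y hu ihY =>
        obtain ⟨f, hf, hfc⟩ := ihY
        by_cases huX : u ∈ X
        · have hr' : ∀ v, ¬ restrict r (insert u Y) v v := fun v h => hr v h.1
          have hnear : NearColoring (restrict r (insert u Y)) X K s u f (f u) := by
            refine ⟨huX, hf u huX, fun v hv => hf v (mem_erase.1 hv).2, fun c hc => ?_,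
              fun c hc => ?_⟩
            · exact ((hfc c hc).1.mono (filter_subset_filter _ (erase_subset _ _))).restrict_insert
                fun h => notMem_erase u X (mem_cls.1 h).1
            · rw [← show (cls X f c).card = s from (hfc c hc).2]
              have herase : cls (X.erase u) f c = (cls X f c).erase u := by
                ext v
                simp only [mem_cls, mem_erase]
                tauto
              rw [herase]
              by_cases hcu : c = f u
              · rw [if_pos hcu, card_erase_add_one (mem_cls.2 ⟨huX, hcu.symm⟩)]
              · rw [if_neg hcu, erase_eq_of_notMem fun h => hcu (mem_cls.1 h).2.symm, add_zero]
          refine hnear.colorable hr' hX (fun v hv => ?_) fun X' K' hlt hX' hdeg' => ?_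
          · exact (Nat.add_le_add_right (deg_restrict_le _ _ _) 1).trans (hdeg v hv)
          · exact ih _ (hN ▸ hlt) X' K' _ hr' hX' hdeg' rfl
        · exact ⟨f, hf, fun c hc => ⟨(hfc c hc).1.restrict_insert
            fun h => huX (mem_cls.1 h).1, (hfc c hc).2⟩⟩
    obtain ⟨f, hf, hfc⟩ := key X
    refine ⟨f, hf, fun c hc => ⟨fun D hD hne => ?_, (hfc c hc).2⟩⟩
    obtain ⟨v, hv, b, hb⟩ := (hfc c hc).1 D hD hne
    have hDX : D ⊆ X := hD.trans (filter_subset _ _)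
    exact ⟨v, hv, b, fun u hu h => hb u hu (dirRel_restrict.2 ⟨h, hDX hv, hDX hu⟩)⟩

/-- The vertices of an acyclic set can be listed so that no edge points forward. -/
theorem IsAcyclicOn.exists_list {C : Finset V} (h : IsAcyclicOn r C) :
    ∃ l : List V, l.Nodup ∧ (∀ v, v ∈ l ↔ v ∈ C) ∧ l.Pairwise fun u v => ¬ r u v := by
  induction hN : C.card generalizing C with
  | zero =>
    obtain rfl := card_eq_zero.1 hN
    exact ⟨[], by simp⟩
  | succ N ih =>
    obtain ⟨v, hv, b, hb⟩ := h C subset_rfl (card_pos.1 (by omega))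
    obtain ⟨l, hl, hlC, hlp⟩ := ih (h.mono (erase_subset v C)) (by
      rw [card_erase_of_mem hv]
      omega)
    have hvl : v ∉ l := fun h => notMem_erase v C ((hlC v).1 h)
    have hlC' : ∀ u ∈ l, u ∈ C := fun u hu => (mem_erase.1 ((hlC u).1 hu)).2
    cases b with
    | true =>
      refine ⟨v :: l, List.nodup_cons.2 ⟨hvl, hl⟩, fun u => ?_,
        List.pairwise_cons.2 ⟨fun u hu => hb u (hlC' u hu), hlp⟩⟩
      rw [List.mem_cons, hlC, mem_erase]
      grind
    | false =>
      refine ⟨l ++ [v], ?_, fun u => ?_, ?_⟩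
      · rw [List.nodup_append]
        grind
      · rw [List.mem_append, List.mem_singleton, hlC, mem_erase]
        grind
      · rw [List.pairwise_append]
        refine ⟨hlp, by simp, fun u hu w hw => ?_⟩
        rw [List.mem_singleton.1 hw]
        exact hb u (hlC' u hu)

/-- In the complement of a loopless digraph on `n` vertices the degrees are `2 * (n - 1)` minus
the original ones. -/
theorem deg_compl_add [Fintype V] [DecidableRel r] (hr : ∀ v, ¬ r v v) (v : V) :
    deg (fun u w => u ≠ w ∧ ¬ r u w) univ v +
      ((univ.filter fun u => r u v).card + (univ.filter fun u => r v u).card) + 2 =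
        2 * Fintype.card V := by
  have key : ∀ (p : V → Prop) [DecidablePred p] (C : Finset V), (∀ u, u ∈ C ↔ u ≠ v ∧ ¬ p u) →
      ¬ p v → C.card + (univ.filter p).card + 1 = Fintype.card V := by
    intro p _ C hC hp
    have h1 : C = (univ.filter fun u => ¬ p u).erase v := by
      ext u
      simp [hC]
    rw [h1, add_right_comm, card_erase_add_one (by simpa using hp), add_comm,
      card_filter_add_card_filter_not, card_univ]
  have h1 := key (fun u => r u v) (nbr (fun u w => u ≠ w ∧ ¬ r u w) false univ v)
    (fun u => mem_filter.trans (by simp [dirRel])) (hr v)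
  have h2 := key (fun u => r v u) (nbr (fun u w => u ≠ w ∧ ¬ r u w) true univ v)
    (fun u => mem_filter.trans (by simp [dirRel, ne_comm])) (hr v)
  simp only [deg, Fintype.sum_bool]
  omega

end AcyclicColoring

/-- **Equitable tiling by transitive tournaments.** A simple directed graph is modelled by
an irreflexive relation `r : V → V → Prop`. If `H` has `n = k * m` vertices and
`d⁻(v) + d⁺(v) ≥ 2n(1 - 1/m) - 1` for every vertex `v`, then `V(H)` can be partitioned
into `k` sets, each of size `m`, each of which can be linearly ordered `v₁, …, v_m` with
an edge from `v_i` to `v_j` for all `i < j` (i.e. each part spans a transitive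
tournament). -/
theorem equitable_tiling_transitive_tournaments {V : Type*} [Fintype V]
    (r : V → V → Prop) [DecidableRel r] (hloopless : ∀ v : V, ¬ r v v)
    (k m : ℕ) (hk : 0 < k) (hm : 0 < m) (hn : Fintype.card V = k * m)
    (hδ : ∀ v : V,
      2 * (Fintype.card V : ℚ) * (1 - 1 / (m : ℚ)) - 1 ≤
        (((Finset.univ.filter fun u => r u v).card +
          (Finset.univ.filter fun u => r v u).card : ℕ) : ℚ)) :
    ∃ f : V → Fin k, ∀ c : Fin k, ∃ g : Fin m → V,
      Function.Injective g ∧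
      (∀ v : V, f v = c ↔ ∃ i : Fin m, g i = v) ∧
      (∀ i j : Fin m, i < j → r (g i) (g j)) := by
  have : Nonempty (Fin k) := ⟨⟨0, hk⟩⟩
  obtain ⟨f, -, hf⟩ := AcyclicColoring.colorable_of_deg (s := m) (Finset.univ : Finset V)
    (Finset.univ : Finset (Fin k)) (fun u w => u ≠ w ∧ ¬ r u w) (fun v h => h.1 rfl)
    (by simpa using hn) (fun v _ => by
      have h1 := AcyclicColoring.deg_compl_add hloopless v
      have h2 : 2 * k * m ≤ (Finset.univ.filter fun u => r u v).card +
          (Finset.univ.filter fun u => r v u).card + 1 + 2 * k := by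
        have h3 := hδ v
        have hm' : (m : ℚ) ≠ 0 := by positivity
        rw [hn] at h3
        have h4 : 2 * ((k * m : ℕ) : ℚ) * (1 - 1 / (m : ℚ)) = 2 * k * m - 2 * k := by
          push_cast
          field_simp
        rw [h4] at h3
        have h5 : ((2 * k * m : ℕ) : ℚ) ≤ (((Finset.univ.filter fun u => r u v).card +
          (Finset.univ.filter fun u => r v u).card + 1 + 2 * k : ℕ) : ℚ) := by
          push_cast at h3 ⊢
          linarith
        exact_mod_cast h5
      rw [hn, ← mul_assoc] at h1
      rw [Finset.card_univ, Fintype.card_fin]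
      omega)
  refine ⟨f, fun c => ?_⟩
  have hac := (hf c (Finset.mem_univ c)).1
  have hcard : (AcyclicColoring.cls Finset.univ f c).card = m := (hf c (Finset.mem_univ c)).2
  obtain ⟨l, hl, hlC, hlp⟩ := hac.exists_list
  have hlen : l.length = m := by
    classical
    rw [← hcard, ← List.toFinset_card_of_nodup hl]
    congr 1
    ext v
    rw [List.mem_toFinset, hlC]
  subst hlen
  refine ⟨l.get, List.nodup_iff_injective_get.1 hl, fun v => ?_, fun i j hij => ?_⟩
  · rw [← List.mem_iff_get, hlC, AcyclicColoring.mem_cls]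
    simp
  · by_contra hcon
    exact List.pairwise_iff_get.1 hlp i j hij
      ⟨fun h => hij.ne (List.nodup_iff_injective_get.1 hl h), hcon⟩
end

section
/- Let k be a positive integer and let G be a simple directed graph on n = 3k vertices such that d⁻(v) + d⁺(v) ≥ 4n/3 − 1 for every vertex v. Then for every t with 1 ≤ t ≤ k, the vertex set of G can be partitioned into k sets of size 3 such that exactly t of the sets span transitive tournaments (there is an ordering u,v,w of the set with edges u→v, u→w, v→w in G) and the remaining k − t sets span cyclic tournaments (there is an ordering u,v,w of the set with edges u→v, v→w, w→u in G). -/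
/-- A loopless multigraph on `3 * k` vertices in which every pair of vertices is joined by at most
two edges and every vertex has degree at least `4 * k - 1`. -/
structure DenseMultigraph {V : Type*} [Fintype V] (μ : V → V → ℕ) (k : ℕ) : Prop where
  symm : ∀ x y, μ x y = μ y x
  le_two : ∀ x y, μ x y ≤ 2
  self : ∀ x, μ x x = 0
  card : Fintype.card V = 3 * k
  degree : ∀ v, 4 * k ≤ ∑ u, μ v u + 1

section Multigraph

variable {V : Type*} {μ : V → V → ℕ} {k m ω : ℕ} {R R' : Multiset V}

/-- The three vertices span at least five edges. -/
def FiveTriangle (μ : V → V → ℕ) (x y z : V) : Prop := 5 ≤ μ x y + μ x z + μ y z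

/-- The three vertices are pairwise adjacent and span at least four edges. -/
def FourTriangle (μ : V → V → ℕ) (x y z : V) : Prop :=
  4 ≤ μ x y + μ x z + μ y z ∧ 1 ≤ μ x y ∧ 1 ≤ μ x z ∧ 1 ≤ μ y z

/-- A five-edge triangle whose first vertex is joined to the other two by double edges. -/
def CenteredTriangle (μ : V → V → ℕ) (x y z : V) : Prop := μ x y = 2 ∧ μ x z = 2 ∧ 1 ≤ μ y z

/-- The vertex set splits into `R` and `m` centered triangles spanning `ω` edges in total. -/
def Packing [Fintype V] (μ : V → V → ℕ) (m ω : ℕ) (R : Multiset V) : Prop :=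
  ∃ S : Multiset (V × V × V), S.card = m ∧
    (S.map fun T => μ T.1 T.2.1 + μ T.1 T.2.2 + μ T.2.1 T.2.2).sum = ω ∧
    (∀ T ∈ S, CenteredTriangle μ T.1 T.2.1 T.2.2) ∧
    (S.map fun T => ({T.1} + {T.2.1} + {T.2.2} : Multiset V)).sum + R = Finset.univ.val

/-- The vertex set splits into five-edge triangles and one four-edge triangle. -/
def HasFactor [Fintype V] (μ : V → V → ℕ) : Prop :=
  ∃ m ω x y z, Packing μ m ω ({x} + {y} + {z}) ∧ FourTriangle μ x y z

variable [Fintype V]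

theorem Packing.insert (G : DenseMultigraph μ k) (h : Packing μ m ω R) {x y z : V}
    (hR : R = {x} + {y} + {z} + R') (hT : FiveTriangle μ x y z) :
    Packing μ (m + 1) (ω + (μ x y + μ x z + μ y z)) R' := by
  obtain ⟨S, hm, hω, hS, hc⟩ := h
  have key : ∀ u v w : V, CenteredTriangle μ u v w →
      ({x} + {y} + {z} : Multiset V) = {u} + {v} + {w} →
      μ x y + μ x z + μ y z = μ u v + μ u w + μ v w →
      Packing μ (m + 1) (ω + (μ x y + μ x z + μ y z)) R' := by
    intro u v w hC hset hw
    refine ⟨(u, v, w) ::ₘ S, by simp [hm], ?_, ?_, ?_⟩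
    · simp only [Multiset.map_cons, Multiset.sum_cons, hω, hw]
      omega
    · intro T hT
      rcases Multiset.mem_cons.1 hT with rfl | h
      · exact hC
      · exact hS T h
    · rw [← hc, hR, hset]
      simp only [Multiset.map_cons, Multiset.sum_cons]
      abel
  have hxy := G.symm x y
  have hxz := G.symm x z
  have hyz := G.symm y z
  have h1 := G.le_two x y
  have h2 := G.le_two x z
  have h3 := G.le_two y z
  unfold FiveTriangle at hT
  by_cases e1 : μ x y = 2
  · by_cases e2 : μ x z = 2
    · exact key x y z ⟨e1, e2, by omega⟩ rfl rfl
    · exact key y x z ⟨by omega, by omega, by omega⟩ (by abel) (by omega)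
  · exact key z x y ⟨by omega, by omega, by omega⟩ (by abel) (by omega)

theorem Packing.congr (h : Packing μ m ω R) (hR : R = R') : Packing μ m ω R' := hR ▸ h

theorem Packing.card_eq (G : DenseMultigraph μ k) (h : Packing μ m ω R) :
    3 * m + R.card = 3 * k := by
  obtain ⟨S, hm, -, -, hc⟩ := h
  have := congrArg Multiset.card hc
  rw [Multiset.card_add, Finset.card_val, Finset.card_univ, G.card] at this
  rw [← this, ← hm]
  congr 1
  clear hm this hc
  induction S using Multiset.induction with
  | empty => simp
  | cons T S ih =>
    simp only [Multiset.map_cons, Multiset.sum_cons, Multiset.card_add, Multiset.card_cons,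
      Multiset.card_singleton, ← ih]
    ring

theorem Packing.weight_le (G : DenseMultigraph μ k) (h : Packing μ m ω R) : ω ≤ 6 * m := by
  obtain ⟨S, rfl, rfl, -, -⟩ := h
  have := Multiset.sum_le_card_nsmul
    (S.map fun T => μ T.1 T.2.1 + μ T.1 T.2.2 + μ T.2.1 T.2.2) 6 (by
      intro a ha
      obtain ⟨T, -, rfl⟩ := Multiset.mem_map.1 ha
      have h1 := G.le_two T.1 T.2.1
      have h2 := G.le_two T.1 T.2.2
      have h3 := G.le_two T.2.1 T.2.2
      omega)
  simp only [Multiset.card_map, smul_eq_mul] at this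
  omega

theorem Packing.degree (G : DenseMultigraph μ k) {S : Multiset (V × V × V)}
    (hc : (S.map fun T => ({T.1} + {T.2.1} + {T.2.2} : Multiset V)).sum + R = Finset.univ.val)
    (z : V) :
    4 * k ≤ (S.map fun T => μ z T.1 + μ z T.2.1 + μ z T.2.2).sum + (R.map (μ z)).sum + 1 := by
  have h := G.degree z
  have e : ∑ u, μ z u = (Finset.univ.val.map (μ z)).sum := rfl
  rw [e, ← hc, Multiset.map_add, Multiset.sum_add] at h
  suffices hs : (Multiset.map (μ z)
      (S.map fun T => ({T.1} + {T.2.1} + {T.2.2} : Multiset V)).sum).sum =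
      (S.map fun T => μ z T.1 + μ z T.2.1 + μ z T.2.2).sum by rwa [hs] at h
  clear h hc e
  induction S using Multiset.induction with
  | empty => simp
  | cons T S ih => simp [← ih]; ring

/-- If the vertices of `L` together send more than `c` edges per triangle to the triangles of a
packing, then some triangle receives more than `c` edges; remove it from the packing. -/
theorem Packing.extract (G : DenseMultigraph μ k) (h : Packing μ m ω R) (L : List V) (c : ℕ)
    (hL : c * m + (L.map fun z => (R.map (μ z)).sum).sum + L.length < 4 * k * L.length) :
    ∃ m' ω' v₁ v₂ v₃, m = m' + 1 ∧ ω = ω' + (4 + μ v₂ v₃) ∧ CenteredTriangle μ v₁ v₂ v₃ ∧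
      c < (L.map fun z => μ z v₁ + μ z v₂ + μ z v₃).sum ∧
      Packing μ m' ω' ({v₁} + {v₂} + {v₃} + R) := by
  classical
  obtain ⟨S, hm, hω, hS, hc⟩ := h
  have hsum : 4 * k * L.length ≤
      (S.map fun T => (L.map fun z => μ z T.1 + μ z T.2.1 + μ z T.2.2).sum).sum +
        (L.map fun z => (R.map (μ z)).sum).sum + L.length := by
    clear hL
    induction L with
    | nil => simp
    | cons z L ih =>
      have := Packing.degree G hc z
      simp only [List.map_cons, List.sum_cons, List.length_cons, Multiset.sum_map_add]
      simp only [Multiset.sum_map_add] at this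
      rw [mul_add]
      omega
  obtain ⟨T, hTS, hT⟩ : ∃ T ∈ S, c < (L.map fun z => μ z T.1 + μ z T.2.1 + μ z T.2.2).sum := by
    by_contra! hno
    have := Multiset.sum_le_card_nsmul
      (S.map fun T => (L.map fun z => μ z T.1 + μ z T.2.1 + μ z T.2.2).sum) c (by
        intro a ha
        obtain ⟨T, hT, rfl⟩ := Multiset.mem_map.1 ha
        exact hno T hT)
    simp only [Multiset.card_map, smul_eq_mul, hm] at this
    rw [mul_comm] at this
    omega
  obtain ⟨S', rfl⟩ := Multiset.exists_cons_of_mem hTS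
  obtain ⟨h1, h2, h3⟩ := hS T hTS
  simp only [Multiset.map_cons, Multiset.sum_cons, Multiset.card_cons] at hc hm hω
  refine ⟨S'.card, _, T.1, T.2.1, T.2.2, hm.symm, ?_, hS T hTS, hT, S', rfl, rfl,
    fun T' hT' => hS T' (Multiset.mem_cons_of_mem hT'), ?_⟩
  · omega
  · rw [← hc]
    abel

theorem Packing.hasFactor (h : Packing μ m ω R) {x y z : V} (hR : R = {x} + {y} + {z})
    (hT : FourTriangle μ x y z) : HasFactor μ :=
  ⟨m, ω, x, y, z, hR ▸ h, hT⟩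

end Multigraph

/-- The predicate `p` holds whenever all nine arguments are at most two. -/
def ForallLeTwo (p : ℕ → ℕ → ℕ → ℕ → ℕ → ℕ → ℕ → ℕ → ℕ → Prop) : Prop :=
  ∀ a₁ ≤ 2, ∀ a₂ ≤ 2, ∀ a₃ ≤ 2, ∀ b₁ ≤ 2, ∀ b₂ ≤ 2, ∀ b₃ ≤ 2, ∀ c₁ ≤ 2, ∀ c₂ ≤ 2, ∀ c₃ ≤ 2,
    p a₁ a₂ a₃ b₁ b₂ b₃ c₁ c₂ c₃

/-- Decide a bounded universal statement by checking its three instances. -/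
def decidableLeTwo (p : ℕ → Prop) [DecidablePred p] : Decidable (∀ a ≤ 2, p a) :=
  decidable_of_iff (p 0 ∧ p 1 ∧ p 2)
    ⟨fun h a ha => by interval_cases a <;> simp [h],
      fun h => ⟨h 0 (by simp), h 1 (by simp), h 2 le_rfl⟩⟩

instance (p : ℕ → ℕ → ℕ → ℕ → ℕ → ℕ → ℕ → ℕ → ℕ → Prop)
    [∀ a₁ a₂ a₃ b₁ b₂ b₃ c₁ c₂ c₃, Decidable (p a₁ a₂ a₃ b₁ b₂ b₃ c₁ c₂ c₃)] :
    Decidable (ForallLeTwo p) :=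
  @decidableLeTwo _ fun _ => @decidableLeTwo _ fun _ => @decidableLeTwo _ fun _ =>
  @decidableLeTwo _ fun _ => @decidableLeTwo _ fun _ => @decidableLeTwo _ fun _ =>
  @decidableLeTwo _ fun _ => @decidableLeTwo _ fun _ => @decidableLeTwo _ fun _ => inferInstance

/-- `a`, `b`, `c` are the rows of three vertices outside a centered triangle `1, 2, 3`. The six
vertices split into a five-edge triangle and three vertices spanning three edges. -/
theorem split_of_sparse : ForallLeTwo fun a₁ a₂ a₃ b₁ b₂ b₃ c₁ c₂ c₃ =>
    13 ≤ a₁ + a₂ + a₃ + b₁ + b₂ + b₃ + c₁ + c₂ + c₃ →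
    (3 ≤ a₁ + a₂ ∧ 3 ≤ b₃ + c₃) ∨
    (3 ≤ a₁ + a₃ ∧ 3 ≤ b₂ + c₂) ∨
    (3 ≤ b₁ + b₂ ∧ 3 ≤ a₃ + c₃) ∨
    (3 ≤ b₁ + b₃ ∧ 3 ≤ a₂ + c₂) ∨
    (3 ≤ c₁ + c₂ ∧ 3 ≤ a₃ + b₃) ∨
    (4 ≤ c₂ + c₃ ∧ 3 ≤ a₁ + b₁) ∨
    (4 ≤ a₂ + a₃ ∧ 3 ≤ b₁ + c₁) ∨
    (3 ≤ c₁ + c₃ ∧ 3 ≤ a₂ + b₂) ∨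
    (4 ≤ b₂ + b₃ ∧ 3 ≤ a₁ + c₁) := by
  decide +kernel

/-- As in `split_of_sparse`, when the outer vertices are pairwise joined by single edges: now the
remaining three vertices span four edges. -/
theorem split_of_light_triangle : ForallLeTwo fun a₁ a₂ a₃ b₁ b₂ b₃ c₁ c₂ c₃ =>
    13 ≤ a₁ + a₂ + a₃ + b₁ + b₂ + b₃ + c₁ + c₂ + c₃ →
    (3 ≤ a₁ + a₂ ∧ 3 ≤ b₃ + c₃) ∨
    (3 ≤ a₁ + a₃ ∧ 3 ≤ b₂ + c₂) ∨
    (3 ≤ b₁ + b₂ ∧ 3 ≤ a₃ + c₃) ∨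
    (3 ≤ b₁ + b₃ ∧ 3 ≤ a₂ + c₂) ∨
    (3 ≤ c₁ + c₂ ∧ 3 ≤ a₃ + b₃) ∨
    (4 ≤ a₁ + b₁ ∧ 3 ≤ c₂ + c₃) ∨
    (4 ≤ a₂ + b₂ ∧ 2 ≤ c₁ + c₃) ∨
    (4 ≤ a₂ + a₃ ∧ 3 ≤ b₁ + c₁) ∨
    (4 ≤ b₂ + b₃ ∧ 3 ≤ a₁ + c₁) := by
  decide +kernel

/-- As in `split_of_light_triangle`, when `ab` is a double edge and `bc` a single edge. -/
theorem split_of_mixed_path : ForallLeTwo fun a₁ a₂ a₃ b₁ b₂ b₃ c₁ c₂ c₃ =>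
    13 ≤ a₁ + a₂ + a₃ + b₁ + b₂ + b₃ + c₁ + c₂ + c₃ →
    (3 ≤ a₂ + b₂ ∧ 2 ≤ c₁ + c₃) ∨
    (3 ≤ a₃ + b₃ ∧ 2 ≤ c₁ + c₂) ∨
    (3 ≤ a₁ + b₁ ∧ 3 ≤ c₂ + c₃) ∨
    (3 ≤ a₁ + a₂ ∧ 3 ≤ b₃ + c₃) ∨
    (3 ≤ a₁ + a₃ ∧ 3 ≤ b₂ + c₂) ∨
    (4 ≤ a₂ + a₃ ∧ 3 ≤ b₁ + c₁) ∨
    (4 ≤ b₂ + c₂ ∧ 2 ≤ a₁ + a₃) ∨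
    (4 ≤ b₃ + c₃ ∧ 2 ≤ a₁ + a₂) := by
  decide +kernel

set_option synthInstance.maxSize 1000 in
/-- If `ab` is a single edge and `bc` a double edge, then the six vertices split into a five-edge
and a four-edge triangle, or some triangle vertex is adjacent to neither `a` nor `c`. -/
theorem path_split : ForallLeTwo fun a₁ a₂ a₃ b₁ b₂ b₃ c₁ c₂ c₃ =>
    13 ≤ a₁ + a₂ + a₃ + b₁ + b₂ + b₃ + c₁ + c₂ + c₃ →
    (3 ≤ a₁ + a₂ ∧ 1 ≤ b₃ ∧ 1 ≤ c₃) ∨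
    (3 ≤ b₂ + c₂ ∧ 1 ≤ a₁ ∧ 1 ≤ a₃) ∨
    (3 ≤ b₁ + c₁ ∧ 3 ≤ a₂ + a₃ ∧ 1 ≤ a₂ ∧ 1 ≤ a₃) ∨
    (3 ≤ c₁ + c₂ ∧ 3 ≤ a₃ + b₃ ∧ 1 ≤ a₃ ∧ 1 ≤ b₃) ∨
    (3 ≤ c₁ + c₃ ∧ 3 ≤ a₂ + b₂ ∧ 1 ≤ a₂ ∧ 1 ≤ b₂) ∨
    (a₁ = 0 ∧ c₁ = 0) ∨
    (a₂ = 0 ∧ c₂ = 0) ∨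
    (a₃ = 0 ∧ c₃ = 0) ∨
    (4 ≤ a₁ + b₁ ∧ 3 ≤ c₂ + c₃ ∧ 1 ≤ c₂ ∧ 1 ≤ c₃) ∨
    (4 ≤ c₂ + c₃ ∧ 3 ≤ a₁ + b₁ ∧ 1 ≤ a₁ ∧ 1 ≤ b₁) := by
  decide +kernel

set_option synthInstance.maxSize 1000 in
/-- If `ab`, `bc` are double edges and the triangle has a single edge, then the six vertices split
into a five-edge and a four-edge triangle, or into a six-edge triangle and a four-edge rest. -/
theorem heavy_path_light_tile : ForallLeTwo fun a₁ a₂ a₃ b₁ b₂ b₃ c₁ c₂ c₃ =>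
    13 ≤ a₁ + a₂ + a₃ + b₁ + b₂ + b₃ + c₁ + c₂ + c₃ →
    (3 ≤ a₂ + b₂ ∧ 1 ≤ c₁ ∧ 1 ≤ c₃) ∨
    (3 ≤ a₃ + b₃ ∧ 1 ≤ c₁ ∧ 1 ≤ c₂) ∨
    (3 ≤ a₁ + b₁ ∧ 3 ≤ c₂ + c₃ ∧ 1 ≤ c₂ ∧ 1 ≤ c₃) ∨
    (3 ≤ b₂ + c₂ ∧ 1 ≤ a₁ ∧ 1 ≤ a₃) ∨
    (4 ≤ b₃ + c₃ ∧ 2 ≤ a₁ + a₂) ∨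
    (4 ≤ a₁ + a₂ ∧ 2 ≤ b₃ + c₃) ∨
    (4 ≤ a₃ + b₃ ∧ 2 ≤ c₁ + c₂) ∨
    (4 ≤ a₂ + b₂ ∧ 2 ≤ c₁ + c₃) ∨
    (4 ≤ c₁ + c₃ ∧ 2 ≤ a₂ + b₂) ∨
    (4 ≤ b₂ + c₂ ∧ 2 ≤ a₁ + a₃) := by
  decide +kernel

set_option synthInstance.maxSize 1000 in
/-- If `ab`, `bc` and all triangle edges are double, then the six vertices split into a five-edge
and a four-edge triangle, or some triangle vertex `i` is adjacent to neither `a` nor `c` and almost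
all edges between `a, c, i` and the remaining three vertices are double. -/
theorem heavy_path_heavy_tile : ForallLeTwo fun a₁ a₂ a₃ b₁ b₂ b₃ c₁ c₂ c₃ =>
    13 ≤ a₁ + a₂ + a₃ + b₁ + b₂ + b₃ + c₁ + c₂ + c₃ →
    (3 ≤ a₁ + b₁ ∧ 1 ≤ c₂ ∧ 1 ≤ c₃) ∨
    (3 ≤ a₂ + b₂ ∧ 1 ≤ c₁ ∧ 1 ≤ c₃) ∨
    (3 ≤ a₃ + b₃ ∧ 1 ≤ c₁ ∧ 1 ≤ c₂) ∨
    (3 ≤ b₁ + c₁ ∧ 1 ≤ a₂ ∧ 1 ≤ a₃) ∨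
    (3 ≤ b₂ + c₂ ∧ 1 ≤ a₁ ∧ 1 ≤ a₃) ∨
    (3 ≤ a₁ + a₂ ∧ 1 ≤ b₃ ∧ 1 ≤ c₃) ∨
    (a₁ = 0 ∧ c₁ = 0 ∧ 3 ≤ b₂ + b₃ ∧ 9 ≤ a₂ + a₃ + c₂ + c₃ + b₁) ∨
    (a₂ = 0 ∧ c₂ = 0 ∧ 3 ≤ b₁ + b₃ ∧ 9 ≤ a₁ + a₃ + c₁ + c₃ + b₂) ∨
    (a₃ = 0 ∧ c₃ = 0 ∧ 3 ≤ b₁ + b₂ ∧ 9 ≤ a₁ + a₂ + c₁ + c₂ + b₃) := by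
  decide +kernel

/-- Some outer vertex can replace the center of the triangle while another is adjacent to it. -/
theorem exchange_center : ForallLeTwo fun a₁ a₂ a₃ b₁ b₂ b₃ c₁ c₂ c₃ =>
    13 ≤ a₁ + a₂ + a₃ + b₁ + b₂ + b₃ + c₁ + c₂ + c₃ →
    (3 ≤ a₂ + a₃ ∧ 1 ≤ a₂ ∧ 1 ≤ a₃ ∧ 2 ≤ b₁) ∨
    (4 ≤ c₂ + c₃ ∧ 1 ≤ a₁) ∨
    (3 ≤ b₂ + b₃ ∧ 1 ≤ b₂ ∧ 1 ≤ b₃ ∧ 2 ≤ c₁) ∨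
    (3 ≤ c₂ + c₃ ∧ 1 ≤ c₂ ∧ 1 ≤ c₃ ∧ 2 ≤ a₁) ∨
    (4 ≤ b₂ + b₃ ∧ 1 ≤ c₁) ∨
    (4 ≤ a₂ + a₃ ∧ 1 ≤ b₁) := by
  decide +kernel

/-- Some outer vertex can replace a noncenter of the triangle while another is adjacent to it. -/
theorem exchange_noncenter : ForallLeTwo fun a₁ a₂ a₃ b₁ b₂ b₃ c₁ c₂ c₃ =>
    13 ≤ a₁ + a₂ + a₃ + b₁ + b₂ + b₃ + c₁ + c₂ + c₃ →
    (3 ≤ a₁ + a₃ ∧ 1 ≤ b₂) ∨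
    (3 ≤ c₁ + c₃ ∧ 1 ≤ a₂) ∨
    (3 ≤ b₁ + b₃ ∧ 1 ≤ c₂) := by
  decide +kernel

set_option synthInstance.maxSize 1000 in
/-- Some outer vertex can replace a triangle vertex to which the other two are adjacent. -/
theorem exchange_common : ForallLeTwo fun a₁ a₂ a₃ b₁ b₂ b₃ c₁ c₂ c₃ =>
    13 ≤ a₁ + a₂ + a₃ + b₁ + b₂ + b₃ + c₁ + c₂ + c₃ →
    (1 ≤ a₂ ∧ 1 ≤ b₂ ∧ 3 ≤ c₁ + c₃) ∨
    (1 ≤ a₂ ∧ 1 ≤ c₂ ∧ 3 ≤ b₁ + b₃) ∨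
    (1 ≤ b₂ ∧ 1 ≤ c₂ ∧ 3 ≤ a₁ + a₃) ∨
    (1 ≤ a₃ ∧ 1 ≤ b₃ ∧ 3 ≤ c₁ + c₂) ∨
    (1 ≤ a₁ ∧ 1 ≤ c₁ ∧ 4 ≤ b₂ + b₃) ∨
    (1 ≤ b₃ ∧ 1 ≤ c₃ ∧ 3 ≤ a₁ + a₂) ∨
    (1 ≤ a₁ ∧ 1 ≤ b₁ ∧ 4 ≤ c₂ + c₃) ∨
    (1 ≤ b₁ ∧ 1 ≤ c₁ ∧ 4 ≤ a₂ + a₃) ∨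
    (1 ≤ a₃ ∧ 1 ≤ c₃ ∧ 3 ≤ b₁ + b₂) := by
  decide +kernel

/-- One of `a`, `b` can replace a triangle vertex adjacent to the other one and to `c`. -/
theorem exchange_pair : ForallLeTwo fun a₁ a₂ a₃ b₁ b₂ b₃ c₁ c₂ c₃ =>
    9 ≤ a₁ + a₂ + a₃ + b₁ + b₂ + b₃ →
    3 ≤ c₁ + c₂ + c₃ →
    (3 ≤ a₁ + a₃ ∧ 1 ≤ b₂ ∧ 1 ≤ c₂) ∨
    (3 ≤ a₁ + a₂ ∧ 1 ≤ b₃ ∧ 1 ≤ c₃) ∨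
    (3 ≤ b₁ + b₃ ∧ 1 ≤ a₂ ∧ 1 ≤ c₂) ∨
    (3 ≤ b₁ + b₂ ∧ 1 ≤ a₃ ∧ 1 ≤ c₃) := by
  decide +kernel

section Multigraph

variable {V : Type*} [Fintype V] {μ : V → V → ℕ} {k m ω : ℕ}

theorem Packing.exists_three_le (G : DenseMultigraph μ k) {a b c : V}
    (h : Packing μ m ω ({a} + {b} + {c})) :
    ∃ ω' x y z, Packing μ m ω' ({x} + {y} + {z}) ∧ 3 ≤ μ x y + μ x z + μ y z := by
  by_cases h3 : 3 ≤ μ a b + μ a c + μ b c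
  · exact ⟨ω, a, b, c, h, h3⟩
  have hcard := h.card_eq G
  have hba := G.symm b a
  have hca := G.symm c a
  have hcb := G.symm c b
  have haa := G.self a
  have hbb := G.self b
  have hcc := G.self c
  obtain ⟨m', ω', v₁, v₂, v₃, rfl, -, ⟨h₁₂, h₁₃, h₂₃⟩, hs, hp⟩ := h.extract G [a, b, c] 12 (by
    simp at hcard ⊢
    omega)
  have key : ∀ x y z u v w : V,
      ({v₁} + {v₂} + {v₃} + ({a} + {b} + {c}) : Multiset V) =
        {x} + {y} + {z} + ({u} + {v} + {w}) →
      5 ≤ μ x y + μ x z + μ y z → 3 ≤ μ u v + μ u w + μ v w →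
      ∃ ω' x y z, Packing μ (m' + 1) ω' ({x} + {y} + {z}) ∧ 3 ≤ μ x y + μ x z + μ y z :=
    fun x y z u v w hR h5 hw => ⟨_, u, v, w, hp.insert G hR h5, hw⟩
  simp only [List.map_cons, List.map_nil, List.sum_cons, List.sum_nil] at hs
  rcases split_of_sparse _ (G.le_two a v₁) _ (G.le_two a v₂) _ (G.le_two a v₃)
    _ (G.le_two b v₁) _ (G.le_two b v₂) _ (G.le_two b v₃)
    _ (G.le_two c v₁) _ (G.le_two c v₂) _ (G.le_two c v₃) (by omega) with
    h | h | h | h | h | h | h | h | h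
  · exact key a v₁ v₂ b c v₃ (by abel) (by omega) (by omega)
  · exact key a v₁ v₃ b c v₂ (by abel) (by omega) (by omega)
  · exact key b v₁ v₂ a c v₃ (by abel) (by omega) (by omega)
  · exact key b v₁ v₃ a c v₂ (by abel) (by omega) (by omega)
  · exact key c v₁ v₂ a b v₃ (by abel) (by omega) (by omega)
  · exact key c v₂ v₃ a b v₁ (by abel) (by omega) (by omega)
  · exact key a v₂ v₃ b c v₁ (by abel) (by omega) (by omega)
  · exact key c v₁ v₃ a b v₂ (by abel) (by omega) (by omega)
  · exact key b v₂ v₃ a c v₁ (by abel) (by omega) (by omega)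

end Multigraph

section Multigraph

variable {V : Type*} [Fintype V] {μ : V → V → ℕ} {k m ω : ℕ}

theorem Packing.exists_four_le_of_three (G : DenseMultigraph μ k) {a b c : V}
    (h : Packing μ m ω ({a} + {b} + {c})) (h3 : μ a b + μ a c + μ b c = 3)
    (hab : (μ a b = 1 ∧ μ a c = 1) ∨ (μ a b = 2 ∧ μ a c = 0)) :
    ∃ ω' x y z, Packing μ m ω' ({x} + {y} + {z}) ∧ 4 ≤ μ x y + μ x z + μ y z := by
  have hcard := h.card_eq G
  have hba := G.symm b a
  have hca := G.symm c a
  have hcb := G.symm c b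
  have haa := G.self a
  have hbb := G.self b
  have hcc := G.self c
  obtain ⟨m', ω', v₁, v₂, v₃, rfl, -, ⟨h₁₂, h₁₃, h₂₃⟩, hs, hp⟩ := h.extract G [a, b, c] 12 (by
    simp at hcard ⊢
    omega)
  have key : ∀ x y z u v w : V,
      ({v₁} + {v₂} + {v₃} + ({a} + {b} + {c}) : Multiset V) =
        {x} + {y} + {z} + ({u} + {v} + {w}) →
      5 ≤ μ x y + μ x z + μ y z → 4 ≤ μ u v + μ u w + μ v w →
      ∃ ω' x y z, Packing μ (m' + 1) ω' ({x} + {y} + {z}) ∧ 4 ≤ μ x y + μ x z + μ y z :=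
    fun x y z u v w hR h5 hw => ⟨_, u, v, w, hp.insert G hR h5, hw⟩
  simp only [List.map_cons, List.map_nil, List.sum_cons, List.sum_nil] at hs
  rcases hab with hab | hab
  · rcases split_of_light_triangle _ (G.le_two a v₁) _ (G.le_two a v₂) _ (G.le_two a v₃)
      _ (G.le_two b v₁) _ (G.le_two b v₂) _ (G.le_two b v₃)
      _ (G.le_two c v₁) _ (G.le_two c v₂) _ (G.le_two c v₃) (by omega) with
      h | h | h | h | h | h | h | h | h
    · exact key a v₁ v₂ b c v₃ (by abel) (by omega) (by omega)
    · exact key a v₁ v₃ b c v₂ (by abel) (by omega) (by omega)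
    · exact key b v₁ v₂ a c v₃ (by abel) (by omega) (by omega)
    · exact key b v₁ v₃ a c v₂ (by abel) (by omega) (by omega)
    · exact key c v₁ v₂ a b v₃ (by abel) (by omega) (by omega)
    · exact key a b v₁ c v₂ v₃ (by abel) (by omega) (by omega)
    · exact key a b v₂ c v₁ v₃ (by abel) (by omega) (by omega)
    · exact key a v₂ v₃ b c v₁ (by abel) (by omega) (by omega)
    · exact key b v₂ v₃ a c v₁ (by abel) (by omega) (by omega)
  · rcases split_of_mixed_path _ (G.le_two a v₁) _ (G.le_two a v₂) _ (G.le_two a v₃)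
      _ (G.le_two b v₁) _ (G.le_two b v₂) _ (G.le_two b v₃)
      _ (G.le_two c v₁) _ (G.le_two c v₂) _ (G.le_two c v₃) (by omega) with
      h | h | h | h | h | h | h | h
    · exact key a b v₂ c v₁ v₃ (by abel) (by omega) (by omega)
    · exact key a b v₃ c v₁ v₂ (by abel) (by omega) (by omega)
    · exact key a b v₁ c v₂ v₃ (by abel) (by omega) (by omega)
    · exact key a v₁ v₂ b c v₃ (by abel) (by omega) (by omega)
    · exact key a v₁ v₃ b c v₂ (by abel) (by omega) (by omega)
    · exact key a v₂ v₃ b c v₁ (by abel) (by omega) (by omega)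
    · exact key b c v₂ a v₁ v₃ (by abel) (by omega) (by omega)
    · exact key b c v₃ a v₁ v₂ (by abel) (by omega) (by omega)

theorem Packing.exists_four_le (G : DenseMultigraph μ k) {a b c : V}
    (h : Packing μ m ω ({a} + {b} + {c})) :
    ∃ ω' x y z, Packing μ m ω' ({x} + {y} + {z}) ∧ 4 ≤ μ x y + μ x z + μ y z := by
  obtain ⟨ω', x, y, z, hp, h3⟩ := h.exists_three_le G
  by_cases h4 : 4 ≤ μ x y + μ x z + μ y z
  · exact ⟨ω', x, y, z, hp, h4⟩
  have h1 := G.le_two x y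
  have h2 := G.le_two x z
  have h3 := G.le_two y z
  have hyx := G.symm x y
  have hzx := G.symm x z
  have hzy := G.symm y z
  have key : ∀ u v w : V, ({x} + {y} + {z} : Multiset V) = {u} + {v} + {w} →
      μ u v + μ u w + μ v w = 3 →
      ((μ u v = 1 ∧ μ u w = 1) ∨ (μ u v = 2 ∧ μ u w = 0)) →
      ∃ ω' x y z, Packing μ m ω' ({x} + {y} + {z}) ∧ 4 ≤ μ x y + μ x z + μ y z :=
    fun u v w hR h3 hT => (hp.congr hR).exists_four_le_of_three G h3 hT
  by_cases e1 : μ x y = 1 ∧ μ x z = 1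
  · exact key x y z rfl (by omega) (by omega)
  by_cases e2 : μ x y = 2
  · by_cases e3 : μ x z = 0
    · exact key x y z rfl (by omega) (by omega)
    · exact key y x z (by abel) (by omega) (by omega)
  by_cases e3 : μ x z = 2
  · by_cases e4 : μ x y = 0
    · exact key x z y (by abel) (by omega) (by omega)
    · exact key z x y (by abel) (by omega) (by omega)
  · by_cases e4 : μ x y = 0
    · exact key y z x (by abel) (by omega) (by omega)
    · exact key z y x (by abel) (by omega) (by omega)

theorem Packing.hasFactor_or_four_le (G : DenseMultigraph μ k) {a b c : V}
    (h : Packing μ m ω ({a} + {b} + {c})) (h4 : 4 ≤ μ a b + μ a c + μ b c) :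
    HasFactor μ ∨ ∃ x y z, Packing μ m ω ({x} + {y} + {z}) ∧
      μ x y = 2 ∧ μ y z = 2 ∧ μ x z = 0 := by
  have h1 := G.le_two a b
  have h2 := G.le_two a c
  have h3 := G.le_two b c
  have hba := G.symm a b
  have hca := G.symm a c
  have hcb := G.symm b c
  by_cases e1 : μ a b = 0
  · exact Or.inr ⟨a, c, b, h.congr (by abel), by omega, by omega, by omega⟩
  by_cases e2 : μ a c = 0
  · exact Or.inr ⟨a, b, c, h, by omega, by omega, by omega⟩
  by_cases e3 : μ b c = 0
  · exact Or.inr ⟨b, a, c, h.congr (by abel), by omega, by omega, by omega⟩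
  · exact Or.inl (h.hasFactor rfl ⟨h4, by omega, by omega, by omega⟩)

end Multigraph

section Multigraph

variable {V : Type*} {μ : V → V → ℕ} {k m ω : ℕ}

/-- An independent triple `x₁, x₂, x₃` joined by double edges to the vertex `t` of the triangle
`c, p, t`, and by double edges with at most one exception to `c` and `p`. -/
structure AlmostJoined (μ : V → V → ℕ) (x₁ x₂ x₃ c p t : V) : Prop where
  x₁₂ : μ x₁ x₂ = 0
  x₁₃ : μ x₁ x₃ = 0
  x₂₃ : μ x₂ x₃ = 0
  cp : μ c p = 2
  ct : μ c t = 2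
  pt : 1 ≤ μ p t
  t₁ : μ x₁ t = 2
  t₂ : μ x₂ t = 2
  t₃ : μ x₃ t = 2
  eleven_le : 11 ≤ μ x₁ c + μ x₂ c + μ x₃ c + (μ x₁ p + μ x₂ p + μ x₃ p)

variable [Fintype V]

theorem Packing.exists_almostJoined (G : DenseMultigraph μ k) {x₁ x₂ x₃ y₁ y₂ y₃ : V}
    (h : Packing μ m ω ({x₁} + {x₂} + {x₃} + ({y₁} + {y₂} + {y₃})))
    (hx : μ x₁ x₂ = 0 ∧ μ x₁ x₃ = 0 ∧ μ x₂ x₃ = 0) (hy : FiveTriangle μ y₁ y₂ y₃)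
    (hs : 17 ≤ μ x₁ y₁ + μ x₂ y₁ + μ x₃ y₁ + (μ x₁ y₂ + μ x₂ y₂ + μ x₃ y₂) +
      (μ x₁ y₃ + μ x₂ y₃ + μ x₃ y₃)) :
    ∃ c p t, Packing μ m ω ({x₁} + {x₂} + {x₃} + ({c} + {p} + {t})) ∧
      AlmostJoined μ x₁ x₂ x₃ c p t := by
  have key : ∀ c p t : V, ({c} + {p} + {t} : Multiset V) = {y₁} + {y₂} + {y₃} →
      μ c p = 2 → μ c t = 2 → 1 ≤ μ p t →
      17 ≤ μ x₁ c + μ x₂ c + μ x₃ c + (μ x₁ p + μ x₂ p + μ x₃ p) +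
        (μ x₁ t + μ x₂ t + μ x₃ t) → 6 ≤ μ x₁ t + μ x₂ t + μ x₃ t →
      ∃ c p t, Packing μ m ω ({x₁} + {x₂} + {x₃} + ({c} + {p} + {t})) ∧
        AlmostJoined μ x₁ x₂ x₃ c p t := by
    intro c p t hR cp ct pt hs ht
    have h1 := G.le_two x₁ t
    have h2 := G.le_two x₂ t
    have h3 := G.le_two x₃ t
    exact ⟨c, p, t, by rwa [hR], hx.1, hx.2.1, hx.2.2, cp, ct, pt, by omega, by omega, by omega,
      by omega⟩
  have b₁₂ := G.le_two y₁ y₂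
  have b₁₃ := G.le_two y₁ y₃
  have b₂₃ := G.le_two y₂ y₃
  have s₁₂ := G.symm y₁ y₂
  have s₁₃ := G.symm y₁ y₃
  have s₂₃ := G.symm y₂ y₃
  have c₁ : μ x₁ y₁ + μ x₂ y₁ + μ x₃ y₁ ≤ 6 := by
    linarith [G.le_two x₁ y₁, G.le_two x₂ y₁, G.le_two x₃ y₁]
  have c₂ : μ x₁ y₂ + μ x₂ y₂ + μ x₃ y₂ ≤ 6 := by
    linarith [G.le_two x₁ y₂, G.le_two x₂ y₂, G.le_two x₃ y₂]
  have c₃ : μ x₁ y₃ + μ x₂ y₃ + μ x₃ y₃ ≤ 6 := by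
    linarith [G.le_two x₁ y₃, G.le_two x₂ y₃, G.le_two x₃ y₃]
  unfold FiveTriangle at hy
  by_cases e₁ : μ y₁ y₂ = 2 ∧ μ y₁ y₃ = 2
  · by_cases f : 6 ≤ μ x₁ y₃ + μ x₂ y₃ + μ x₃ y₃
    · exact key y₁ y₂ y₃ rfl (by omega) (by omega) (by omega) (by omega) f
    · exact key y₁ y₃ y₂ (by abel) (by omega) (by omega) (by omega) (by omega) (by omega)
  by_cases e₂ : μ y₁ y₂ = 2
  · by_cases f : 6 ≤ μ x₁ y₃ + μ x₂ y₃ + μ x₃ y₃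
    · exact key y₂ y₁ y₃ (by abel) (by omega) (by omega) (by omega) (by omega) f
    · exact key y₂ y₃ y₁ (by abel) (by omega) (by omega) (by omega) (by omega) (by omega)
  · by_cases f : 6 ≤ μ x₁ y₂ + μ x₂ y₂ + μ x₃ y₂
    · exact key y₃ y₁ y₂ (by abel) (by omega) (by omega) (by omega) (by omega) f
    · exact key y₃ y₂ y₁ (by abel) (by omega) (by omega) (by omega) (by omega) (by omega)

theorem Packing.heavy_path (G : DenseMultigraph μ k) {a b c : V}
    (h : Packing μ m ω ({a} + {b} + {c})) (hab : μ a b = 2) (hbc : μ b c = 2)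
    (hac : μ a c = 0) :
    HasFactor μ ∨
    (∃ ω' x y z, ω < ω' ∧ Packing μ m ω' ({x} + {y} + {z}) ∧ 4 ≤ μ x y + μ x z + μ y z) ∨
    ∃ m' ω' x₁ x₂ x₃ c p t, Packing μ m' ω' ({x₁} + {x₂} + {x₃} + ({c} + {p} + {t})) ∧
      AlmostJoined μ x₁ x₂ x₃ c p t := by
  have hcard := h.card_eq G
  have hba := G.symm b a
  have hca := G.symm c a
  have hcb := G.symm c b
  have haa := G.self a
  have hbb := G.self b
  have hcc := G.self c
  obtain ⟨m', ω', v₁, v₂, v₃, rfl, rfl, ⟨h₁₂, h₁₃, h₂₃⟩, hs, hp⟩ := h.extract G [a, b, c] 12 (by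
    simp at hcard ⊢
    omega)
  have factor : ∀ x y z u v w : V,
      ({v₁} + {v₂} + {v₃} + ({a} + {b} + {c}) : Multiset V) =
        {x} + {y} + {z} + ({u} + {v} + {w}) →
      5 ≤ μ x y + μ x z + μ y z →
      (4 ≤ μ u v + μ u w + μ v w ∧ 1 ≤ μ u v ∧ 1 ≤ μ u w ∧ 1 ≤ μ v w) → HasFactor μ :=
    fun x y z u v w hR h5 hw => (hp.insert G hR h5).hasFactor rfl hw
  simp only [List.map_cons, List.map_nil, List.sum_cons, List.sum_nil] at hs
  have s₁₂ := G.symm v₁ v₂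
  have s₁₃ := G.symm v₁ v₃
  have s₂₃ := G.symm v₂ v₃
  by_cases e : μ v₂ v₃ = 2
  · have joined : ∀ x y z : V, ({v₁} + {v₂} + {v₃} : Multiset V) = {x} + {y} + {z} →
        μ a x = 0 ∧ μ c x = 0 → 5 ≤ μ b y + μ b z + μ y z → μ x y = 2 → μ x z = 2 →
        9 ≤ μ a y + μ a z + μ c y + μ c z + μ b x →
        ∃ m' ω' x₁ x₂ x₃ c p t, Packing μ m' ω' ({x₁} + {x₂} + {x₃} + ({c} + {p} + {t})) ∧
          AlmostJoined μ x₁ x₂ x₃ c p t := by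
      intro x y z hR hx h5 xy xz hs
      have hxb := G.symm x b
      exact ⟨m', ω', a, c, x,
        (hp.congr (show _ = {a} + {c} + {x} + ({b} + {y} + {z}) by
          rw [hR]; abel)).exists_almostJoined
          G ⟨hac, hx⟩ h5 (by omega)⟩
    rcases heavy_path_heavy_tile _ (G.le_two a v₁) _ (G.le_two a v₂) _ (G.le_two a v₃)
      _ (G.le_two b v₁) _ (G.le_two b v₂) _ (G.le_two b v₃)
      _ (G.le_two c v₁) _ (G.le_two c v₂) _ (G.le_two c v₃) (by omega) with
      h | h | h | h | h | h | h | h | h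
    · exact .inl (factor a b v₁ c v₂ v₃ (by abel) (by omega) (by omega))
    · exact .inl (factor a b v₂ c v₁ v₃ (by abel) (by omega) (by omega))
    · exact .inl (factor a b v₃ c v₁ v₂ (by abel) (by omega) (by omega))
    · exact .inl (factor b c v₁ a v₂ v₃ (by abel) (by omega) (by omega))
    · exact .inl (factor b c v₂ a v₁ v₃ (by abel) (by omega) (by omega))
    · exact .inl (factor a v₁ v₂ b c v₃ (by abel) (by omega) (by omega))
    · exact .inr (.inr (joined v₁ v₂ v₃ rfl (by omega) (by omega) (by omega) (by omega) (by omega)))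
    · exact .inr (.inr (joined v₂ v₁ v₃ (by abel) (by omega) (by omega) (by omega) (by omega)
        (by omega)))
    · exact .inr (.inr (joined v₃ v₁ v₂ (by abel) (by omega) (by omega) (by omega) (by omega)
        (by omega)))
  · have b₂₃ := G.le_two v₂ v₃
    have grow : ∀ x y z u v w : V,
        ({v₁} + {v₂} + {v₃} + ({a} + {b} + {c}) : Multiset V) =
          {x} + {y} + {z} + ({u} + {v} + {w}) →
        6 ≤ μ x y + μ x z + μ y z → 4 ≤ μ u v + μ u w + μ v w →
        ∃ ω'' x y z, ω' + (4 + μ v₂ v₃) < ω'' ∧ Packing μ (m' + 1) ω'' ({x} + {y} + {z}) ∧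
          4 ≤ μ x y + μ x z + μ y z :=
      fun x y z u v w hR h6 hw => ⟨_, u, v, w, by omega,
        hp.insert G hR (show 5 ≤ μ x y + μ x z + μ y z by omega), hw⟩
    rcases heavy_path_light_tile _ (G.le_two a v₁) _ (G.le_two a v₂) _ (G.le_two a v₃)
      _ (G.le_two b v₁) _ (G.le_two b v₂) _ (G.le_two b v₃)
      _ (G.le_two c v₁) _ (G.le_two c v₂) _ (G.le_two c v₃) (by omega) with
      h | h | h | h | h | h | h | h | h | h
    · exact .inl (factor a b v₂ c v₁ v₃ (by abel) (by omega) (by omega))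
    · exact .inl (factor a b v₃ c v₁ v₂ (by abel) (by omega) (by omega))
    · exact .inl (factor a b v₁ c v₂ v₃ (by abel) (by omega) (by omega))
    · exact .inl (factor b c v₂ a v₁ v₃ (by abel) (by omega) (by omega))
    · exact .inr (.inl (grow b c v₃ a v₁ v₂ (by abel) (by omega) (by omega)))
    · exact .inr (.inl (grow a v₁ v₂ b c v₃ (by abel) (by omega) (by omega)))
    · exact .inr (.inl (grow a b v₃ c v₁ v₂ (by abel) (by omega) (by omega)))
    · exact .inr (.inl (grow a b v₂ c v₁ v₃ (by abel) (by omega) (by omega)))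
    · exact .inr (.inl (grow c v₁ v₃ a b v₂ (by abel) (by omega) (by omega)))
    · exact .inr (.inl (grow b c v₂ a v₁ v₃ (by abel) (by omega) (by omega)))

/-- Either there is a factor or there is a packing that leaves an almost joined pair of triples. -/
theorem Packing.hasFactor_or_almostJoined (G : DenseMultigraph μ k) {a b c : V}
    (h : Packing μ m ω ({a} + {b} + {c})) :
    HasFactor μ ∨ ∃ m' ω' x₁ x₂ x₃ c p t,
      Packing μ m' ω' ({x₁} + {x₂} + {x₃} + ({c} + {p} + {t})) ∧
        AlmostJoined μ x₁ x₂ x₃ c p t := by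
  obtain ⟨ω₁, x, y, z, hp, h4⟩ := h.exists_four_le G
  clear h
  induction hd : 6 * m - ω₁ using Nat.strong_induction_on generalizing ω₁ x y z with
  | _ d ih =>
    rcases hp.hasFactor_or_four_le G h4 with hf | ⟨u, v, w, hq, huv, hvw, huw⟩
    · exact .inl hf
    rcases hq.heavy_path G huv hvw huw with hf | ⟨ω₂, x', y', z', hlt, hp', h4'⟩ | hj
    · exact .inl hf
    · have := hp'.weight_le G
      exact ih _ (by omega) ω₂ x' y' z' hp' h4' rfl
    · exact .inr hj

end Multigraph

section Multigraph

variable {V : Type*} [Fintype V] {μ : V → V → ℕ} {k m ω : ℕ} {R : Multiset V}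

theorem Packing.hasFactor_of_insert_two (G : DenseMultigraph μ k) (h : Packing μ m ω R)
    {a₁ a₂ a₃ b₁ b₂ b₃ x y z : V}
    (hR : R = {a₁} + {a₂} + {a₃} + ({b₁} + {b₂} + {b₃} + ({x} + {y} + {z})))
    (ha : 5 ≤ μ a₁ a₂ + μ a₁ a₃ + μ a₂ a₃) (hb : 5 ≤ μ b₁ b₂ + μ b₁ b₃ + μ b₂ b₃)
    (hx : 4 ≤ μ x y + μ x z + μ y z ∧ 1 ≤ μ x y ∧ 1 ≤ μ x z ∧ 1 ≤ μ y z) : HasFactor μ :=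
  ((h.insert G hR ha).insert G rfl hb).hasFactor rfl hx

theorem Packing.hasFactor_of_insert_three (G : DenseMultigraph μ k) (h : Packing μ m ω R)
    {a₁ a₂ a₃ b₁ b₂ b₃ c₁ c₂ c₃ x y z : V}
    (hR : R = {a₁} + {a₂} + {a₃} +
      ({b₁} + {b₂} + {b₃} + ({c₁} + {c₂} + {c₃} + ({x} + {y} + {z}))))
    (ha : 5 ≤ μ a₁ a₂ + μ a₁ a₃ + μ a₂ a₃) (hb : 5 ≤ μ b₁ b₂ + μ b₁ b₃ + μ b₂ b₃)
    (hc : 5 ≤ μ c₁ c₂ + μ c₁ c₃ + μ c₂ c₃)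
    (hx : 4 ≤ μ x y + μ x z + μ y z ∧ 1 ≤ μ x y ∧ 1 ≤ μ x z ∧ 1 ≤ μ y z) : HasFactor μ :=
  (((h.insert G hR ha).insert G rfl hb).insert G rfl hc).hasFactor rfl hx

theorem AlmostJoined.swap (G : DenseMultigraph μ k) {x₁ x₂ x₃ c p t : V}
    (H : AlmostJoined μ x₁ x₂ x₃ c p t) : AlmostJoined μ x₂ x₁ x₃ c p t :=
  ⟨G.symm x₁ x₂ ▸ H.x₁₂, H.x₂₃, H.x₁₃, H.cp, H.ct, H.pt, H.t₂, H.t₁, H.t₃,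
    by linarith [H.eleven_le]⟩

theorem AlmostJoined.rotate (G : DenseMultigraph μ k) {x₁ x₂ x₃ c p t : V}
    (H : AlmostJoined μ x₁ x₂ x₃ c p t) : AlmostJoined μ x₂ x₃ x₁ c p t :=
  ⟨H.x₂₃, G.symm x₁ x₂ ▸ H.x₁₂, G.symm x₁ x₃ ▸ H.x₁₃, H.cp, H.ct, H.pt, H.t₂, H.t₃, H.t₁,
    by linarith [H.eleven_le]⟩

theorem AlmostJoined.three_le (G : DenseMultigraph μ k) {x₁ x₂ x₃ c p t : V}
    (H : AlmostJoined μ x₁ x₂ x₃ c p t) : 3 ≤ μ x₁ c + μ x₁ p := by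
  linarith [H.eleven_le, G.le_two x₂ c, G.le_two x₃ c, G.le_two x₂ p, G.le_two x₃ p]

theorem AlmostJoined.hasFactor_of_tile (G : DenseMultigraph μ k)
    {x₁ x₂ x₃ c p t w w' w'' v₁ v₂ v₃ : V} (H : AlmostJoined μ x₁ x₂ x₃ c p t)
    (h : Packing μ m ω ({v₁} + {v₂} + {v₃} +
      ({x₁} + {x₂} + {x₃} + ({c} + {p} + {t}) + ({w} + {w'} + {w''}))))
    (hv : CenteredTriangle μ v₁ v₂ v₃) (hw : FiveTriangle μ w w' w'')
    (hx₃ : FiveTriangle μ x₃ w' w'') (hwx₁ : 1 ≤ μ w x₁)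
    (hle : μ x₂ v₁ + μ x₂ v₂ + μ x₂ v₃ ≤ μ x₁ v₁ + μ x₁ v₂ + μ x₁ v₃)
    (hs : 25 ≤ μ x₁ v₁ + μ x₁ v₂ + μ x₁ v₃ + (μ x₂ v₁ + μ x₂ v₂ + μ x₂ v₃) +
      2 * (μ t v₁ + μ t v₂ + μ t v₃) + 2 * (μ w v₁ + μ w v₂ + μ w v₃)) :
    HasFactor μ := by
  obtain ⟨h₁₂, h₁₃, h₂₃⟩ := hv
  have hx₁t := H.t₁
  have hx₂t := H.t₂
  have hcp := H.cp
  have hx₂ := (H.rotate G).three_le G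
  have hx₃' := ((H.rotate G).rotate G).three_le G
  have s₁ := G.symm t v₁
  have s₂ := G.symm t v₂
  have s₃ := G.symm t v₃
  have s₄ := G.symm x₁ t
  unfold FiveTriangle at hw hx₃
  have factor : ∀ x y z u v r : V,
      ({w} + {x₁} + {t} + ({v₁} + {v₂} + {v₃}) : Multiset V) =
        {x} + {y} + {z} + ({u} + {v} + {r}) →
      5 ≤ μ x y + μ x z + μ y z →
      (4 ≤ μ u v + μ u r + μ v r ∧ 1 ≤ μ u v ∧ 1 ≤ μ u r ∧ 1 ≤ μ v r) → HasFactor μ := by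
    intro x y z u v r hR h5 h4
    refine h.hasFactor_of_insert_three G (a₁ := x₃) (a₂ := w') (a₃ := w'') (b₁ := x₂) (b₂ := c)
      (b₃ := p) (c₁ := x) (c₂ := y) (c₃ := z) (x := u) (y := v) (z := r) ?_ hx₃ (by omega) h5 h4
    rw [← hR]
    abel
  have zero : ((μ w v₁ = 0 ∧ μ t v₁ = 0) ∨ (μ w v₂ = 0 ∧ μ t v₂ = 0) ∨
      (μ w v₃ = 0 ∧ μ t v₃ = 0)) → HasFactor μ := by
    intro h0
    have b₁ := G.le_two w v₁
    have b₂ := G.le_two w v₂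
    have b₃ := G.le_two w v₃
    have d₁ := G.le_two t v₁
    have d₂ := G.le_two t v₂
    have d₃ := G.le_two t v₃
    have e₁ := G.le_two x₁ v₁
    have e₂ := G.le_two x₁ v₂
    have e₃ := G.le_two x₁ v₃
    rcases exchange_pair _ (G.le_two x₁ v₁) _ (G.le_two x₁ v₂) _ (G.le_two x₁ v₃)
      _ (G.le_two x₂ v₁) _ (G.le_two x₂ v₂) _ (G.le_two x₂ v₃)
      _ (G.le_two t v₁) _ (G.le_two t v₂) _ (G.le_two t v₃) (by omega) (by omega) with
      f | f | f | f
    · exact h.hasFactor_of_insert_three G (a₁ := w) (a₂ := w') (a₃ := w'') (b₁ := x₃) (b₂ := c)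
        (b₃ := p) (c₁ := x₁) (c₂ := v₁) (c₃ := v₃) (x := x₂) (y := t) (z := v₂) (by abel)
        hw (by omega) (by omega) (by omega)
    · exact h.hasFactor_of_insert_three G (a₁ := w) (a₂ := w') (a₃ := w'') (b₁ := x₃) (b₂ := c)
        (b₃ := p) (c₁ := x₁) (c₂ := v₁) (c₃ := v₂) (x := x₂) (y := t) (z := v₃) (by abel)
        hw (by omega) (by omega) (by omega)
    · exact h.hasFactor_of_insert_three G (a₁ := w) (a₂ := w') (a₃ := w'') (b₁ := x₃) (b₂ := c)
        (b₃ := p) (c₁ := x₂) (c₂ := v₁) (c₃ := v₃) (x := x₁) (y := t) (z := v₂) (by abel)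
        hw (by omega) (by omega) (by omega)
    · exact h.hasFactor_of_insert_three G (a₁ := w) (a₂ := w') (a₃ := w'') (b₁ := x₃) (b₂ := c)
        (b₃ := p) (c₁ := x₂) (c₂ := v₁) (c₃ := v₂) (x := x₁) (y := t) (z := v₃) (by abel)
        hw (by omega) (by omega) (by omega)
  rcases path_split _ (G.le_two w v₁) _ (G.le_two w v₂) _ (G.le_two w v₃)
    _ (G.le_two x₁ v₁) _ (G.le_two x₁ v₂) _ (G.le_two x₁ v₃)
    _ (G.le_two t v₁) _ (G.le_two t v₂) _ (G.le_two t v₃) (by omega) with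
    f | f | f | f | f | f | f | f | f | f
  · exact factor w v₁ v₂ x₁ t v₃ (by abel) (by omega) (by omega)
  · exact factor x₁ t v₂ w v₁ v₃ (by abel) (by omega) (by omega)
  · exact factor x₁ t v₁ w v₂ v₃ (by abel) (by omega) (by omega)
  · exact factor t v₁ v₂ w x₁ v₃ (by abel) (by omega) (by omega)
  · exact factor t v₁ v₃ w x₁ v₂ (by abel) (by omega) (by omega)
  · exact zero (.inl f)
  · exact zero (.inr (.inl f))
  · exact zero (.inr (.inr f))
  · exact factor w x₁ v₁ t v₂ v₃ (by abel) (by omega) (by omega)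
  · exact factor t v₂ v₃ w x₁ v₁ (by abel) (by omega) (by omega)

theorem AlmostJoined.hasFactor_of_common (G : DenseMultigraph μ k)
    {x₁ x₂ x₃ c p t w w' w'' : V} (H : AlmostJoined μ x₁ x₂ x₃ c p t)
    (h : Packing μ m ω ({x₁} + {x₂} + {x₃} + ({c} + {p} + {t}) + ({w} + {w'} + {w''})))
    (hw : FiveTriangle μ w w' w'') (hx₃ : FiveTriangle μ x₃ w' w'')
    (hwx₁ : 1 ≤ μ w x₁) (hwx₂ : 1 ≤ μ w x₂) (ht : μ t w = 0 ∧ μ t w' = 0 ∧ μ t w'' = 0) :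
    HasFactor μ := by
  by_contra hno
  have hx₃' := hx₃
  unfold FiveTriangle at hx₃'
  obtain ⟨x₁₂, x₁₃, x₂₃, cp, ct, pt, t₁, t₂, t₃, hel⟩ := id H
  have hpt := G.le_two p t
  have sct := G.symm c t
  have spt := G.symm p t
  have swt := G.symm w t
  have swx₁ := G.symm w x₁
  have swx₂ := G.symm w x₂
  have sx₁t := G.symm t x₁
  have sx₂t := G.symm t x₂
  have sx₃t := G.symm t x₃
  have sx := G.symm x₁ x₂
  have c₁ := G.le_two x₁ c
  have c₂ := G.le_two x₂ c
  have c₃ := G.le_two x₃ c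
  have p₁ := G.le_two x₁ p
  have p₂ := G.le_two x₂ p
  have p₃ := G.le_two x₃ p
  have hwp : μ w p = 0 := by
    by_contra hwp
    apply hno
    by_cases e : μ x₁ p = 2
    · exact h.hasFactor_of_insert_two G (a₁ := x₃) (a₂ := w') (a₃ := w'') (b₁ := x₂) (b₂ := c)
        (b₃ := t) (x := x₁) (y := w) (z := p) (by abel) hx₃' (by omega) (by omega)
    · exact h.hasFactor_of_insert_two G (a₁ := x₃) (a₂ := w') (a₃ := w'') (b₁ := x₁) (b₂ := c)
        (b₃ := t) (x := x₂) (y := w) (z := p) (by abel) hx₃' (by omega) (by omega)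
  have hwc : μ w c = 0 := by
    by_contra hwc
    apply hno
    by_cases e : μ x₁ c = 2 ∧ μ x₂ p = 2
    · exact h.hasFactor_of_insert_two G (a₁ := x₃) (a₂ := w') (a₃ := w'') (b₁ := x₂) (b₂ := p)
        (b₃ := t) (x := x₁) (y := w) (z := c) (by abel) hx₃' (by omega) (by omega)
    · exact h.hasFactor_of_insert_two G (a₁ := x₃) (a₂ := w') (a₃ := w'') (b₁ := x₁) (b₂ := p)
        (b₃ := t) (x := x₂) (y := w) (z := c) (by abel) hx₃' (by omega) (by omega)
  have hcard := h.card_eq G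
  obtain ⟨m', ω', v₁, v₂, v₃, rfl, -, hv, hs, hp⟩ := h.extract G [x₁, x₂, t, t, w, w] 24 (by
    have := G.self x₁
    have := G.self x₂
    have := G.self t
    have := G.self w
    have := G.le_two x₁ w
    have := G.le_two x₁ w'
    have := G.le_two x₁ w''
    have := G.le_two x₂ w
    have := G.le_two x₂ w'
    have := G.le_two x₂ w''
    have := G.le_two w x₃
    have := G.le_two w w'
    have := G.le_two w w''
    simp at hcard ⊢
    omega)
  simp only [List.map_cons, List.map_nil, List.sum_cons, List.sum_nil] at hs
  rcases le_total (μ x₂ v₁ + μ x₂ v₂ + μ x₂ v₃) (μ x₁ v₁ + μ x₁ v₂ + μ x₁ v₃) with hle | hle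
  · exact hno (H.hasFactor_of_tile G hp hv hw hx₃ hwx₁ hle (by omega))
  · exact hno ((H.swap G).hasFactor_of_tile G (hp.congr (by abel)) hv hw hx₃ hwx₂ hle (by omega))

end Multigraph

section Multigraph

variable {V : Type*} [Fintype V] {μ : V → V → ℕ} {k m ω : ℕ}

theorem AlmostJoined.hasFactor (G : DenseMultigraph μ k) {x₁ x₂ x₃ c p t : V}
    (H : AlmostJoined μ x₁ x₂ x₃ c p t)
    (h : Packing μ m ω ({x₁} + {x₂} + {x₃} + ({c} + {p} + {t}))) : HasFactor μ := by
  by_contra hno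
  have hcard := h.card_eq G
  obtain ⟨m', ω', w₁, w₂, w₃, rfl, -, ⟨h₁₂, h₁₃, h₂₃⟩, hs, hp⟩ := h.extract G [x₁, x₂, x₃] 12 (by
    have := G.self x₁
    have := G.self x₂
    have := G.self x₃
    have := G.symm x₁ x₂
    have := G.symm x₁ x₃
    have := G.symm x₂ x₃
    have := H.x₁₂
    have := H.x₁₃
    have := H.x₂₃
    have := G.le_two x₁ c
    have := G.le_two x₂ c
    have := G.le_two x₃ c
    have := G.le_two x₁ p
    have := G.le_two x₂ p
    have := G.le_two x₃ p
    have := H.t₁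
    have := H.t₂
    have := H.t₃
    simp at hcard ⊢
    omega)
  simp only [List.map_cons, List.map_nil, List.sum_cons, List.sum_nil] at hs
  have hcp := H.cp
  have r₁ := H.three_le G
  have r₂ := (H.rotate G).three_le G
  have r₃ := ((H.rotate G).rotate G).three_le G
  have exchange : ∀ x y z w w' w'' : V, ({x} + {y} + {z} : Multiset V) = {x₁} + {x₂} + {x₃} →
      ({w} + {w'} + {w''} : Multiset V) = {w₁} + {w₂} + {w₃} →
      μ y t = 2 → 3 ≤ μ z c + μ z p → μ t w ≠ 0 →
      (5 ≤ μ x w' + μ x w'' + μ w' w'' ∧ 1 ≤ μ y w) ∨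
      ((4 ≤ μ x w' + μ x w'' + μ w' w'' ∧ 1 ≤ μ x w' ∧ 1 ≤ μ x w'' ∧ 1 ≤ μ w' w'') ∧
        2 ≤ μ y w) → False := by
    intro x y z w w' w'' hx hw hyt hz hne hor
    have := G.symm t w
    rcases hor with ⟨h5, hy⟩ | ⟨h4, hy⟩
    · exact hno (hp.hasFactor_of_insert_two G (a₁ := x) (a₂ := w') (a₃ := w'') (b₁ := z)
        (b₂ := c) (b₃ := p) (x := y) (y := w) (z := t) (by rw [← hx, ← hw]; abel)
        h5 (by omega) (by omega))
    · exact hno (hp.hasFactor_of_insert_two G (a₁ := y) (a₂ := w) (a₃ := t) (b₁ := z)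
        (b₂ := c) (b₃ := p) (x := x) (y := w') (z := w'') (by rw [← hx, ← hw]; abel)
        (by omega) (by omega) h4)
  have s₂₃ := G.symm w₂ w₃
  have s₁₂ := G.symm w₁ w₂
  have s₁₃ := G.symm w₁ w₃
  have ht₁ : μ t w₁ = 0 := by
    by_contra hne
    rcases exchange_center _ (G.le_two x₁ w₁) _ (G.le_two x₁ w₂) _ (G.le_two x₁ w₃)
      _ (G.le_two x₂ w₁) _ (G.le_two x₂ w₂) _ (G.le_two x₂ w₃)
      _ (G.le_two x₃ w₁) _ (G.le_two x₃ w₂) _ (G.le_two x₃ w₃) (by omega) with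
      f | f | f | f | f | f
    · exact exchange x₁ x₂ x₃ w₁ w₂ w₃ (by abel) (by abel) H.t₂ r₃ hne (.inr (by omega))
    · exact exchange x₃ x₁ x₂ w₁ w₂ w₃ (by abel) (by abel) H.t₁ r₂ hne (.inl (by omega))
    · exact exchange x₂ x₃ x₁ w₁ w₂ w₃ (by abel) (by abel) H.t₃ r₁ hne (.inr (by omega))
    · exact exchange x₃ x₁ x₂ w₁ w₂ w₃ (by abel) (by abel) H.t₁ r₂ hne (.inr (by omega))
    · exact exchange x₂ x₃ x₁ w₁ w₂ w₃ (by abel) (by abel) H.t₃ r₁ hne (.inl (by omega))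
    · exact exchange x₁ x₂ x₃ w₁ w₂ w₃ (by abel) (by abel) H.t₂ r₃ hne (.inl (by omega))
  have ht₂ : μ t w₂ = 0 := by
    by_contra hne
    rcases exchange_noncenter _ (G.le_two x₁ w₁) _ (G.le_two x₁ w₂) _ (G.le_two x₁ w₃)
      _ (G.le_two x₂ w₁) _ (G.le_two x₂ w₂) _ (G.le_two x₂ w₃)
      _ (G.le_two x₃ w₁) _ (G.le_two x₃ w₂) _ (G.le_two x₃ w₃) (by omega) with f | f | f
    · exact exchange x₁ x₂ x₃ w₂ w₁ w₃ (by abel) (by abel) H.t₂ r₃ hne (.inl (by omega))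
    · exact exchange x₃ x₁ x₂ w₂ w₁ w₃ (by abel) (by abel) H.t₁ r₂ hne (.inl (by omega))
    · exact exchange x₂ x₃ x₁ w₂ w₁ w₃ (by abel) (by abel) H.t₃ r₁ hne (.inl (by omega))
  have ht₃ : μ t w₃ = 0 := by
    by_contra hne
    rcases exchange_noncenter _ (G.le_two x₁ w₁) _ (G.le_two x₁ w₃) _ (G.le_two x₁ w₂)
      _ (G.le_two x₂ w₁) _ (G.le_two x₂ w₃) _ (G.le_two x₂ w₂)
      _ (G.le_two x₃ w₁) _ (G.le_two x₃ w₃) _ (G.le_two x₃ w₂) (by omega) with f | f | f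
    · exact exchange x₁ x₂ x₃ w₃ w₁ w₂ (by abel) (by abel) H.t₂ r₃ hne (.inl (by omega))
    · exact exchange x₃ x₁ x₂ w₃ w₁ w₂ (by abel) (by abel) H.t₁ r₂ hne (.inl (by omega))
    · exact exchange x₂ x₃ x₁ w₃ w₁ w₂ (by abel) (by abel) H.t₃ r₁ hne (.inl (by omega))
  have common : ∀ x y z w w' w'' : V, AlmostJoined μ x y z c p t →
      ({x} + {y} + {z} : Multiset V) = {x₁} + {x₂} + {x₃} →
      ({w} + {w'} + {w''} : Multiset V) = {w₁} + {w₂} + {w₃} →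
      μ t w = 0 ∧ μ t w' = 0 ∧ μ t w'' = 0 → 5 ≤ μ w w' + μ w w'' + μ w' w'' →
      1 ≤ μ x w ∧ 1 ≤ μ y w ∧ 5 ≤ μ z w' + μ z w'' + μ w' w'' → False := by
    intro x y z w w' w'' H' hx hw ht h5 hxyz
    refine hno (H'.hasFactor_of_common G (hp.congr ?_) h5 hxyz.2.2 ?_ ?_ ht)
    · rw [hx, hw]; abel
    · rw [G.symm]; exact hxyz.1
    · rw [G.symm]; exact hxyz.2.1
  have H₁ := H.rotate G
  have H₂ := H₁.rotate G
  rcases exchange_common _ (G.le_two x₁ w₁) _ (G.le_two x₁ w₂) _ (G.le_two x₁ w₃)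
    _ (G.le_two x₂ w₁) _ (G.le_two x₂ w₂) _ (G.le_two x₂ w₃)
    _ (G.le_two x₃ w₁) _ (G.le_two x₃ w₂) _ (G.le_two x₃ w₃) (by omega) with
    f | f | f | f | f | f | f | f | f
  · exact common _ _ _ w₂ w₁ w₃ H (by abel) (by abel) (by omega) (by omega) (by omega)
  · exact common _ _ _ w₂ w₁ w₃ H₂ (by abel) (by abel) (by omega) (by omega) (by omega)
  · exact common _ _ _ w₂ w₁ w₃ H₁ (by abel) (by abel) (by omega) (by omega) (by omega)
  · exact common _ _ _ w₃ w₁ w₂ H (by abel) (by abel) (by omega) (by omega) (by omega)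
  · exact common _ _ _ w₁ w₂ w₃ H₂ (by abel) (by abel) (by omega) (by omega) (by omega)
  · exact common _ _ _ w₃ w₁ w₂ H₁ (by abel) (by abel) (by omega) (by omega) (by omega)
  · exact common _ _ _ w₁ w₂ w₃ H (by abel) (by abel) (by omega) (by omega) (by omega)
  · exact common _ _ _ w₁ w₂ w₃ H₁ (by abel) (by abel) (by omega) (by omega) (by omega)
  · exact common _ _ _ w₃ w₁ w₂ H₂ (by abel) (by abel) (by omega) (by omega) (by omega)

end Multigraph

section Multigraph

variable {V : Type*} [Fintype V] {μ : V → V → ℕ} {k m ω : ℕ} {R : Multiset V}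

theorem Multiset.exists_eq_singleton_add {α : Type*} {R : Multiset α} (h : 0 < R.card) :
    ∃ c R', R = {c} + R' := by
  obtain ⟨c, hc⟩ := Multiset.card_pos_iff_exists_mem.1 h
  exact ⟨c, Multiset.exists_cons_of_mem hc⟩

theorem DenseMultigraph.row_le (G : DenseMultigraph μ k) (x v₁ v₂ v₃ : V) :
    μ x v₁ + μ x v₂ + μ x v₃ ≤ 6 := by
  linarith [G.le_two x v₁, G.le_two x v₂, G.le_two x v₃]

theorem Packing.map_add_map_le (G : DenseMultigraph μ k) (hno : ∀ ω R, ¬Packing μ (m + 1) ω R)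
    {a a' : V} (h : Packing μ m ω ({a} + {a'} + R)) (ha : μ a a' = 2) :
    (R.map (μ a)).sum + (R.map (μ a')).sum ≤ 2 * R.card := by
  rw [← Multiset.sum_map_add]
  have := Multiset.sum_le_card_nsmul (R.map fun z => μ a z + μ a' z) 2 (by
    intro n hn
    obtain ⟨z, hz, rfl⟩ := Multiset.mem_map.1 hn
    obtain ⟨R', rfl⟩ := Multiset.exists_cons_of_mem hz
    by_contra hlt
    refine hno _ _ (h.insert G (x := a) (y := a') (z := z) (R' := R') ?_ ?_)
    · rw [← Multiset.singleton_add]; abel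
    · unfold FiveTriangle; omega)
  simpa [mul_comm] using this

/-- One of two vertices sending many edges to a triangle replaces one of its vertices, and the
other one forms a double edge with the replaced vertex. -/
theorem Packing.exists_heavy_of_rows (G : DenseMultigraph μ k) {a b v₁ v₂ v₃ : V}
    (h : Packing μ m ω ({v₁} + {v₂} + {v₃} + ({a} + {b} + R))) (hv : CenteredTriangle μ v₁ v₂ v₃)
    (ha : 5 ≤ μ a v₁ + μ a v₂ + μ a v₃) (hb : 4 ≤ μ b v₁ + μ b v₂ + μ b v₃) :
    ∃ ω' u v, μ u v = 2 ∧ Packing μ (m + 1) ω' ({u} + {v} + R) := by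
  obtain ⟨h₁₂, h₁₃, h₂₃⟩ := hv
  have a₁ := G.le_two a v₁
  have a₂ := G.le_two a v₂
  have a₃ := G.le_two a v₃
  have b₁ := G.le_two b v₁
  have b₂ := G.le_two b v₂
  have b₃ := G.le_two b v₃
  by_cases hb₂ : μ b v₂ = 2
  · exact ⟨_, b, v₂, hb₂, h.insert G (x := a) (y := v₁) (z := v₃) (by abel)
      (by unfold FiveTriangle; omega)⟩
  by_cases hb₃ : μ b v₃ = 2
  · exact ⟨_, b, v₃, hb₃, h.insert G (x := a) (y := v₁) (z := v₂) (by abel)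
      (by unfold FiveTriangle; omega)⟩
  by_cases ha₂ : μ a v₂ = 2
  · exact ⟨_, a, v₂, ha₂, h.insert G (x := b) (y := v₁) (z := v₃) (by abel)
      (by unfold FiveTriangle; omega)⟩
  · exact ⟨_, a, v₃, by omega, h.insert G (x := b) (y := v₁) (z := v₂) (by abel)
      (by unfold FiveTriangle; omega)⟩

theorem DenseMultigraph.sum_add_one_le_card (G : DenseMultigraph μ k) {Q : Multiset V} {c : V}
    (hc : c ∈ R) (hR : ∀ u v R', R = {u} + {v} + R' → μ u v ≤ 1)
    (hQ : (Q.map (μ c)).sum ≤ Q.card) :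
    ((Q + R).map (μ c)).sum + 1 ≤ (Q + R).card := by
  obtain ⟨R', rfl⟩ := Multiset.exists_cons_of_mem hc
  have hsum := Multiset.sum_le_card_nsmul (R'.map (μ c)) 1 (by
    intro n hn
    obtain ⟨z, hz, rfl⟩ := Multiset.mem_map.1 hn
    obtain ⟨R'', rfl⟩ := Multiset.exists_cons_of_mem hz
    exact hR c z R'' (by rw [← Multiset.singleton_add, ← Multiset.singleton_add, add_assoc]))
  have := G.self c
  simp only [Multiset.card_map, smul_eq_mul, mul_one] at hsum
  simp only [Multiset.map_add, Multiset.sum_add, Multiset.map_cons, Multiset.sum_cons,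
    Multiset.card_add, Multiset.card_cons] at *
  omega

/-- As long as three vertices are left, another double edge can be split off the leftover. -/
theorem Packing.exists_heavy (G : DenseMultigraph μ k) {Q : Multiset V}
    (h : Packing μ m ω (Q + R)) (hR : 3 ≤ R.card)
    (hQ : ∀ z ∈ R, (Q.map (μ z)).sum ≤ Q.card) :
    ∃ ω' u v R', μ u v = 2 ∧ Packing μ m ω' (Q + ({u} + {v}) + R') := by
  by_cases hh : ∃ u v R', R = {u} + {v} + R' ∧ μ u v = 2
  · obtain ⟨u, v, R', rfl, huv⟩ := hh
    exact ⟨ω, u, v, R', huv, h.congr (by abel)⟩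
  have hle : ∀ u v R', R = {u} + {v} + R' → μ u v ≤ 1 := by
    intro u v R' e
    have := G.le_two u v
    by_contra
    exact hh ⟨u, v, R', e, by omega⟩
  obtain ⟨c, R₁, rfl⟩ := Multiset.exists_eq_singleton_add (by omega : 0 < R.card)
  obtain ⟨d, R₂, rfl⟩ := Multiset.exists_eq_singleton_add (R := R₁) (by simp at hR; omega)
  obtain ⟨e, R', rfl⟩ := Multiset.exists_eq_singleton_add (R := R₂) (by simp at hR; omega)
  have hcard := h.card_eq G
  have rc := G.sum_add_one_le_card (c := c) (by simp) hle (hQ c (by simp))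
  have rd := G.sum_add_one_le_card (c := d) (by simp) hle (hQ d (by simp))
  have re := G.sum_add_one_le_card (c := e) (by simp) hle (hQ e (by simp))
  obtain ⟨m', ω', v₁, v₂, v₃, rfl, -, hv, hs, hp⟩ := h.extract G [c, d, e] 12 (by
    simp only [List.map_cons, List.map_nil, List.sum_cons, List.sum_nil, List.length_cons,
      List.length_nil]
    omega)
  simp only [List.map_cons, List.map_nil, List.sum_cons, List.sum_nil] at hs
  have finish : ∀ x y z : V, ({x} + {y} + {z} : Multiset V) = {c} + {d} + {e} →
      5 ≤ μ x v₁ + μ x v₂ + μ x v₃ ∧ 4 ≤ μ y v₁ + μ y v₂ + μ y v₃ →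
      ∃ ω' u v R', μ u v = 2 ∧ Packing μ (m' + 1) ω' (Q + ({u} + {v}) + R') := by
    intro x y z hxyz hxy
    obtain ⟨ω₁, u, v, huv, hp'⟩ := (hp.congr (R' := {v₁} + {v₂} + {v₃} +
      ({x} + {y} + (Q + R' + {z}))) (by
        trans {v₁} + {v₂} + {v₃} + (Q + ({c} + {d} + {e} + R'))
        · abel
        · rw [← hxyz]; abel)).exists_heavy_of_rows G hv hxy.1 hxy.2
    exact ⟨ω₁, u, v, R' + {z}, huv, hp'.congr (by abel)⟩
  have := G.le_two c v₁
  have := G.le_two c v₂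
  have := G.le_two c v₃
  have := G.le_two d v₁
  have := G.le_two d v₂
  have := G.le_two d v₃
  have := G.le_two e v₁
  have := G.le_two e v₂
  have := G.le_two e v₃
  by_cases hcd : 5 ≤ μ c v₁ + μ c v₂ + μ c v₃ ∧ 4 ≤ μ d v₁ + μ d v₂ + μ d v₃
  · exact finish c d e (by abel) hcd
  by_cases hce : 5 ≤ μ c v₁ + μ c v₂ + μ c v₃ ∧ 4 ≤ μ e v₁ + μ e v₂ + μ e v₃
  · exact finish c e d (by abel) hce
  by_cases hdc : 5 ≤ μ d v₁ + μ d v₂ + μ d v₃ ∧ 4 ≤ μ c v₁ + μ c v₂ + μ c v₃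
  · exact finish d c e (by abel) hdc
  by_cases hde : 5 ≤ μ d v₁ + μ d v₂ + μ d v₃ ∧ 4 ≤ μ e v₁ + μ e v₂ + μ e v₃
  · exact finish d e c (by abel) hde
  by_cases hec : 5 ≤ μ e v₁ + μ e v₂ + μ e v₃ ∧ 4 ≤ μ c v₁ + μ c v₂ + μ c v₃
  · exact finish e c d (by abel) hec
  · exact finish e d c (by abel) (by omega)

/-- Two double edges absorb two vertices of a triangle. -/
theorem Packing.exists_add_two_of_pairs (G : DenseMultigraph μ k) {a a' b b' v₁ v₂ v₃ : V}
    (h : Packing μ m ω ({v₁} + {v₂} + {v₃} + ({a} + {a'} + ({b} + {b'}) + R)))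
    (ha : μ a a' = 2) (hb : μ b b' = 2)
    (hA : 9 ≤ μ a v₁ + μ a v₂ + μ a v₃ + (μ a' v₁ + μ a' v₂ + μ a' v₃))
    (hB : 7 ≤ μ b v₁ + μ b v₂ + μ b v₃ + (μ b' v₁ + μ b' v₂ + μ b' v₃)) :
    ∃ ω' R', Packing μ (m + 2) ω' R' := by
  have finish : ∀ u v w : V, ({u} + {v} + {w} : Multiset V) = {v₁} + {v₂} + {v₃} →
      3 ≤ μ a u + μ a' u → 3 ≤ μ b v + μ b' v → ∃ ω' R', Packing μ (m + 2) ω' R' := by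
    intro u v w huvw hu hv
    refine ⟨_, {w} + R, (h.insert G (x := a) (y := a') (z := u)
      (R' := {b} + {b'} + {v} + ({w} + R)) (by rw [← huvw]; abel) ?_).insert G rfl ?_⟩
    · unfold FiveTriangle; omega
    · unfold FiveTriangle; omega
  have := G.le_two a v₁
  have := G.le_two a v₂
  have := G.le_two a v₃
  have := G.le_two a' v₁
  have := G.le_two a' v₂
  have := G.le_two a' v₃
  by_cases hb₁ : 3 ≤ μ b v₁ + μ b' v₁
  · by_cases ha₂ : 3 ≤ μ a v₂ + μ a' v₂
    · exact finish v₂ v₁ v₃ (by abel) ha₂ hb₁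
    · exact finish v₃ v₁ v₂ (by abel) (by omega) hb₁
  by_cases hb₂ : 3 ≤ μ b v₂ + μ b' v₂
  · by_cases ha₁ : 3 ≤ μ a v₁ + μ a' v₁
    · exact finish v₁ v₂ v₃ (by abel) ha₁ hb₂
    · exact finish v₃ v₂ v₁ (by abel) (by omega) hb₂
  · by_cases ha₁ : 3 ≤ μ a v₁ + μ a' v₁
    · exact finish v₁ v₃ v₂ (by abel) ha₁ (by omega)
    · exact finish v₂ v₃ v₁ (by abel) (by omega) (by omega)

/-- A double edge absorbs a vertex of a triangle which is replaced by a further vertex. -/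
theorem Packing.exists_add_two_of_pair (G : DenseMultigraph μ k) {a a' c v₁ v₂ v₃ : V}
    (h : Packing μ m ω ({v₁} + {v₂} + {v₃} + ({a} + {a'} + {c} + R)))
    (hv : CenteredTriangle μ v₁ v₂ v₃) (ha : μ a a' = 2)
    (hor : (9 ≤ μ a v₁ + μ a v₂ + μ a v₃ + (μ a' v₁ + μ a' v₂ + μ a' v₃) ∧
        5 ≤ μ c v₁ + μ c v₂ + μ c v₃) ∨
      (7 ≤ μ a v₁ + μ a v₂ + μ a v₃ + (μ a' v₁ + μ a' v₂ + μ a' v₃) ∧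
        6 ≤ μ c v₁ + μ c v₂ + μ c v₃) ∨
      (11 ≤ μ a v₁ + μ a v₂ + μ a v₃ + (μ a' v₁ + μ a' v₂ + μ a' v₃) ∧
        4 ≤ μ c v₁ + μ c v₂ + μ c v₃)) :
    ∃ ω' R', Packing μ (m + 2) ω' R' := by
  obtain ⟨h₁₂, h₁₃, h₂₃⟩ := hv
  have finish : ∀ u v w : V, ({u} + {v} + {w} : Multiset V) = {v₁} + {v₂} + {v₃} →
      3 ≤ μ a u + μ a' u → 5 ≤ μ c v + μ c w + μ v w → ∃ ω' R', Packing μ (m + 2) ω' R' := by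
    intro u v w huvw hu hv
    refine ⟨_, R, (h.insert G (x := a) (y := a') (z := u)
      (R' := {c} + {v} + {w} + R) (by rw [← huvw]; abel) ?_).insert G rfl hv⟩
    unfold FiveTriangle; omega
  have := G.le_two a v₁
  have := G.le_two a v₂
  have := G.le_two a v₃
  have := G.le_two a' v₁
  have := G.le_two a' v₂
  have := G.le_two a' v₃
  have := G.le_two c v₁
  have := G.le_two c v₂
  have := G.le_two c v₃
  by_cases f₁ : 3 ≤ μ a v₂ + μ a' v₂ ∧ 3 ≤ μ c v₁ + μ c v₃
  · exact finish v₂ v₁ v₃ (by abel) f₁.1 (by omega)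
  by_cases f₂ : 3 ≤ μ a v₃ + μ a' v₃ ∧ 3 ≤ μ c v₁ + μ c v₂
  · exact finish v₃ v₁ v₂ (by abel) f₂.1 (by omega)
  · exact finish v₁ v₂ v₃ (by abel) (by omega) (by omega)

theorem Packing.exists_succ_of_three_pairs (G : DenseMultigraph μ k) {a a' b b' c c' : V}
    (h : Packing μ m ω ({a} + {a'} + ({b} + {b'}) + ({c} + {c'}) + R))
    (ha : μ a a' = 2) (hb : μ b b' = 2) (hc : μ c c' = 2) :
    ∃ ω' R', Packing μ (m + 1) ω' R' := by
  by_contra! hno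
  have hcard := h.card_eq G
  have ra := (h.congr (R' := {a} + {a'} + ({b} + {b'} + ({c} + {c'}) + R))
    (by abel)).map_add_map_le G hno ha
  have rb := (h.congr (R' := {b} + {b'} + ({a} + {a'} + ({c} + {c'}) + R))
    (by abel)).map_add_map_le G hno hb
  have rc := (h.congr (R' := {c} + {c'} + ({a} + {a'} + ({b} + {b'}) + R))
    (by abel)).map_add_map_le G hno hc
  obtain ⟨m', ω', v₁, v₂, v₃, rfl, -, hv, hs, hp⟩ := h.extract G [a, a', b, b', c, c'] 24 (by
    have := G.self a
    have := G.self a'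
    have := G.self b
    have := G.self b'
    have := G.self c
    have := G.self c'
    have := G.symm a a'
    have := G.symm b b'
    have := G.symm c c'
    simp at *
    omega)
  simp only [List.map_cons, List.map_nil, List.sum_cons, List.sum_nil] at hs
  have finish : ∀ x x' y y' z z' : V, ({x} + {x'} + ({y} + {y'}) + ({z} + {z'}) : Multiset V) =
      {a} + {a'} + ({b} + {b'}) + ({c} + {c'}) → μ x x' = 2 → μ y y' = 2 →
      ¬(9 ≤ μ x v₁ + μ x v₂ + μ x v₃ + (μ x' v₁ + μ x' v₂ + μ x' v₃) ∧
        7 ≤ μ y v₁ + μ y v₂ + μ y v₃ + (μ y' v₁ + μ y' v₂ + μ y' v₃)) := by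
    intro x x' y y' z z' hxyz hx hy hle
    obtain ⟨ω₁, R₁, hp'⟩ := (hp.congr (R' := {v₁} + {v₂} + {v₃} +
      ({x} + {x'} + ({y} + {y'}) + ({z} + {z'} + R)))
      (by rw [← hxyz]; abel)).exists_add_two_of_pairs G hx hy hle.1 hle.2
    exact hno _ _ hp'
  have := G.le_two a v₁
  have := G.le_two a v₂
  have := G.le_two a v₃
  have := G.le_two a' v₁
  have := G.le_two a' v₂
  have := G.le_two a' v₃
  have := G.le_two b v₁
  have := G.le_two b v₂
  have := G.le_two b v₃
  have := G.le_two b' v₁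
  have := G.le_two b' v₂
  have := G.le_two b' v₃
  have := G.le_two c v₁
  have := G.le_two c v₂
  have := G.le_two c v₃
  have := G.le_two c' v₁
  have := G.le_two c' v₂
  have := G.le_two c' v₃
  have := finish a a' b b' c c' (by abel) ha hb
  have := finish a a' c c' b b' (by abel) ha hc
  have := finish b b' a a' c c' (by abel) hb ha
  have := finish b b' c c' a a' (by abel) hb hc
  have := finish c c' a a' b b' (by abel) hc ha
  have := finish c c' b b' a a' (by abel) hc hb
  omega

theorem Packing.exists_succ_of_two_pairs (G : DenseMultigraph μ k) {a a' b b' : V}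
    (h : Packing μ m ω ({a} + {a'} + ({b} + {b'}) + R))
    (ha : μ a a' = 2) (hb : μ b b' = 2) (hR : 2 ≤ R.card) :
    ∃ ω' R', Packing μ (m + 1) ω' R' := by
  by_contra! hno
  have hle : ∀ u v R', R = {u} + {v} + R' → μ u v ≤ 1 := by
    rintro u v R' rfl
    have := G.le_two u v
    by_contra
    obtain ⟨_, _, hp⟩ := (h.congr (R' := {a} + {a'} + ({b} + {b'}) + ({u} + {v}) + R')
      (by abel)).exists_succ_of_three_pairs G ha hb (by omega)
    exact hno _ _ hp
  have hcard := h.card_eq G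
  have ra := (h.congr (R' := {a} + {a'} + ({b} + {b'} + R)) (by abel)).map_add_map_le G hno ha
  have rb := (h.congr (R' := {b} + {b'} + ({a} + {a'} + R)) (by abel)).map_add_map_le G hno hb
  have row : ∀ z ∈ R, ((({a} + {a'} + ({b} + {b'}) : Multiset V)).map (μ z)).sum ≤
      ({a} + {a'} + ({b} + {b'}) : Multiset V).card := by
    intro z hz
    obtain ⟨R', rfl⟩ := Multiset.exists_cons_of_mem hz
    have hza : μ a z + μ a' z ≤ 2 := by
      by_contra
      refine hno _ _ (h.insert G (x := a) (y := a') (z := z) (R' := {b} + {b'} + R') ?_ ?_)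
      · rw [← Multiset.singleton_add]; abel
      · unfold FiveTriangle; omega
    have hzb : μ b z + μ b' z ≤ 2 := by
      by_contra
      refine hno _ _ (h.insert G (x := b) (y := b') (z := z) (R' := {a} + {a'} + R') ?_ ?_)
      · rw [← Multiset.singleton_add]; abel
      · unfold FiveTriangle; omega
    have := G.symm a z
    have := G.symm a' z
    have := G.symm b z
    have := G.symm b' z
    simp
    omega
  obtain ⟨c, R₁, rfl⟩ := Multiset.exists_eq_singleton_add (by omega : 0 < R.card)
  obtain ⟨d, R', rfl⟩ := Multiset.exists_eq_singleton_add (R := R₁) (by simp at hR; omega)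
  have rc := G.sum_add_one_le_card (c := c) (by simp) hle (row c (by simp))
  have rd := G.sum_add_one_le_card (c := d) (by simp) hle (row d (by simp))
  obtain ⟨m', ω', v₁, v₂, v₃, rfl, -, hv, hs, hp⟩ := h.extract G [a, a', b, b', c, d] 24 (by
    have := G.self a
    have := G.self a'
    have := G.self b
    have := G.self b'
    have := G.symm a a'
    have := G.symm b b'
    simp only [List.map_cons, List.map_nil, List.sum_cons, List.sum_nil, List.length_cons,
      List.length_nil, Multiset.map_add, Multiset.sum_add, Multiset.map_singleton,
      Multiset.sum_singleton, Multiset.card_add, Multiset.card_singleton] at *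
    omega)
  simp only [List.map_cons, List.map_nil, List.sum_cons, List.sum_nil] at hs
  have pairs : ∀ x x' y y' : V, ({x} + {x'} + ({y} + {y'}) : Multiset V) =
      {a} + {a'} + ({b} + {b'}) → μ x x' = 2 → μ y y' = 2 →
      ¬(9 ≤ μ x v₁ + μ x v₂ + μ x v₃ + (μ x' v₁ + μ x' v₂ + μ x' v₃) ∧
        7 ≤ μ y v₁ + μ y v₂ + μ y v₃ + (μ y' v₁ + μ y' v₂ + μ y' v₃)) := by
    intro x x' y y' hxy hx hy hle
    obtain ⟨_, _, hp'⟩ := (hp.congr (by rw [← hxy])).exists_add_two_of_pairs G hx hy hle.1 hle.2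
    exact hno _ _ hp'
  have rows : ∀ x y : V, ({x} + {y} : Multiset V) = {c} + {d} →
      ¬(5 ≤ μ x v₁ + μ x v₂ + μ x v₃ ∧ 4 ≤ μ y v₁ + μ y v₂ + μ y v₃) := by
    intro x y hxy hle
    obtain ⟨_, u, v, huv, hp'⟩ := (hp.congr (R' := {v₁} + {v₂} + {v₃} +
      ({x} + {y} + ({a} + {a'} + ({b} + {b'}) + R'))) (by
        rw [hxy]; abel)).exists_heavy_of_rows G hv hle.1 hle.2
    obtain ⟨_, _, hp''⟩ := (hp'.congr (R' := {a} + {a'} + ({b} + {b'}) + ({u} + {v}) + R')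
      (by abel)).exists_succ_of_three_pairs G ha hb huv
    exact hno _ _ hp''
  have single : ∀ x x' y y' z z' : V, ({x} + {x'} + ({y} + {y'}) + ({z} + {z'}) : Multiset V) =
      {a} + {a'} + ({b} + {b'}) + ({c} + {d}) → μ x x' = 2 →
      ¬((9 ≤ μ x v₁ + μ x v₂ + μ x v₃ + (μ x' v₁ + μ x' v₂ + μ x' v₃) ∧
          5 ≤ μ z v₁ + μ z v₂ + μ z v₃) ∨
        (7 ≤ μ x v₁ + μ x v₂ + μ x v₃ + (μ x' v₁ + μ x' v₂ + μ x' v₃) ∧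
          6 ≤ μ z v₁ + μ z v₂ + μ z v₃) ∨
        (11 ≤ μ x v₁ + μ x v₂ + μ x v₃ + (μ x' v₁ + μ x' v₂ + μ x' v₃) ∧
          4 ≤ μ z v₁ + μ z v₂ + μ z v₃)) := by
    intro x x' y y' z z' hxyz hx hor
    obtain ⟨_, _, hp'⟩ := (hp.congr (R' := {v₁} + {v₂} + {v₃} +
      ({x} + {x'} + {z} + ({y} + {y'} + {z'} + R'))) (by
        trans {v₁} + {v₂} + {v₃} + ({a} + {a'} + ({b} + {b'}) + ({c} + {d}) + R')
        · abel
        · rw [← hxyz]; abel)).exists_add_two_of_pair G hv hx hor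
    exact hno _ _ hp'
  have := G.row_le a v₁ v₂ v₃
  have := G.row_le a' v₁ v₂ v₃
  have := G.row_le b v₁ v₂ v₃
  have := G.row_le b' v₁ v₂ v₃
  have := G.row_le c v₁ v₂ v₃
  have := G.row_le d v₁ v₂ v₃
  have := pairs a a' b b' (by abel) ha hb
  have := pairs b b' a a' (by abel) hb ha
  have := rows c d (by abel)
  have := rows d c (by abel)
  have := single a a' b b' c d (by abel) ha
  have := single a a' b b' d c (by abel) ha
  have := single b b' a a' c d (by abel) hb
  have := single b b' a a' d c (by abel) hb
  generalize μ a v₁ + μ a v₂ + μ a v₃ = A at *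
  generalize μ a' v₁ + μ a' v₂ + μ a' v₃ = A' at *
  generalize μ b v₁ + μ b v₂ + μ b v₃ = B at *
  generalize μ b' v₁ + μ b' v₂ + μ b' v₃ = B' at *
  generalize μ c v₁ + μ c v₂ + μ c v₃ = C at *
  generalize μ d v₁ + μ d v₂ + μ d v₃ = D at *
  clear pairs rows single hno hle row ra rb rc rd hcard h hp
  grind

theorem Packing.exists_succ (G : DenseMultigraph μ k) (h : Packing μ m ω R) (hm : m + 2 ≤ k) :
    ∃ ω' R', Packing μ (m + 1) ω' R' := by
  by_contra! hno
  have hcard := h.card_eq G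
  obtain ⟨ω₁, a, a', R₁, ha, h₁⟩ := (h.congr (R' := 0 + R) (by simp)).exists_heavy G
    (by omega) (by simp)
  rw [zero_add] at h₁
  have hcard₁ := h₁.card_eq G
  simp only [Multiset.card_add, Multiset.card_singleton] at hcard₁
  obtain ⟨ω₂, b, b', R₂, hb, h₂⟩ := h₁.exists_heavy G (by omega) (by
    intro z hz
    obtain ⟨R', rfl⟩ := Multiset.exists_cons_of_mem hz
    have hza : μ a z + μ a' z ≤ 2 := by
      by_contra
      refine hno _ _ (h₁.insert G (x := a) (y := a') (z := z) (R' := R') ?_ ?_)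
      · rw [← Multiset.singleton_add]; abel
      · unfold FiveTriangle; omega
    have := G.symm a z
    have := G.symm a' z
    simp
    omega)
  have hcard₂ := h₂.card_eq G
  simp only [Multiset.card_add, Multiset.card_singleton] at hcard₂
  obtain ⟨_, _, h₃⟩ := h₂.exists_succ_of_two_pairs G ha hb (by omega)
  exact hno _ _ h₃

theorem DenseMultigraph.exists_packing (G : DenseMultigraph μ k) (hm : m + 1 ≤ k) :
    ∃ ω R, Packing μ m ω R := by
  induction m with
  | zero => exact ⟨0, Finset.univ.val, 0, by simp⟩
  | succ m ih =>
    obtain ⟨_, _, h⟩ := ih (by omega)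
    exact h.exists_succ G hm

theorem DenseMultigraph.hasFactor (G : DenseMultigraph μ k) (hk : 0 < k) : HasFactor μ := by
  obtain ⟨ω, R, h⟩ := G.exists_packing (m := k - 1) (by omega)
  have hcard := h.card_eq G
  obtain ⟨a, b, c, rfl⟩ := Multiset.card_eq_three.1 (by omega : R.card = 3)
  rcases (h.congr (R' := {a} + {b} + {c}) rfl).hasFactor_or_almostJoined G with
    hf | ⟨_, _, _, _, _, _, _, _, hp, H⟩
  · exact hf
  · exact H.hasFactor G hp

end Multigraph

section Multigraph

variable {V : Type*} [Fintype V] {μ : V → V → ℕ} {k : ℕ}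

theorem FiveTriangle.fourTriangle (G : DenseMultigraph μ k) {x y z : V}
    (h : FiveTriangle μ x y z) : FourTriangle μ x y z := by
  have := G.le_two x y
  have := G.le_two x z
  have := G.le_two y z
  unfold FiveTriangle at h
  unfold FourTriangle
  omega

theorem HasFactor.exists_tiles (G : DenseMultigraph μ k) (hf : HasFactor μ) :
    ∃ g : Fin k → V × V × V,
      ∑ i, ({(g i).1} + {(g i).2.1} + {(g i).2.2} : Multiset V) = Finset.univ.val ∧
      (∀ i, FourTriangle μ (g i).1 (g i).2.1 (g i).2.2) ∧
      ∀ i, i.val ≠ 0 → FiveTriangle μ (g i).1 (g i).2.1 (g i).2.2 := by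
  obtain ⟨m, ω, x, y, z, h, h4⟩ := hf
  have hcard := h.card_eq G
  obtain ⟨S, hm, -, hS, hc⟩ := h
  obtain ⟨l, rfl⟩ := Quot.exists_rep S
  obtain rfl : l.length + 1 = k := by
    simp at hcard hm
    omega
  have five : ∀ i : Fin l.length, FiveTriangle μ (l.get i).1 (l.get i).2.1 (l.get i).2.2 := by
    intro i
    obtain ⟨h₁, h₂, h₃⟩ := hS (l.get i) (List.get_mem l i)
    unfold FiveTriangle
    omega
  refine ⟨Fin.cons (x, y, z) l.get, ?_, ?_, ?_⟩
  · rw [Fin.sum_univ_succ, ← hc, add_comm]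
    simp only [Fin.cons_zero, Fin.cons_succ]
    congr 1
    change _ = (List.map _ l).sum
    rw [← List.sum_ofFn]
    congr 1
    apply List.ext_get <;> simp
  · refine Fin.cases h4 fun i => ?_
    exact (five i).fourTriangle G
  · refine Fin.cases (fun h => absurd rfl h) fun i _ => ?_
    exact five i

theorem exists_fiber_eq [DecidableEq V] {g : Fin k → V × V × V}
    (hg : ∑ i, ({(g i).1} + {(g i).2.1} + {(g i).2.2} : Multiset V) = Finset.univ.val) :
    ∃ f : V → Fin k, ∀ i,
      (Finset.univ.filter fun x => f x = i) = {(g i).1, (g i).2.1, (g i).2.2} := by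
  have hex : ∀ v, ∃ i, v ∈ ({(g i).1} + {(g i).2.1} + {(g i).2.2} : Multiset V) := by
    intro v
    have hv : v ∈ (Finset.univ : Finset V).val := Finset.mem_univ v
    rw [← hg, Multiset.mem_sum] at hv
    simpa using hv
  have huniq : ∀ v i j, v ∈ ({(g i).1} + {(g i).2.1} + {(g i).2.2} : Multiset V) →
      v ∈ ({(g j).1} + {(g j).2.1} + {(g j).2.2} : Multiset V) → i = j := by
    intro v i j hi hj
    by_contra hne
    have h1 := Multiset.count_eq_one_of_mem Finset.univ.nodup (Finset.mem_univ v)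
    rw [← hg, Multiset.count_sum'] at h1
    have h2 := Finset.sum_le_univ_sum_of_nonneg (s := {i, j})
      (f := fun i => Multiset.count v ({(g i).1} + {(g i).2.1} + {(g i).2.2})) (by simp)
    rw [Finset.sum_pair hne] at h2
    have := Multiset.count_pos.2 hi
    have := Multiset.count_pos.2 hj
    omega
  choose f hf using hex
  refine ⟨f, fun i => ?_⟩
  ext v
  have : f v = i ↔ v ∈ ({(g i).1} + {(g i).2.1} + {(g i).2.2} : Multiset V) :=
    ⟨fun h => h ▸ hf v, fun h => huniq v _ _ (hf v) h⟩
  simp [this]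

end Multigraph

section Relation

variable {V : Type*} (r : V → V → Prop) [DecidableRel r]

/-- The number of edges between two vertices, in either direction. -/
def edgeCount (x y : V) : ℕ := (if r x y then 1 else 0) + if r y x then 1 else 0

variable {r}

theorem FourTriangle.exists_transitive [DecidableEq V] {x y z : V}
    (h : FourTriangle (edgeCount r) x y z) :
    ∃ u v w : V, ({x, y, z} : Finset V) = {u, v, w} ∧ r u v ∧ r u w ∧ r v w := by
  by_contra! hno
  have h₁ := hno x y z rfl
  have h₂ := hno x z y (by grind)
  have h₃ := hno y x z (by grind)
  have h₄ := hno y z x (by grind)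
  have h₅ := hno z x y (by grind)
  have h₆ := hno z y x (by grind)
  unfold FourTriangle edgeCount at h
  grind

theorem FiveTriangle.exists_cyclic [DecidableEq V] {x y z : V}
    (h : FiveTriangle (edgeCount r) x y z) :
    ∃ u v w : V, ({x, y, z} : Finset V) = {u, v, w} ∧ r u v ∧ r v w ∧ r w u := by
  by_contra! hno
  have h₁ := hno x y z rfl
  have h₂ := hno x z y (by grind)
  unfold FiveTriangle edgeCount at h
  grind

end Relation

/-- **Tiling by mixtures of transitive and cyclic triangle tournaments
(Czygrinow–Kierstead–Molla).** A simple directed graph is modelled by an irreflexive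
relation `r : V → V → Prop`. Suppose `G` has `n = 3k` vertices and
`d⁻(v) + d⁺(v) ≥ 4n/3 - 1` for every vertex `v`. Then for every `t` with `1 ≤ t ≤ k`,
the vertex set can be partitioned into `k` sets of size `3` such that exactly `t` of them
span transitive tournaments and the remaining `k - t` span cyclic tournaments. -/
theorem tiling_transitive_and_cyclic_triangles {V : Type*} [Fintype V] [DecidableEq V]
    (r : V → V → Prop) [DecidableRel r] (hloopless : ∀ v : V, ¬ r v v)
    (k : ℕ) (hk : 0 < k) (hn : Fintype.card V = 3 * k)
    (hδ : ∀ v : V,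
      4 * (Fintype.card V : ℚ) / 3 - 1 ≤
        (((Finset.univ.filter fun u => r u v).card +
          (Finset.univ.filter fun u => r v u).card : ℕ) : ℚ)) :
    ∀ t : ℕ, 1 ≤ t → t ≤ k →
      ∃ f : V → Fin k, ∃ T : Finset (Fin k), T.card = t ∧
        (∀ c ∈ T, ∃ u v w : V,
          (Finset.univ.filter fun x => f x = c) = {u, v, w} ∧
          r u v ∧ r u w ∧ r v w) ∧
        (∀ c : Fin k, c ∉ T → ∃ u v w : V,
          (Finset.univ.filter fun x => f x = c) = {u, v, w} ∧
          r u v ∧ r v w ∧ r w u) := by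
  intro t ht htk
  have G : DenseMultigraph (edgeCount r) k := by
    refine ⟨fun x y => add_comm _ _, fun x y => ?_, fun x => ?_, hn, fun v => ?_⟩
    · unfold edgeCount
      split_ifs <;> simp
    · simp [edgeCount, hloopless]
    · have h := hδ v
      rw [hn] at h
      have hsum : ∑ u, edgeCount r v u =
          (Finset.univ.filter fun u => r u v).card + (Finset.univ.filter fun u => r v u).card := by
        simp [edgeCount, Finset.sum_add_distrib, add_comm]
      rw [hsum]
      push_cast at h
      have : (4 * k : ℚ) ≤ (Finset.univ.filter fun u => r u v).card +
          (Finset.univ.filter fun u => r v u).card + 1 := by linarith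
      exact_mod_cast this
  obtain ⟨g, hg, h4, h5⟩ := (G.hasFactor hk).exists_tiles G
  obtain ⟨f, hf⟩ := exists_fiber_eq hg
  refine ⟨f, Finset.univ.map (Fin.castLEEmb htk), by simp, fun c _ => ?_, fun c hc => ?_⟩
  · rw [hf]
    exact (h4 c).exists_transitive
  · rw [hf]
    refine (h5 c fun h0 => hc ?_).exists_cyclic
    exact Finset.mem_map.2 ⟨⟨0, ht⟩, Finset.mem_univ _, Fin.ext h0.symm⟩
end

section
/- Let k ≥ 2 and let G be a bipartite graph with Δ(G) ≤ k. Then either G has an equitable k-coloring, or k is odd and G contains K_{k,k} as a subgraph. -/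
open Finset

namespace LihWu

open scoped Classical in
/-- The vertices of `Y` adjacent to some vertex of `T`. -/
noncomputable def nbrs {V : Type*} (G : SimpleGraph V) (Y T : Finset V) : Finset V :=
  Y.filter fun y => ∃ x ∈ T, G.Adj x y

/-- `A` has a proper coloring with the colors `0, …, p - 1`, all classes of size `s` or `s + 1`. -/
def Splits {V : Type*} (G : SimpleGraph V) (s : ℕ) (A : Finset V) (p : ℕ) : Prop :=
  ∃ f : V → ℕ, (∀ v ∈ A, f v < p) ∧ (∀ u ∈ A, ∀ v ∈ A, G.Adj u v → f u ≠ f v) ∧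
    ∀ c < p, s ≤ #{v ∈ A | f v = c} ∧ #{v ∈ A | f v = c} ≤ s + 1

/-- The subgraph induced on `A` has an equitable `k`-coloring. -/
def Equitable {V : Type*} (G : SimpleGraph V) (k : ℕ) (A : Finset V) : Prop :=
  ∃ f : V → Fin k, (∀ u ∈ A, ∀ v ∈ A, G.Adj u v → f u ≠ f v) ∧
    ∀ c c' : Fin k, #{v ∈ A | f v = c} ≤ #{v ∈ A | f v = c'} + 1

variable {V : Type*} {G : SimpleGraph V}

lemma mem_nbrs {Y T : Finset V} {y : V} : y ∈ nbrs G Y T ↔ y ∈ Y ∧ ∃ x ∈ T, G.Adj x y := by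
  simp [nbrs]

lemma nbrs_subset (Y T : Finset V) : nbrs G Y T ⊆ Y := fun _ h => (mem_nbrs.1 h).1

open scoped Classical in
lemma sum_card_adj_comm (X Y : Finset V) :
    ∑ x ∈ X, #{y ∈ Y | G.Adj x y} = ∑ y ∈ Y, #{x ∈ X | G.Adj y x} := by
  have := sum_card_bipartiteAbove_eq_sum_card_bipartiteBelow (s := X) (t := Y) G.Adj
  simpa only [bipartiteAbove, bipartiteBelow, G.adj_comm] using this

lemma splits_one {s : ℕ} {A : Finset V} (hA : ∀ u ∈ A, ∀ v ∈ A, ¬ G.Adj u v)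
    (h₁ : s ≤ #A) (h₂ : #A ≤ s + 1) : Splits G s A 1 := by
  refine ⟨fun _ => 0, by simp, fun u hu v hv h => absurd h (hA u hu v hv), ?_⟩
  intro c hc
  obtain rfl : c = 0 := by omega
  simpa using ⟨h₁, h₂⟩

lemma Splits.equitable {s k : ℕ} {A : Finset V} (hk : 0 < k) (h : Splits G s A k) :
    Equitable G k A := by
  obtain ⟨f, hf, hp, hc⟩ := h
  refine ⟨fun v => if h : f v < k then ⟨f v, h⟩ else ⟨0, hk⟩, ?_, ?_⟩
  · intro u hu v hv huv
    simpa [hf u hu, hf v hv] using hp u hu v hv huv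
  · have key : ∀ c : Fin k,
        ({v ∈ A | (if h : f v < k then (⟨f v, h⟩ : Fin k) else ⟨0, hk⟩) = c} : Finset V)
          = {v ∈ A | f v = c} := by
      intro c
      apply filter_congr
      intro v hv
      simp [hf v hv, Fin.ext_iff]
    intro c c'
    rw [key, key]
    have := (hc c c.2).2
    have := (hc c' c'.2).1
    omega

section DecidableEq

variable [DecidableEq V]

lemma Splits.union {s p q : ℕ} {A B : Finset V} (hd : Disjoint A B)
    (hA : Splits G s A p) (hB : Splits G s B q) : Splits G s (A ∪ B) (p + q) := by
  obtain ⟨f, hf, hfp, hfc⟩ := hA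
  obtain ⟨g, hg, hgp, hgc⟩ := hB
  have hAB : ∀ v ∈ B, v ∉ A := fun v hv hv' => disjoint_left.1 hd hv' hv
  refine ⟨fun v => if v ∈ A then f v else p + g v, ?_, ?_, ?_⟩
  · intro v hv
    by_cases h : v ∈ A
    · have := hf v h
      simp only [h, if_true]; omega
    · have := hg v (by grind)
      simp only [h, if_false]; omega
  · intro u hu v hv huv
    by_cases h : u ∈ A <;> by_cases h' : v ∈ A <;> simp only [h, h', if_true, if_false]
    · exact hfp u h v h' huv
    · have := hf u h
      omega
    · have := hf v h'
      omega
    · have := hgp u (by grind) v (by grind) huv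
      omega
  · intro c hc
    by_cases h : c < p
    · have : ({v ∈ A ∪ B | (if v ∈ A then f v else p + g v) = c} : Finset V)
          = {v ∈ A | f v = c} := by
        ext v
        simp only [mem_filter, mem_union]
        grind
      rw [this]
      exact hfc c h
    · have : ({v ∈ A ∪ B | (if v ∈ A then f v else p + g v) = c} : Finset V)
          = {v ∈ B | g v = c - p} := by
        ext v
        simp only [mem_filter, mem_union]
        grind
      rw [this]
      exact hgc (c - p) (by omega)

lemma splits_of_independent {s : ℕ} (p : ℕ) {A : Finset V}
    (hA : ∀ u ∈ A, ∀ v ∈ A, ¬ G.Adj u v)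
    (h₁ : p * s ≤ #A) (h₂ : #A ≤ p * (s + 1)) : Splits G s A p := by
  induction p generalizing A with
  | zero => exact ⟨fun _ => 0, by simp_all, by simp_all, by simp⟩
  | succ p ih =>
    obtain ⟨c, hc, hc', hc₁, hc₂⟩ :
        ∃ c, s ≤ c ∧ c ≤ s + 1 ∧ p * s + c ≤ #A ∧ #A ≤ p * (s + 1) + c := by
      rw [add_mul] at h₁ h₂
      by_cases h : #A ≤ p * (s + 1) + s
      · exact ⟨s, by omega, by omega, by omega, h⟩
      · refine ⟨s + 1, by omega, by omega, ?_, by omega⟩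
        have : p * s ≤ p * (s + 1) := Nat.mul_le_mul_left _ (by omega)
        omega
    obtain ⟨C, hCA, hC⟩ := exists_subset_card_eq (show c ≤ #A by omega)
    have hcard := card_sdiff_add_card_eq_card hCA
    have := Splits.union (disjoint_sdiff_self_left (x := C) (y := A))
      (ih (A := A \ C) (fun u hu v hv => hA u (by grind) v (by grind)) (by omega) (by omega))
      (splits_one (s := s) (A := C) (fun u hu v hv => hA u (hCA hu) v (hCA hv))
        (by omega) (by omega))
    rwa [sdiff_union_of_subset hCA] at this

lemma Equitable.union {k : ℕ} {A B : Finset V} (hd : Disjoint A B)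
    (hAB : ∀ u ∈ A, ∀ v ∈ B, ¬ G.Adj u v)
    (hA : Equitable G k A) (hB : Equitable G k B) : Equitable G k (A ∪ B) := by
  obtain ⟨f, hfp, hfc⟩ := hA
  obtain ⟨g, hgp, hgc⟩ := hB
  set a : Fin k → ℕ := fun c => #{v ∈ A | f v = c} with ha
  set b : Fin k → ℕ := fun c => #{v ∈ B | g v = c} with hb
  set σ : Equiv.Perm (Fin k) := Tuple.sort a
  set τ : Equiv.Perm (Fin k) := Fin.revPerm.trans (Tuple.sort b)
  have hσ : Monotone (a ∘ σ) := Tuple.monotone_sort a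
  have hτ : Antitone (b ∘ τ) := fun c c' h => Tuple.monotone_sort b (Fin.rev_le_rev.2 h)
  have hBA : ∀ v ∈ B, v ∉ A := fun v hv hv' => disjoint_left.1 hd hv' hv
  refine ⟨fun v => if v ∈ A then σ.symm (f v) else τ.symm (g v), ?_, ?_⟩
  · intro u hu v hv huv
    by_cases h : u ∈ A <;> by_cases h' : v ∈ A <;> simp only [h, h', if_true, if_false]
    · simpa using hfp u h v h' huv
    · exact absurd huv (hAB u h v (by grind))
    · exact absurd huv.symm (hAB v h' u (by grind))
    · simpa using hgp u (by grind) v (by grind) huv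
  · have key : ∀ c, #{v ∈ A ∪ B | (if v ∈ A then σ.symm (f v) else τ.symm (g v)) = c}
        = a (σ c) + b (τ c) := by
      intro c
      rw [filter_union, card_union_of_disjoint (disjoint_filter_filter hd)]
      congr 2
      · refine filter_congr fun v hv => ?_
        simp [hv, Equiv.symm_apply_eq]
      · refine filter_congr fun v hv => ?_
        simp [hBA v hv, Equiv.symm_apply_eq]
    intro c c'
    rw [key, key]
    have h₁ : a (σ c) ≤ a (σ c') + 1 := hfc _ _
    have h₂ : b (τ c) ≤ b (τ c') + 1 := hgc _ _
    rcases le_total c c' with h | h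
    · have : a (σ c) ≤ a (σ c') := hσ h
      omega
    · have : b (τ c) ≤ b (τ c') := hτ h
      omega

open scoped Classical in
lemma card_nbrs_insert_add (Y S : Finset V) (x : V) :
    #(nbrs G Y (insert x S)) + #{y ∈ nbrs G Y S | G.Adj x y}
      = #(nbrs G Y S) + #{y ∈ Y | G.Adj x y} := by
  have h₁ : nbrs G Y (insert x S) = nbrs G Y S ∪ {y ∈ Y | G.Adj x y} := by
    ext y; simp only [mem_nbrs, mem_union, mem_filter, mem_insert]; grind
  have h₂ : ({y ∈ nbrs G Y S | G.Adj x y} : Finset V)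
      = nbrs G Y S ∩ {y ∈ Y | G.Adj x y} := by
    ext y; simp only [mem_nbrs, mem_inter, mem_filter]; grind
  rw [h₁, h₂, card_union_add_card_inter]

/-- Any two vertices of `X` are linked by a path alternating between `X` and `Y`: no nonempty
proper subset of `X` is closed under passing to a vertex with a common neighbor in `Y`. -/
def Linked (G : SimpleGraph V) (X Y : Finset V) : Prop :=
  ∀ S ⊆ X, S.Nonempty → S ≠ X → ∃ x ∈ X, x ∉ S ∧ ∃ y ∈ nbrs G Y S, G.Adj x y

open scoped Classical in
lemma Linked.exists_card_nbrs_le {X Y : Finset V} (hl : Linked G X Y) {K : ℕ}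
    (hX : ∀ x ∈ X, #{y ∈ Y | G.Adj x y} ≤ K + 1) {x₀ : V} (hx₀ : x₀ ∈ X) (t : ℕ)
    (ht : t + 1 ≤ #X) :
    ∃ T ⊆ X, #T = t + 1 ∧ #(nbrs G Y T) ≤ #{y ∈ Y | G.Adj x₀ y} + t * K := by
  induction t with
  | zero => exact ⟨{x₀}, by simpa using hx₀, by simp, by simp [nbrs]⟩
  | succ t ih =>
    obtain ⟨S, hSX, hS, hN⟩ := ih (by omega)
    obtain ⟨x, hx, hxS, y, hy, hxy⟩ := hl S hSX (card_pos.1 (by omega)) (by grind)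
    refine ⟨insert x S, by grind, by grind, ?_⟩
    have h₁ := card_nbrs_insert_add (G := G) Y S x
    have h₂ : 0 < #{y ∈ nbrs G Y S | G.Adj x y} := card_pos.2 ⟨y, by simp [hy, hxy]⟩
    have h₃ := hX x hx
    rw [add_mul]
    omega

open scoped Classical in
/-- In a regular linked bipartite graph some `t`-subset of `X` has few neighbors, since the
alternative would make the second neighborhood of a `(t - 1)`-subset too large. -/
lemma Linked.exists_card_nbrs_le_of_regular {X Y : Finset V} (hl : Linked G X Y) {K t : ℕ}
    (hK : 2 ≤ K) (ht : 2 ≤ t)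
    (hX : ∀ x ∈ X, #{y ∈ Y | G.Adj x y} = K + 1)
    (hY : ∀ y ∈ Y, #{x ∈ X | G.Adj y x} = K + 1)
    (hm : #X = t * (K + 1)) :
    ∃ T ⊆ X, #T = t ∧ #(nbrs G Y T) ≤ t * K := by
  obtain ⟨a, rfl⟩ : ∃ a, t = a + 2 := ⟨t - 2, by omega⟩
  by_contra! hcon
  have hle : a + 2 ≤ #X := by rw [hm]; nlinarith
  obtain ⟨x₀, hx₀⟩ : X.Nonempty := card_pos.1 (by omega)
  obtain ⟨S, hSX, hS, hN⟩ :=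
    hl.exists_card_nbrs_le (fun x hx => (hX x hx).le) hx₀ a (by omega)
  rw [hX x₀ hx₀] at hN
  have hgrow : ∀ x ∈ X, x ∉ S →
      (a + 2) * K + #{y ∈ nbrs G Y S | G.Adj x y} ≤ #(nbrs G Y S) + K := by
    intro x hx hxS
    have h₁ := card_nbrs_insert_add (G := G) Y S x
    have h₂ := hcon (insert x S) (by grind) (by grind)
    rw [hX x hx] at h₁
    omega
  have hlow : (a + 1) * K + 1 ≤ #(nbrs G Y S) := by
    obtain ⟨x, hx, hxS, y, hy, hxy⟩ := hl S hSX (card_pos.1 (by omega)) (by grind)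
    have h₁ := hgrow x hx hxS
    have h₂ : 0 < #{y ∈ nbrs G Y S | G.Adj x y} := card_pos.2 ⟨y, by simp [hy, hxy]⟩
    nlinarith
  have hsum : ∑ x ∈ X, #{y ∈ nbrs G Y S | G.Adj x y} = #(nbrs G Y S) * (K + 1) := by
    rw [sum_card_adj_comm, sum_const_nat]
    exact fun y hy => hY y (mem_nbrs.1 hy).1
  rw [← sum_sdiff hSX] at hsum
  have hin : ∑ x ∈ S, #{y ∈ nbrs G Y S | G.Adj x y} ≤ #S * (K + 1) := by
    refine sum_le_card_nsmul _ _ _ fun x hx => ?_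
    rw [← hX x (hSX hx)]
    exact card_le_card (filter_subset_filter _ (filter_subset _ _))
  have hout : ∑ x ∈ X \ S, #{y ∈ nbrs G Y S | G.Adj x y} ≤ #(X \ S) * 1 := by
    refine sum_le_card_nsmul _ _ _ fun x hx => ?_
    have := hgrow x (by grind) (by grind)
    nlinarith
  have hcard := card_sdiff_add_card_eq_card hSX
  rw [hS] at hin hcard
  have : ((a + 1) * K + 1) * (K + 1) ≤ #(nbrs G Y S) * (K + 1) := Nat.mul_le_mul_right _ hlow
  nlinarith

open scoped Classical in
lemma Linked.exists_card_nbrs_le_or_complete {X Y : Finset V} (hl : Linked G X Y) {K t b : ℕ}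
    (hK : 2 ≤ K) (ht : 1 ≤ t) (htb : t ≤ b)
    (hX : ∀ x ∈ X, #{y ∈ Y | G.Adj x y} ≤ K + 1)
    (hY : ∀ y ∈ Y, #{x ∈ X | G.Adj y x} ≤ K + 1)
    (hm : #X = b * K + t) (hn : #Y = t * K + b) :
    (∃ T ⊆ X, #T = t ∧ #(nbrs G Y T) ≤ t * K) ∨
      (#X = K + 1 ∧ #Y = K + 1 ∧ ∀ x ∈ X, ∀ y ∈ Y, G.Adj x y) := by
  by_cases hreg : ∀ x ∈ X, #{y ∈ Y | G.Adj x y} = K + 1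
  · have hE : #X * (K + 1) = ∑ y ∈ Y, #{x ∈ X | G.Adj y x} := by
      rw [← sum_card_adj_comm, sum_const_nat hreg]
    have hE' : ∑ y ∈ Y, #{x ∈ X | G.Adj y x} ≤ #Y * (K + 1) := sum_le_card_nsmul _ _ _ hY
    have hXY : #X ≤ #Y := Nat.le_of_mul_le_mul_right (hE.trans_le hE') (by omega)
    obtain rfl : b = t := by
      obtain ⟨d, rfl⟩ := Nat.exists_eq_add_of_le htb
      have : d * K ≤ d := by nlinarith
      have : d = 0 := by nlinarith
      omega
    have hregY : ∀ y ∈ Y, #{x ∈ X | G.Adj y x} = K + 1 := by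
      refine (sum_eq_sum_iff_of_le hY).1 ?_
      rw [← hE, sum_const, smul_eq_mul, hm, hn]
    rcases ht.eq_or_lt with rfl | ht
    · right
      refine ⟨by omega, by omega, fun x hx y hy => ?_⟩
      have : ({y ∈ Y | G.Adj x y} : Finset V) = Y :=
        eq_of_subset_of_card_le (filter_subset _ _) (by rw [hreg x hx]; omega)
      rw [← this] at hy
      exact (mem_filter.1 hy).2
    · left
      exact hl.exists_card_nbrs_le_of_regular hK ht hreg hregY (by rw [hm]; ring)
  · push Not at hreg
    obtain ⟨x₀, hx₀, hne⟩ := hreg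
    left
    obtain ⟨a, rfl⟩ : ∃ a, t = a + 1 := ⟨t - 1, by omega⟩
    obtain ⟨T, hT, hTc, hN⟩ := hl.exists_card_nbrs_le hX hx₀ a (by omega)
    refine ⟨T, hT, hTc, hN.trans ?_⟩
    have := hX x₀ hx₀
    rw [add_mul]
    omega

lemma exists_block_count {m s r : ℕ} (j : ℕ) (h : m ≤ j * s + min j r + s) :
    ∃ p ≤ j, p * s + min p r ≤ m ∧ m ≤ p * s + min p r + s := by
  induction j with
  | zero => exact ⟨0, le_rfl, by simp, h⟩
  | succ j ih =>
    by_cases h' : (j + 1) * s + min (j + 1) r ≤ m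
    · exact ⟨j + 1, le_rfl, h', h⟩
    · rw [add_mul] at h'
      obtain ⟨p, hp, hp'⟩ := ih (by omega)
      exact ⟨p, by omega, hp'⟩

/-- Coloring with `p` classes inside `X`, `q` classes inside `Y`, and one mixed class. -/
lemma splits_of_card_nbrs_le {X Y T : Finset V} {s p q b : ℕ} (hXY : Disjoint X Y)
    (hX : ∀ u ∈ X, ∀ v ∈ X, ¬ G.Adj u v) (hY : ∀ u ∈ Y, ∀ v ∈ Y, ¬ G.Adj u v)
    (hTX : T ⊆ X) (hT : #T + b = s) (hN : #(nbrs G Y T) + b ≤ #Y)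
    (hp : p * s + #T ≤ #X) (hp' : #X ≤ p * (s + 1) + #T)
    (hq : q * s + b ≤ #Y) (hq' : #Y ≤ q * (s + 1) + b) :
    Splits G s (X ∪ Y) (p + q + 1) := by
  have hNY : nbrs G Y T ⊆ Y := nbrs_subset _ _
  have h₁ := card_sdiff_add_card_eq_card hNY
  obtain ⟨B, hB, hBc⟩ := exists_subset_card_eq (show b ≤ #(Y \ nbrs G Y T) by omega)
  have hBY : B ⊆ Y := hB.trans sdiff_subset
  have hTB : ∀ u ∈ T, ∀ v ∈ B, ¬ G.Adj u v := by
    intro u hu v hv huv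
    have := mem_sdiff.1 (hB hv)
    exact this.2 (mem_nbrs.2 ⟨this.1, u, hu, huv⟩)
  have h₂ := card_sdiff_add_card_eq_card hTX
  have h₃ := card_sdiff_add_card_eq_card hBY
  have hd := fun v (hv : v ∈ X) (hv' : v ∈ Y) => disjoint_left.1 hXY hv hv'
  have hdTB : Disjoint T B := disjoint_left.2 fun v hv hv' => hd v (hTX hv) (hBY hv')
  have c₁ : Splits G s (X \ T) p := splits_of_independent p
    (fun u hu v hv => hX u (by grind) v (by grind)) (by omega) (by omega)
  have c₂ : Splits G s (Y \ B) q := splits_of_independent q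
    (fun u hu v hv => hY u (by grind) v (by grind)) (by omega) (by omega)
  have c₃ : Splits G s (T ∪ B) 1 := by
    apply splits_one
    · intro u hu v hv huv
      rcases mem_union.1 hu with hu | hu <;> rcases mem_union.1 hv with hv | hv
      · exact hX u (hTX hu) v (hTX hv) huv
      · exact hTB u hu v hv huv
      · exact hTB v hv u hu huv.symm
      · exact hY u (hBY hu) v (hBY hv) huv
    · rw [card_union_of_disjoint hdTB]; omega
    · rw [card_union_of_disjoint hdTB]; omega
  have := (c₁.union (disjoint_left.2 fun v hv hv' => hd v (by grind) (by grind)) c₂).union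
    (disjoint_left.2 fun v hv hv' => by grind) c₃
  convert this using 1
  ext v
  grind

open scoped Classical in
lemma splits_or_complete_of_linked {X Y : Finset V} {K : ℕ} (hK : 1 ≤ K) (hXY : Disjoint X Y)
    (hX : ∀ u ∈ X, ∀ v ∈ X, ¬ G.Adj u v) (hY : ∀ u ∈ Y, ∀ v ∈ Y, ¬ G.Adj u v)
    (hlX : Linked G X Y) (hlY : Linked G Y X)
    (hdX : ∀ x ∈ X, #{y ∈ Y | G.Adj x y} ≤ K + 1)
    (hdY : ∀ y ∈ Y, #{x ∈ X | G.Adj y x} ≤ K + 1) :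
    (∃ s, Splits G s (X ∪ Y) (K + 1)) ∨
      (#X = K + 1 ∧ #Y = K + 1 ∧ ∀ x ∈ X, ∀ y ∈ Y, G.Adj x y) := by
  obtain ⟨s, r, hr, hN⟩ : ∃ s r, r ≤ K ∧ #X + #Y = (K + 1) * s + r :=
    ⟨(#X + #Y) / (K + 1), (#X + #Y) % (K + 1),
      Nat.le_of_lt_succ (Nat.mod_lt _ (by omega)), (Nat.div_add_mod _ _).symm⟩
  rw [add_mul] at hN
  obtain ⟨p, hpK, hp₁, hp₂⟩ := exists_block_count (m := #X) (s := s) (r := r) K (by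
    rw [min_eq_right hr]; omega)
  obtain ⟨i, hi⟩ : ∃ i, i = min p r := ⟨_, rfl⟩
  rw [← hi] at hp₁ hp₂
  obtain ⟨q, rfl⟩ := Nat.exists_eq_add_of_le hpK
  obtain ⟨j, hj⟩ : ∃ j, r = i + j := ⟨r - i, by omega⟩
  obtain ⟨t, hXc⟩ := Nat.exists_eq_add_of_le hp₁
  obtain ⟨b, hb⟩ : ∃ b, t + b = s := ⟨s - t, by omega⟩
  have hYc : #Y = q * s + j + b := by rw [add_mul] at hN; omega
  have useT : (∃ T ⊆ X, #T = t ∧ #(nbrs G Y T) ≤ q * s + j) →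
      ∃ s, Splits G s (X ∪ Y) (p + q + 1) := by
    rintro ⟨T, hT, hTc, hTN⟩
    exact ⟨s, splits_of_card_nbrs_le (b := b) hXY hX hY hT (by omega) (by omega) (by omega)
      (by rw [mul_add]; omega) (by omega) (by rw [mul_add]; omega)⟩
  have useB : (∃ B ⊆ Y, #B = b ∧ #(nbrs G X B) ≤ p * s + i) →
      ∃ s, Splits G s (X ∪ Y) (p + q + 1) := by
    rintro ⟨B, hB, hBc, hBN⟩
    rw [union_comm, add_comm p q]
    exact ⟨s, splits_of_card_nbrs_le (b := t) hXY.symm hY hX hB (by omega) (by omega) (by omega)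
      (by rw [mul_add]; omega) (by omega) (by rw [mul_add]; omega)⟩
  rcases Nat.eq_zero_or_pos t with rfl | ht
  · exact Or.inl (useT ⟨∅, by simp, by simp, by simp [nbrs]⟩)
  rcases Nat.eq_zero_or_pos b with rfl | hb₀
  · exact Or.inl (useB ⟨∅, by simp, by simp, by simp [nbrs]⟩)
  by_cases hT : t * (p + q) + 1 ≤ q * s + j
  · obtain ⟨x₀, hx₀⟩ : X.Nonempty := card_pos.1 (by omega)
    obtain ⟨T, hTX, hTc, hTN⟩ := hlX.exists_card_nbrs_le hdX hx₀ (t - 1) (by omega)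
    refine Or.inl (useT ⟨T, hTX, by omega, hTN.trans ?_⟩)
    have := hdX x₀ hx₀
    obtain ⟨t, rfl⟩ : ∃ a, t = a + 1 := ⟨t - 1, by omega⟩
    rw [add_mul] at hT
    simp only [Nat.add_sub_cancel]
    omega
  by_cases hB : b * (p + q) + 1 ≤ p * s + i
  · obtain ⟨y₀, hy₀⟩ : Y.Nonempty := card_pos.1 (by omega)
    obtain ⟨B, hBY, hBc, hBN⟩ := hlY.exists_card_nbrs_le hdY hy₀ (b - 1) (by omega)
    refine Or.inl (useB ⟨B, hBY, by omega, hBN.trans ?_⟩)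
    have := hdY y₀ hy₀
    obtain ⟨b, rfl⟩ : ∃ a, b = a + 1 := ⟨b - 1, by omega⟩
    rw [add_mul] at hB
    simp only [Nat.add_sub_cancel]
    omega
  have hsum : t * (p + q) + b * (p + q) = p * s + q * s := by rw [← hb]; ring
  obtain rfl : i = 0 := by omega
  obtain rfl : j = 0 := by omega
  have hte : t * (p + q) = q * s := by omega
  have hbe : b * (p + q) = p * s := by omega
  have hK₂ : 2 ≤ p + q := by
    by_contra hlt
    have h1 : p + q = 1 := by omega
    rw [h1] at hte hbe
    rcases Nat.eq_zero_or_pos p with rfl | hp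
    · omega
    · obtain rfl : q = 0 := by omega
      omega
  rcases le_total t b with htb | hbt
  · rcases hlX.exists_card_nbrs_le_or_complete hK₂ ht htb hdX hdY (by omega) (by omega)
      with ⟨T, hTX, hTc, hTN⟩ | h
    · exact Or.inl (useT ⟨T, hTX, hTc, by omega⟩)
    · exact Or.inr h
  · rcases hlY.exists_card_nbrs_le_or_complete hK₂ hb₀ hbt hdY hdX (by omega) (by omega)
      with ⟨B, hBY, hBc, hBN⟩ | ⟨h₁, h₂, h₃⟩
    · exact Or.inl (useB ⟨B, hBY, hBc, by omega⟩)
    · exact Or.inr ⟨h₂, h₁, fun x hx y hy => (h₃ y hy x hx).symm⟩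

lemma linked_of_connected {X Y : Finset V} (hXY : Disjoint X Y)
    (hX : ∀ u ∈ X, ∀ v ∈ X, ¬ G.Adj u v) (hY : ∀ u ∈ Y, ∀ v ∈ Y, ¬ G.Adj u v)
    (hconn : ∀ S ⊂ X ∪ Y, S.Nonempty → ∃ u ∈ S, ∃ v ∈ (X ∪ Y) \ S, G.Adj u v) :
    Linked G X Y := by
  intro S hSX hS hne
  have hNY : nbrs G Y S ⊆ Y := nbrs_subset _ _
  obtain ⟨x, hx, hxS⟩ := exists_of_ssubset (hSX.ssubset_of_ne hne)
  have hd := fun v (hv : v ∈ X) (hv' : v ∈ Y) => disjoint_left.1 hXY hv hv'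
  obtain ⟨u, hu, v, hv, huv⟩ := hconn (S ∪ nbrs G Y S)
    (Finset.ssubset_iff_subset_ne.2 ⟨union_subset_union hSX hNY, fun h => by
      have : x ∈ S ∪ nbrs G Y S := by rw [h]; exact mem_union_left _ hx
      grind⟩) (hS.mono subset_union_left)
  simp only [mem_sdiff, mem_union, not_or] at hu hv
  obtain ⟨hv, hvS, hvN⟩ := hv
  rcases hu with hu | hu
  · rcases hv with hv | hv
    · exact absurd huv (hX u (hSX hu) v hv)
    · exact absurd (mem_nbrs.2 ⟨hv, u, hu, huv⟩) hvN
  · rcases hv with hv | hv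
    · exact ⟨v, hv, hvS, u, hu, huv.symm⟩
    · exact absurd huv (hY u (hNY hu) v hv)

open scoped Classical in
lemma equitable_of_bipartite {K : ℕ} (hK : 1 ≤ K) (f : G.Coloring (Fin 2))
    (A : Finset V) (hdeg : ∀ v, #{w ∈ A | G.Adj v w} ≤ K + 1)
    (hG : ¬ (Odd (K + 1) ∧ ∃ A B : Finset V, Disjoint A B ∧ #A = K + 1 ∧ #B = K + 1 ∧
      ∀ a ∈ A, ∀ b ∈ B, G.Adj a b)) :
    Equitable G (K + 1) A := by
  induction A using Finset.strongInduction with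
  | H A ih =>
  by_cases hconn : ∀ S ⊂ A, S.Nonempty → ∃ u ∈ S, ∃ v ∈ A \ S, G.Adj u v
  · obtain ⟨X, hXdef⟩ : ∃ X : Finset V, X = {v ∈ A | f v = 0} := ⟨_, rfl⟩
    obtain ⟨Y, hYdef⟩ : ∃ Y : Finset V, Y = {v ∈ A | f v = 1} := ⟨_, rfl⟩
    have hA : A = X ∪ Y := by
      ext v
      have : f v = 0 ∨ f v = 1 := by omega
      grind
    have hXY : Disjoint X Y := disjoint_left.2 fun v hv hv' => by
      have h₀ : f v = 0 := by grind
      have h₁ : f v = 1 := by grind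
      exact absurd (h₀.symm.trans h₁) (by decide)
    have hX : ∀ u ∈ X, ∀ v ∈ X, ¬ G.Adj u v := fun u hu v hv h => f.valid h (by grind)
    have hY : ∀ u ∈ Y, ∀ v ∈ Y, ¬ G.Adj u v := fun u hu v hv h => f.valid h (by grind)
    have hlX : Linked G X Y := linked_of_connected hXY hX hY (by rwa [← hA])
    have hlY : Linked G Y X := linked_of_connected hXY.symm hY hX (by rwa [union_comm, ← hA])
    have hdX : ∀ x ∈ X, #{y ∈ Y | G.Adj x y} ≤ K + 1 := fun x _ =>
      (card_le_card (filter_subset_filter _ (by grind))).trans (hdeg x)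
    have hdY : ∀ y ∈ Y, #{x ∈ X | G.Adj y x} ≤ K + 1 := fun y _ =>
      (card_le_card (filter_subset_filter _ (by grind))).trans (hdeg y)
    rw [hA]
    rcases splits_or_complete_of_linked hK hXY hX hY hlX hlY hdX hdY with ⟨s, h⟩ | ⟨h₁, h₂, h₃⟩
    · exact h.equitable (by omega)
    · have hodd : ¬ Odd (K + 1) := fun ho => hG ⟨ho, X, Y, hXY, h₁, h₂, h₃⟩
      obtain ⟨h, hh⟩ := Nat.not_odd_iff_even.1 hodd
      have := (splits_of_independent (s := 2) h hX (by omega) (by omega)).union hXY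
        (splits_of_independent (s := 2) h hY (by omega) (by omega))
      rw [← hh] at this
      exact this.equitable (by omega)
  · push Not at hconn
    obtain ⟨S, hSA, hS, hno⟩ := hconn
    have hmono : ∀ B ⊆ A, ∀ v, #{w ∈ B | G.Adj v w} ≤ K + 1 := fun B hB v =>
      (card_le_card (filter_subset_filter _ hB)).trans (hdeg v)
    have := (ih S hSA (hmono S hSA.1)).union disjoint_sdiff_self_right hno
      (ih (A \ S) (sdiff_ssubset hSA.1 hS) (hmono _ sdiff_subset))
    rwa [union_sdiff_of_subset hSA.1] at this

end DecidableEq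

end LihWu

/-- **Lih–Wu: the Chen–Lih–Wu Conjecture for bipartite graphs.** Let `k ≥ 2` and let `G`
be a bipartite (i.e. 2-colorable) graph with `Δ(G) ≤ k`. Then either `G` has an equitable
`k`-coloring, or `k` is odd and `G` contains `K_{k,k}` as a subgraph. -/
theorem lih_wu_bipartite {V : Type*} [Fintype V] (G : SimpleGraph V)
    [DecidableRel G.Adj] (k : ℕ) (hk : 2 ≤ k)
    (hbip : G.Colorable 2) (hΔ : G.maxDegree ≤ k) :
    (∃ f : V → Fin k,
      (∀ ⦃u v : V⦄, G.Adj u v → f u ≠ f v) ∧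
      (∀ c c' : Fin k,
        (Finset.univ.filter fun v => f v = c).card ≤
          (Finset.univ.filter fun v => f v = c').card + 1)) ∨
    (Odd k ∧ ∃ A B : Finset V, Disjoint A B ∧ A.card = k ∧ B.card = k ∧
      ∀ a ∈ A, ∀ b ∈ B, G.Adj a b) := by
  classical
  by_contra! hcon
  obtain ⟨hne, hG⟩ := hcon
  obtain ⟨K, rfl⟩ : ∃ K, k = K + 1 := ⟨k - 1, by omega⟩
  obtain ⟨f⟩ := hbip
  obtain ⟨g, hg, hc⟩ := LihWu.equitable_of_bipartite (K := K) (by omega) f Finset.univ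
    (fun v => by
      have := (G.degree_le_maxDegree v).trans hΔ
      rw [← G.card_neighborFinset_eq_degree, G.neighborFinset_eq_filter] at this
      exact (Finset.card_le_card (by intro w; simp)).trans this)
    (fun ⟨ho, A, B, hd, hA, hB, h⟩ => by
      obtain ⟨a, ha, b, hb, hab⟩ := hG ho A B hd hA hB
      exact hab (h a ha b hb))
  obtain ⟨c, c', h⟩ := hne g fun u v huv => hg u (Finset.mem_univ u) v (Finset.mem_univ v) huv
  have := hc c c'
  omega
end
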